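/- arXiv:math/0105072 — 5 statements merged into one kernel-verified Lean document; each statement's English description precedes it below -/
import Mathlib

section
/- For every integer d ≥ 1 and every integer N ≥ 0, as t → 0+ one has Σ_{k=0}^∞ μ_{k,d} e^{-t k(k+d-1)} = Σ_{n=0}^{N} a_{n,d} t^{n-d/2} + o(t^{N-d/2}), where a_{0,d} = 2π^{(d+1)/2} / ((4π)^{d/2} Γ((d+1)/2)) and, for n ≥ 1, a_{n,d} = A_{n,d}(2n). -/
open Finset

/-- Multiplicity of the k-th eigenvalue of the Laplacian on `S^d`. -/
noncomputable def sphMu (k d : ℕ) : ℝ :=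
  if k = 0 then 1 else
    ((2 * k + d : ℝ) - 1) * (Nat.factorial (k + d - 2)) /
      (Nat.factorial k * Nat.factorial (d - 1))

/-- The k-th eigenvalue of the Laplacian on `S^d`. -/
def sphLam (k d : ℕ) : ℕ := k * (k + d - 1)

/-- The expression `A_{n,d}(ω)` from the paper. -/
noncomputable def A (n d ω : ℕ) : ℝ :=
  ∑ j ∈ Icc 1 ω,
    (2 * (-1 : ℝ) ^ n * Real.Gamma ((ω : ℝ) + d / 2 + 1) /
      (Nat.factorial (ω - j) * Nat.factorial (j + n) * Nat.factorial (2 * j + d))) *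
    ∑ k ∈ Icc 1 j,
      (-1 : ℝ) ^ k * (Nat.choose (2 * j + d - 1) (j - k)) * sphMu k d *
        (sphLam k d : ℝ) ^ (j + n)

open Real in
/-- The heat trace coefficients of `S^d`: `a_{0,d}` is the volume term
`vol(S^d)/(4π)^{d/2}` and `a_{n,d} = A_{n,d}(2n)` for `n ≥ 1`. -/
noncomputable def heatCoeff (n d : ℕ) : ℝ :=
  if n = 0 then
    2 * π ^ (((d : ℝ) + 1) / 2) / ((4 * π) ^ ((d : ℝ) / 2) * Real.Gamma (((d : ℝ) + 1) / 2))
  else A n d (2 * n)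


open Polynomial in
/-- polynomial times Gaussian -/
noncomputable def hphi (p : ℝ[X]) (x : ℝ) : ℝ := p.eval x * Real.exp (-x ^ 2)

open Polynomial in
/-- derivative on polynomial symbols -/
noncomputable def hD (p : ℝ[X]) : ℝ[X] := derivative p - C 2 * X * p

open Polynomial in
lemma hphi_hasDerivAt (p : ℝ[X]) (x : ℝ) : HasDerivAt (hphi p) (hphi (hD p) x) x := by
  have h1 := p.hasDerivAt x
  have h2 : HasDerivAt (fun x : ℝ => Real.exp (-x ^ 2)) (Real.exp (-x ^ 2) * (-(2 * x))) x := by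
    have := (((hasDerivAt_id x).pow 2).neg).exp
    simpa using this
  have := h1.mul h2
  refine this.congr_deriv ?_
  simp [hphi, hD]
  ring

lemma hphi_continuous (p : Polynomial ℝ) : Continuous (hphi p) :=
  continuous_iff_continuousAt.2 fun x => (hphi_hasDerivAt p x).continuousAt

open Polynomial in
lemma hphi_bound (p : ℝ[X]) : ∃ C : ℝ, 0 ≤ C ∧ ∀ x, |hphi p x| ≤ C * Real.exp (-|x|) := by
  induction p using Polynomial.induction_on' with
  | add p q hp hq =>
    obtain ⟨C, hC, h⟩ := hp
    obtain ⟨C', hC', h'⟩ := hq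
    refine ⟨C + C', by positivity, fun x => ?_⟩
    have : hphi (p + q) x = hphi p x + hphi q x := by simp [hphi]; ring
    rw [this, add_mul]
    exact (abs_add_le _ _).trans (add_le_add (h x) (h' x))
  | monomial n a =>
    refine ⟨|a| * (n.factorial * Real.exp 1), by positivity, fun x => ?_⟩
    have h1 : |x| ^ n ≤ n.factorial * Real.exp |x| := by
      have := Real.pow_div_factorial_le_exp |x| (abs_nonneg x) n
      rw [div_le_iff₀ (by positivity)] at this
      linarith
    have h2 : Real.exp |x| * Real.exp (-x ^ 2) ≤ Real.exp 1 * Real.exp (-|x|) := by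
      rw [← Real.exp_add, ← Real.exp_add, Real.exp_le_exp]
      nlinarith [sq_nonneg (|x| - 1), sq_abs x]
    simp only [hphi, eval_monomial, abs_mul, abs_pow, Real.abs_exp]
    calc |a| * |x| ^ n * Real.exp (-x ^ 2) ≤ |a| * (n.factorial * Real.exp |x|) * Real.exp (-x ^ 2) := by
          gcongr
      _ = |a| * n.factorial * (Real.exp |x| * Real.exp (-x ^ 2)) := by ring
      _ ≤ |a| * n.factorial * (Real.exp 1 * Real.exp (-|x|)) := by gcongr
      _ = _ := by ring

lemma hphi_taylor (K : ℕ) : ∀ p : Polynomial ℝ, ∃ C : ℝ, 0 ≤ C ∧ ∀ a y : ℝ, |y| ≤ 1 →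
    |hphi p (a + y) - ∑ b ∈ Finset.range K, hphi (hD^[b] p) a * (y ^ b / b.factorial)|
      ≤ C * Real.exp (-|a|) * |y| ^ K := by
  induction K with
  | zero =>
    intro p
    obtain ⟨C, hC, h⟩ := hphi_bound p
    refine ⟨C * Real.exp 1, by positivity, fun a y hy => ?_⟩
    simp only [Finset.range_zero, Finset.sum_empty, sub_zero, pow_zero, mul_one]
    refine (h _).trans ?_
    rw [mul_assoc, ← Real.exp_add]
    gcongr
    have := abs_sub_abs_le_abs_sub a (-y)
    rw [abs_neg, sub_neg_eq_add] at this
    linarith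
  | succ K ih =>
    intro p
    obtain ⟨C, hC, h⟩ := ih (hD p)
    refine ⟨C, hC, fun a y hy => ?_⟩
    set R : ℝ → ℝ := fun z =>
      hphi p (a + z) - ∑ b ∈ Finset.range (K + 1), hphi (hD^[b] p) a * (z ^ b / b.factorial)
    have hR : ∀ z, HasDerivAt R (hphi (hD p) (a + z) -
        ∑ b ∈ Finset.range K, hphi (hD^[b] (hD p)) a * (z ^ b / b.factorial)) z := by
      intro z
      have h1 : HasDerivAt (fun z => hphi p (a + z)) (hphi (hD p) (a + z)) z :=
        HasDerivAt.comp_const_add a z (hphi_hasDerivAt p (a + z))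
      refine h1.sub ?_
      simp only [Finset.sum_range_succ']
      simp only [pow_zero]
      refine HasDerivAt.add_const _ ?_
      refine HasDerivAt.fun_sum fun b _ => ?_
      rw [← Function.iterate_succ_apply]
      refine HasDerivAt.const_mul _ ?_
      have := (hasDerivAt_pow (b + 1) z).div_const ((b + 1).factorial : ℝ)
      refine this.congr_deriv ?_
      rw [Nat.factorial_succ]
      push_cast
      field_simp
    have hb : ∀ z ∈ Set.Icc (-|y|) |y|, ‖hphi (hD p) (a + z) -
        ∑ b ∈ Finset.range K, hphi (hD^[b] (hD p)) a * (z ^ b / b.factorial)‖ ≤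
        C * Real.exp (-|a|) * |y| ^ K := by
      intro z hz
      have hz' : |z| ≤ |y| := abs_le.2 hz
      refine (h a z (hz'.trans hy)).trans ?_
      gcongr
    have := (convex_Icc (-|y|) |y|).norm_image_sub_le_of_norm_hasDerivWithin_le
      (fun z _ => (hR z).hasDerivWithinAt) hb (x := 0) (y := y) (by simp) (abs_le.1 le_rfl)
    have h0 : R 0 = 0 := by
      simp [R, Finset.sum_range_succ']
    rw [h0, sub_zero, sub_zero] at this
    rw [pow_succ, ← mul_assoc]
    exact this

/-- coefficients of `sinh(v/2)/(v/2)` -/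
noncomputable def hc (b : ℕ) : ℝ := (1 - (-1) ^ (b + 1)) / (2 ^ (b + 1) * (b + 1).factorial)

lemma hphi_interval (K : ℕ) (p : Polynomial ℝ) : ∃ C : ℝ, 0 ≤ C ∧ ∀ a h : ℝ, 0 < h → h ≤ 1 →
    |(∫ y in Set.Ioc (a - h / 2) (a + h / 2), hphi p y)
      - h * ∑ b ∈ Finset.range K, hc b * h ^ b * hphi (hD^[b] p) a|
      ≤ C * Real.exp (-|a|) * h ^ K * h := by
  obtain ⟨C, hC, H⟩ := hphi_taylor K p
  refine ⟨C, hC, fun a h h0 h1 => ?_⟩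
  rw [← intervalIntegral.integral_of_le (by linarith)]
  have e1 : ∫ y in (a - h / 2)..(a + h / 2), hphi p y = ∫ y in (-(h / 2))..(h / 2), hphi p (a + y) := by
    rw [intervalIntegral.integral_comp_add_left]
    simp [sub_eq_add_neg]
  have e2 : h * ∑ b ∈ Finset.range K, hc b * h ^ b * hphi (hD^[b] p) a =
      ∫ y in (-(h / 2))..(h / 2), ∑ b ∈ Finset.range K, hphi (hD^[b] p) a * (y ^ b / b.factorial) := by
    rw [intervalIntegral.integral_finsetSum]
    · rw [Finset.mul_sum]
      refine Finset.sum_congr rfl fun b _ => ?_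
      rw [intervalIntegral.integral_const_mul, intervalIntegral.integral_div, integral_pow,
        neg_pow (h / 2), div_pow, hc, Nat.factorial_succ]
      push_cast
      field_simp
      ring
    · intro b _
      apply Continuous.intervalIntegrable
      fun_prop
  rw [e1, e2, ← intervalIntegral.integral_sub]
  · have := intervalIntegral.norm_integral_le_of_norm_le_const (a := -(h / 2)) (b := h / 2)
      (f := fun y => hphi p (a + y) -
        ∑ b ∈ Finset.range K, hphi (hD^[b] p) a * (y ^ b / b.factorial))
      (C := C * Real.exp (-|a|) * h ^ K) ?_
    · refine this.trans (le_of_eq ?_)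
      rw [show h / 2 - -(h / 2) = h by ring, abs_of_pos h0]
    · intro y hy
      rw [Set.uIoc_of_le (by linarith)] at hy
      have hy' : |y| ≤ h := abs_le.2 ⟨by linarith [hy.1], by linarith [hy.2]⟩
      refine (H a y (hy'.trans h1)).trans ?_
      gcongr
  · apply Continuous.intervalIntegrable
    exact (hphi_continuous p).comp (by fun_prop)
  · apply Continuous.intervalIntegrable
    fun_prop

lemma hexp_integrable : MeasureTheory.Integrable (fun y : ℝ => Real.exp (-|y|)) := by
  refine (integrable_inv_one_add_sq.const_mul 2).mono' (by fun_prop)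
    (Filter.Eventually.of_forall fun y => ?_)
  rw [Real.norm_eq_abs, Real.abs_exp, Real.exp_neg, ← div_eq_mul_inv,
    le_div_iff₀ (by positivity), inv_mul_le_iff₀ (Real.exp_pos _)]
  nlinarith [Real.quadratic_le_exp_of_nonneg (abs_nonneg y), sq_abs y, abs_nonneg y]

lemma hphi_integrable (p : Polynomial ℝ) : MeasureTheory.Integrable (hphi p) := by
  obtain ⟨C, hC, h⟩ := hphi_bound p
  exact (hexp_integrable.const_mul C).mono' (hphi_continuous p).aestronglyMeasurable
    (Filter.Eventually.of_forall h)

/-- A lattice: the half-open cells of size `h` around `x i * h` tile `U`. -/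
def hTile {ι : Type} (x : ι → ℝ) (U : Set ℝ) : Prop :=
  ∀ h : ℝ, 0 < h → Pairwise (Function.onFun Disjoint
      fun i => Set.Ioc (x i * h - h / 2) (x i * h + h / 2)) ∧
    (⋃ i, Set.Ioc (x i * h - h / 2) (x i * h + h / 2)) = U

lemma hTile_hasSum {ι : Type} [Countable ι] {x : ι → ℝ} {U : Set ℝ} (hx : hTile x U)
    {f : ℝ → ℝ} (hf : MeasureTheory.Integrable f) {h : ℝ} (h0 : 0 < h) :
    HasSum (fun i => ∫ y in Set.Ioc (x i * h - h / 2) (x i * h + h / 2), f y) (∫ y in U, f y) := by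
  obtain ⟨h1, h2⟩ := hx h h0
  have := MeasureTheory.hasSum_integral_iUnion (μ := MeasureTheory.volume) (f := f)
    (s := fun i => Set.Ioc (x i * h - h / 2) (x i * h + h / 2))
    (fun i => measurableSet_Ioc) h1 hf.integrableOn
  rwa [h2] at this

lemma hexp_cell {a h : ℝ} (h0 : 0 < h) (h1 : h ≤ 1) :
    Real.exp (-|a|) * h ≤
      Real.exp 1 * ∫ y in Set.Ioc (a - h / 2) (a + h / 2), Real.exp (-|y|) := by
  have : ∫ y in Set.Ioc (a - h / 2) (a + h / 2), Real.exp (-1) * Real.exp (-|a|) ≤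
      ∫ y in Set.Ioc (a - h / 2) (a + h / 2), Real.exp (-|y|) := by
    refine MeasureTheory.setIntegral_mono_on ?_ hexp_integrable.integrableOn measurableSet_Ioc ?_
    · exact MeasureTheory.integrableOn_const (by simp)
    · intro y hy
      rw [← Real.exp_add, Real.exp_le_exp]
      have h3 := abs_sub_abs_le_abs_sub y a
      have : |y - a| ≤ 1 := abs_le.2 ⟨by linarith [hy.1], by linarith [hy.2]⟩
      linarith
  rw [MeasureTheory.setIntegral_const] at this
  simp only [MeasureTheory.measureReal_def, Real.volume_Ioc, smul_eq_mul] at this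
  rw [show a + h / 2 - (a - h / 2) = h by ring, ENNReal.toReal_ofReal h0.le] at this
  calc Real.exp (-|a|) * h = Real.exp 1 * (h * (Real.exp (-1) * Real.exp (-|a|))) := by
        rw [Real.exp_neg 1]; field_simp
    _ ≤ _ := by gcongr

lemma hexp_summable {ι : Type} [Countable ι] {x : ι → ℝ} {U : Set ℝ} (hx : hTile x U)
    {h : ℝ} (h0 : 0 < h) (h1 : h ≤ 1) : Summable fun i => Real.exp (-|x i * h|) * h := by
  refine Summable.of_nonneg_of_le (fun i => by positivity) (fun i => hexp_cell h0 h1) ?_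
  exact ((hTile_hasSum hx hexp_integrable h0).summable).mul_left _

lemma hexp_tsum {ι : Type} [Countable ι] {x : ι → ℝ} {U : Set ℝ} (hx : hTile x U)
    {h : ℝ} (h0 : 0 < h) (h1 : h ≤ 1) : ∑' i, Real.exp (-|x i * h|) * h ≤
      Real.exp 1 * ∫ y in U, Real.exp (-|y|) := by
  have := hTile_hasSum hx hexp_integrable h0
  rw [← this.tsum_eq, ← tsum_mul_left]
  exact Summable.tsum_le_tsum (fun i => hexp_cell h0 h1) (hexp_summable hx h0 h1)
    (this.summable.mul_left _)

lemma hphi_summable {ι : Type} [Countable ι] {x : ι → ℝ} {U : Set ℝ} (hx : hTile x U)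
    {h : ℝ} (h0 : 0 < h) (h1 : h ≤ 1) (p : Polynomial ℝ) :
    Summable fun i => hphi p (x i * h) := by
  obtain ⟨C, hC, H⟩ := hphi_bound p
  have h2 := (hexp_summable hx h0 h1).mul_left (C / h)
  refine Summable.of_norm_bounded h2 fun i => (H _).trans (le_of_eq ?_)
  field_simp

/-- normalised lattice sum -/
noncomputable def hS {ι : Type} (x : ι → ℝ) (p : Polynomial ℝ) (h : ℝ) : ℝ :=
  h * ∑' i, hphi p (x i * h)

lemma hS_main {ι : Type} [Countable ι] {x : ι → ℝ} {U : Set ℝ} (hx : hTile x U)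
    (K : ℕ) (p : Polynomial ℝ) : ∃ C : ℝ, ∀ h : ℝ, 0 < h → h ≤ 1 →
    |∑ b ∈ Finset.range K, hc b * h ^ b * hS x (hD^[b] p) h - ∫ y in U, hphi p y| ≤ C * h ^ K := by
  obtain ⟨C, hC, H⟩ := hphi_interval K p
  refine ⟨C * (Real.exp 1 * ∫ y in U, Real.exp (-|y|)), fun h h0 h1 => ?_⟩
  have s1 := hTile_hasSum hx (hphi_integrable p) h0
  have s2 : HasSum (fun i => h * ∑ b ∈ Finset.range K, hc b * h ^ b * hphi (hD^[b] p) (x i * h))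
      (∑ b ∈ Finset.range K, hc b * h ^ b * hS x (hD^[b] p) h) := by
    have : ∑ b ∈ Finset.range K, hc b * h ^ b * hS x (hD^[b] p) h =
        h * ∑ b ∈ Finset.range K, hc b * h ^ b * ∑' i, hphi (hD^[b] p) (x i * h) := by
      rw [Finset.mul_sum]
      refine Finset.sum_congr rfl fun b _ => ?_
      rw [hS]; ring
    rw [this]
    refine HasSum.mul_left _ (hasSum_sum fun b _ => HasSum.mul_left _ ?_)
    exact (hphi_summable hx h0 h1 _).hasSum
  have s3 := s1.sub s2
  rw [abs_sub_comm, ← s3.tsum_eq, ← Real.norm_eq_abs]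
  have s4 := (hexp_summable hx h0 h1).mul_left (C * h ^ K)
  refine (tsum_of_norm_bounded s4.hasSum fun i => ?_).trans ?_
  · refine (H (x i * h) h h0 h1).trans (le_of_eq ?_)
    ring
  · rw [tsum_mul_left]
    calc C * h ^ K * ∑' i, Real.exp (-|x i * h|) * h ≤
        C * h ^ K * (Real.exp 1 * ∫ y in U, Real.exp (-|y|)) := by
          have := hexp_tsum hx h0 h1
          gcongr
      _ = _ := by ring

/-- the generating series of `sinh(v/2)/(v/2)` -/
noncomputable def hW : PowerSeries ℝ := PowerSeries.mk hc

lemma hW_const : PowerSeries.constantCoeff hW = 1 := by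
  simp [hW, hc, ← PowerSeries.coeff_zero_eq_constantCoeff_apply]

lemma hW_inv : hW⁻¹ * hW = 1 := PowerSeries.inv_mul_cancel _ (by rw [hW_const]; simp)

open Asymptotics Topology in
lemma hS_expand {ι : Type} [Countable ι] {x : ι → ℝ} {U : Set ℝ} (hx : hTile x U)
    (K : ℕ) (p : Polynomial ℝ) :
    (fun h => hS x p h - ∑ b ∈ Finset.range K,
      PowerSeries.coeff b hW⁻¹ * (∫ y in U, hphi (hD^[b] p) y) * h ^ b)
      =O[𝓝[>] 0] fun h => h ^ K := by
  have ev : ∀ᶠ h : ℝ in 𝓝[>] 0, 0 < h ∧ h ≤ 1 :=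
    Ioc_mem_nhdsGT one_pos
  have main : ∀ K p, (fun h => ∑ b ∈ Finset.range K, hc b * h ^ b * hS x (hD^[b] p) h -
      ∫ y in U, hphi p y) =O[𝓝[>] 0] fun h => h ^ K := by
    intro K p
    obtain ⟨C, H⟩ := hS_main hx K p
    refine IsBigO.of_bound C ?_
    filter_upwards [ev] with h hh
    rw [Real.norm_eq_abs, Real.norm_eq_abs, abs_of_pos (pow_pos hh.1 K)]
    exact H h hh.1 hh.2
  have key : (fun h => ∑ b' ∈ Finset.range K, PowerSeries.coeff b' hW⁻¹ * (h ^ b' *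
      (∑ b ∈ Finset.range (K - b'), hc b * h ^ b * hS x (hD^[b] (hD^[b'] p)) h -
      ∫ y in U, hphi (hD^[b'] p) y))) =O[𝓝[>] 0] fun h => h ^ K := by
    refine IsBigO.fun_sum fun b' hb' => IsBigO.const_mul_left ?_ _
    have := (isBigO_refl (fun h : ℝ => h ^ b') (𝓝[>] 0)).mul (main (K - b') (hD^[b'] p))
    refine this.congr_right fun h => ?_
    rw [← pow_add]
    congr 1
    have := Finset.mem_range.1 hb'
    omega
  rcases Nat.eq_zero_or_pos K with rfl | hK
  · have := main 1 p
    have h2 : (fun h => hS x p h - ∫ y in U, hphi p y) =O[𝓝[>] 0] fun h : ℝ => (1 : ℝ) := by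
      have h3 : (fun h : ℝ => h ^ 1) =O[𝓝[>] 0] fun h : ℝ => (1 : ℝ) := by
        refine IsBigO.of_bound 1 ?_
        filter_upwards [ev] with h hh
        rw [Real.norm_eq_abs, abs_of_pos (by simpa using hh.1)]
        simpa using hh.2
      refine (this.trans h3).congr_left fun h => ?_
      simp [hc]
    have h4 := h2.add (isBigO_const_const (∫ y in U, hphi p y) (one_ne_zero (α := ℝ)) (𝓝[>] (0 : ℝ)))
    simpa using h4
  refine key.congr_left fun h => ?_
  have e1 : ∀ b' ∈ Finset.range K, PowerSeries.coeff b' hW⁻¹ * (h ^ b' *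
      (∑ b ∈ Finset.range (K - b'), hc b * h ^ b * hS x (hD^[b] (hD^[b'] p)) h -
      ∫ y in U, hphi (hD^[b'] p) y)) =
      ∑ b ∈ Finset.range (K - b'), (PowerSeries.coeff b' hW⁻¹ * PowerSeries.coeff b hW) *
          (h ^ (b' + b) * hS x (hD^[b' + b] p) h) -
        PowerSeries.coeff b' hW⁻¹ * (∫ y in U, hphi (hD^[b'] p) y) * h ^ b' := by
    intro b' _
    rw [mul_sub, mul_sub, Finset.mul_sum, Finset.mul_sum]
    congr 1
    · refine Finset.sum_congr rfl fun b _ => ?_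
      rw [add_comm b' b, Function.iterate_add_apply, hW, PowerSeries.coeff_mk]
      ring
    · ring
  rw [Finset.sum_congr rfl e1, Finset.sum_sub_distrib]
  congr 1
  rw [← Finset.sum_range_diag_flip K (fun b' b =>
    (PowerSeries.coeff b' hW⁻¹ * PowerSeries.coeff b hW) *
          (h ^ (b' + b) * hS x (hD^[b' + b] p) h))]
  have e2 : ∀ m ∈ Finset.range K, (∑ k ∈ Finset.range (m + 1),
      (PowerSeries.coeff k hW⁻¹ * PowerSeries.coeff (m - k) hW) *
          (h ^ (k + (m - k)) * hS x (hD^[k + (m - k)] p) h)) =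
      PowerSeries.coeff m (1 : PowerSeries ℝ) * (h ^ m * hS x (hD^[m] p) h) := by
    intro m _
    rw [← hW_inv, PowerSeries.coeff_mul, Finset.Nat.sum_antidiagonal_eq_sum_range_succ_mk,
      Finset.sum_mul]
    refine Finset.sum_congr rfl fun k hk => ?_
    have : k + (m - k) = m := by have := Finset.mem_range.1 hk; omega
    rw [this]
  rw [Finset.sum_congr rfl e2, Finset.sum_eq_single 0]
  · simp
  · intro m _ hm
    rw [PowerSeries.coeff_one, if_neg hm, zero_mul]
  · intro h; simp at h; omega

lemma hTile_half : hTile (fun k : ℕ => (k : ℝ) + 1 / 2) (Set.Ioi 0) := by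
  intro h h0
  refine ⟨fun i j hij => ?_, ?_⟩
  · rw [Function.onFun, Set.disjoint_left]
    intro y hy hy'
    apply hij
    simp only [Set.mem_Ioc] at hy hy'
    have h1 : (i : ℝ) < j + 1 := by
      by_contra hc
      push Not at hc
      nlinarith [mul_le_mul_of_nonneg_right hc h0.le]
    have h2 : (j : ℝ) < i + 1 := by
      by_contra hc
      push Not at hc
      nlinarith [mul_le_mul_of_nonneg_right hc h0.le]
    norm_cast at h1 h2
    omega
  · ext y
    simp only [Set.mem_iUnion, Set.mem_Ioc, Set.mem_Ioi]
    constructor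
    · rintro ⟨i, hi, -⟩
      have : 0 ≤ (i : ℝ) * h := by positivity
      nlinarith
    · intro hy
      have hp : 0 < y / h := div_pos hy h0
      have hc : 0 < ⌈y / h⌉₊ := Nat.ceil_pos.2 hp
      obtain ⟨n, hn⟩ : ∃ n, ⌈y / h⌉₊ = n + 1 := ⟨_, (Nat.succ_pred_eq_of_pos hc).symm⟩
      rw [Nat.ceil_eq_iff (by omega)] at hn
      obtain ⟨h1, h2⟩ := hn
      simp only [Nat.add_sub_cancel] at h1
      rw [lt_div_iff₀ h0] at h1
      rw [div_le_iff₀ h0] at h2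
      push_cast at h2
      refine ⟨n, by linarith, by linarith⟩

lemma hTile_int : hTile (fun k : ℤ => (k : ℝ)) Set.univ := by
  intro h h0
  refine ⟨fun i j hij => ?_, ?_⟩
  · rw [Function.onFun, Set.disjoint_left]
    intro y hy hy'
    apply hij
    simp only [Set.mem_Ioc] at hy hy'
    have h1 : (i : ℝ) < j + 1 := by
      by_contra hc
      push Not at hc
      nlinarith [mul_le_mul_of_nonneg_right hc h0.le]
    have h2 : (j : ℝ) < i + 1 := by
      by_contra hc
      push Not at hc
      nlinarith [mul_le_mul_of_nonneg_right hc h0.le]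
    norm_cast at h1 h2
    omega
  · ext y
    simp only [Set.mem_iUnion, Set.mem_Ioc, Set.mem_univ, iff_true]
    have h1 := Int.le_ceil (y / h - 1 / 2)
    have h2 := Int.ceil_lt_add_one (y / h - 1 / 2)
    refine ⟨⌈y / h - 1 / 2⌉, ?_, ?_⟩
    · have : (⌈y / h - 1 / 2⌉ : ℝ) - 1 / 2 < y / h := by linarith
      rw [lt_div_iff₀ h0] at this
      linarith
    · have : y / h ≤ (⌈y / h - 1 / 2⌉ : ℝ) + 1 / 2 := by linarith
      rw [div_le_iff₀ h0] at this
      linarith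

open Topology Filter in
lemma hphi_tendsto (p : Polynomial ℝ) {l : Filter ℝ} (hl : Tendsto (fun x : ℝ => |x|) l atTop) :
    Tendsto (hphi p) l (𝓝 0) := by
  obtain ⟨C, hC, h⟩ := hphi_bound p
  have h2 : Tendsto (fun x : ℝ => C * Real.exp (-|x|)) l (𝓝 0) := by
    have := (Real.tendsto_exp_neg_atTop_nhds_zero.comp hl).const_mul C
    simpa [Function.comp_def] using this
  exact squeeze_zero_norm h h2

lemma hphi_int_Ioi (p : Polynomial ℝ) : ∫ y in Set.Ioi (0 : ℝ), hphi (hD p) y = -p.eval 0 := by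
  rw [MeasureTheory.integral_Ioi_of_hasDerivAt_of_tendsto' (m := 0) (f := hphi p)
    (fun x _ => hphi_hasDerivAt p x) (hphi_integrable _).integrableOn
    (hphi_tendsto p Filter.tendsto_abs_atTop_atTop)]
  simp [hphi]

lemma hphi_int_univ (p : Polynomial ℝ) : ∫ y in Set.univ, hphi (hD p) y = 0 := by
  rw [MeasureTheory.setIntegral_univ,
    MeasureTheory.integral_of_hasDerivAt_of_tendsto (m := 0) (n := 0) (f := hphi p)
    (fun x => hphi_hasDerivAt p x) (hphi_integrable _)
    (hphi_tendsto p Filter.tendsto_abs_atBot_atTop)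
    (hphi_tendsto p Filter.tendsto_abs_atTop_atTop)]
  simp

open Polynomial in
lemma hphi_gamma (a : ℕ) : ∫ y in Set.Ioi (0 : ℝ), hphi (X ^ a) y =
    1 / 2 * Real.Gamma (((a : ℝ) + 1) / 2) := by
  rw [← integral_rpow_mul_exp_neg_rpow (p := 2) (q := a) two_pos (by
    have : (0 : ℝ) ≤ a := a.cast_nonneg
    linarith)]
  refine MeasureTheory.setIntegral_congr_fun measurableSet_Ioi fun y hy => ?_
  simp [hphi]

open Polynomial in
lemma hphi_gamma_univ (a : ℕ) (ha : Even a) : ∫ y in Set.univ, hphi (X ^ a) y =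
    Real.Gamma (((a : ℝ) + 1) / 2) := by
  have : ∀ y, hphi (X ^ a) y = hphi (X ^ a) |y| := by
    intro y
    simp [hphi, ha.pow_abs]
  rw [MeasureTheory.setIntegral_univ]
  rw [MeasureTheory.integral_congr_ae (Filter.Eventually.of_forall this),
    integral_comp_abs (f := hphi (X ^ a)), hphi_gamma]
  ring

open Polynomial in
lemma hD_add (p q : ℝ[X]) : hD (p + q) = hD p + hD q := by
  simp only [hD, derivative_add]; ring

open Polynomial in
lemma hD_smul (c : ℝ) (p : ℝ[X]) : hD (C c * p) = C c * hD p := by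
  simp only [hD, derivative_mul, derivative_C]; ring

open Polynomial in
lemma hD_iter_lin (n : ℕ) (c c' : ℝ) (p q : ℝ[X]) :
    hD^[n] (C c * p + C c' * q) = C c * hD^[n] p + C c' * hD^[n] q := by
  induction n generalizing p q with
  | zero => rfl
  | succ n ih => simp only [Function.iterate_succ_apply, hD_add, hD_smul, ih]

open Polynomial in
lemma hD_iter_zero (n : ℕ) : ∀ a : ℕ, (hD^[n] (X ^ a)).eval 0 =
    if a ≤ n ∧ Even (n - a) then
      (n.factorial : ℝ) * (-1) ^ ((n - a) / 2) / ((n - a) / 2).factorial else 0 := by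
  induction n with
  | zero =>
    intro a
    rcases Nat.eq_zero_or_pos a with rfl | ha
    · simp
    · simp [ha.ne']
  | succ n ih =>
    intro a
    rw [Function.iterate_succ_apply]
    have e : hD (X ^ a) = C (a : ℝ) * X ^ (a - 1) + C (-2) * X ^ (a + 1) := by
      simp [hD, derivative_X_pow, pow_succ]
      ring
    rw [e, hD_iter_lin, eval_add, eval_mul, eval_mul, eval_C, eval_C, ih, ih]
    by_cases h : a ≤ n + 1 ∧ Even (n + 1 - a)
    · obtain ⟨h1, s, hs⟩ := h
      have hn : n + 1 = a + 2 * s := by omega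
      rw [if_pos (c := a ≤ n + 1 ∧ Even (n + 1 - a)) ⟨h1, s, hs⟩, show (n + 1 - a) / 2 = s by omega, Nat.factorial_succ]
      have hn' : (n : ℝ) + 1 = a + 2 * s := by exact_mod_cast hn
      rcases Nat.eq_zero_or_pos a with rfl | ha
      · rcases s with _ | s
        · omega
        · rw [if_pos (c := 0 + 1 ≤ n ∧ _) ⟨by omega, s, by omega⟩,
            show (n - (0 + 1)) / 2 = s by omega, Nat.factorial_succ]
          push_cast at hn' ⊢
          rw [hn', pow_succ]
          simp only [zero_mul]
          field_simp
          ring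
      · rw [if_pos (c := a - 1 ≤ n ∧ _) ⟨by omega, s, by omega⟩,
            show (n - (a - 1)) / 2 = s by omega]
        rcases s with _ | s
        · rw [if_neg (c := a + 1 ≤ n ∧ _) (by omega)]
          push_cast at hn' ⊢
          rw [hn']
          simp
        · rw [if_pos (c := a + 1 ≤ n ∧ _) ⟨by omega, s, by omega⟩,
            show (n - (a + 1)) / 2 = s by omega, Nat.factorial_succ]
          push_cast at hn' ⊢
          rw [hn', pow_succ]
          field_simp
          ring
    · rw [if_neg h, if_neg (c := a + 1 ≤ n ∧ _)]
      · rcases Nat.eq_zero_or_pos a with rfl | ha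
        · simp
        · rw [if_neg]
          · simp
          · rintro ⟨h1, s, hs⟩
            exact h ⟨by omega, s, by omega⟩
      · rintro ⟨h1, s, hs⟩
        exact h ⟨by omega, s + 1, by omega⟩

lemma hU_dvd (p : ℕ) : (PowerSeries.X : PowerSeries ℝ) ^ (2 * p) ∣ (hW - 1) ^ p := by
  rw [pow_mul]
  refine pow_dvd_pow_of_dvd ?_ p
  rw [PowerSeries.X_pow_dvd_iff]
  intro m hm
  interval_cases m
  · simp [hW_const]
  · simp [hW, hc, PowerSeries.coeff_one]

lemma hU_coeff (a p : ℕ) (h : a / 2 < p) (F : PowerSeries ℝ) :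
    PowerSeries.coeff a ((hW - 1) ^ p * F) = 0 := by
  have := (hU_dvd p).mul_right F
  rw [PowerSeries.X_pow_dvd_iff] at this
  exact this a (by omega)

open Polynomial in
/-- `[v^a] W^M` as a polynomial in `M` -/
noncomputable def htau (a : ℕ) : ℝ[X] :=
  ∑ p ∈ Finset.range (a / 2 + 1),
    C (PowerSeries.coeff a ((hW - 1) ^ p) / (p.factorial : ℝ) : ℝ) * descPochhammer ℝ p

open Polynomial in
lemma htau_degree (a : ℕ) : (htau a).natDegree ≤ a / 2 := by
  refine natDegree_sum_le_of_forall_le _ _ fun p hp => ?_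
  refine (natDegree_C_mul_le _ _).trans ?_
  rw [descPochhammer_natDegree]
  have := Finset.mem_range.1 hp
  omega

open Polynomial in
lemma htau_nat (a M : ℕ) : (htau a).eval (M : ℝ) = PowerSeries.coeff a (hW ^ M) := by
  have h1 : hW ^ M = ∑ p ∈ Finset.range (M + 1), PowerSeries.C (M.choose p : ℝ) * (hW - 1) ^ p := by
    conv_lhs => rw [show hW = (hW - 1) + 1 by ring, add_pow]
    refine Finset.sum_congr rfl fun p _ => ?_
    simp [mul_comm]
  have h2 : ∀ p, M < p → PowerSeries.coeff a ((hW - 1) ^ p) * (M.choose p : ℝ) = 0 := by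
    intro p hp; rw [Nat.choose_eq_zero_of_lt hp]; simp
  have h3 : ∀ p, a / 2 < p → PowerSeries.coeff a ((hW - 1) ^ p) * (M.choose p : ℝ) = 0 := by
    intro p hp; have := hU_coeff a p hp 1; rw [mul_one] at this; rw [this]; simp
  have e1 : (htau a).eval (M : ℝ) = ∑ p ∈ Finset.range (a / 2 + 1),
      PowerSeries.coeff a ((hW - 1) ^ p) * (M.choose p : ℝ) := by
    simp only [htau, eval_finsetSum, eval_mul, eval_C]
    refine Finset.sum_congr rfl fun p _ => ?_
    rw [descPochhammer_eval_eq_descFactorial, Nat.descFactorial_eq_factorial_mul_choose]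
    push_cast
    field_simp
  rw [e1, h1, map_sum]
  simp only [PowerSeries.coeff_C_mul]
  rw [Finset.sum_congr rfl (fun p _ => mul_comm (M.choose p : ℝ) _)]
  rw [Finset.sum_subset (Finset.range_mono (le_max_left (a / 2 + 1) (M + 1))),
    Finset.sum_subset (Finset.range_mono (le_max_right (a / 2 + 1) (M + 1)))]
  · intro p _ hp
    exact h2 p (by simpa using hp)
  · intro p _ hp
    exact h3 p (by simpa using hp)

open Polynomial in
lemma descPoch_neg_one (p : ℕ) : (descPochhammer ℝ p).eval (-1) = (-1) ^ p * p.factorial := by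
  induction p with
  | zero => simp
  | succ p ih =>
    rw [descPochhammer_succ_right, eval_mul, ih, Nat.factorial_succ]
    simp
    ring

open Polynomial in
lemma htau_neg_one (a : ℕ) : (htau a).eval (-1) = PowerSeries.coeff a hW⁻¹ := by
  have h1 : (∑ p ∈ Finset.range (a / 2 + 1), (-(hW - 1)) ^ p) =
      hW⁻¹ - (hW - 1) ^ (a / 2 + 1) * ((-1) ^ (a / 2 + 1) * hW⁻¹) := by
    have := geom_sum_mul (-(hW - 1)) (a / 2 + 1)
    have h2 : (∑ p ∈ Finset.range (a / 2 + 1), (-(hW - 1)) ^ p) * hW =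
        1 - (-(hW - 1)) ^ (a / 2 + 1) := by
      linear_combination -this
    have h3 := congrArg (· * hW⁻¹) h2
    simp only [mul_assoc, mul_comm hW, hW_inv, mul_one] at h3
    rw [h3, neg_pow (hW - 1)]
    ring
  have h2 : (htau a).eval (-1) =
      PowerSeries.coeff a (∑ p ∈ Finset.range (a / 2 + 1), (-(hW - 1)) ^ p) := by
    simp only [htau, eval_finsetSum, eval_mul, eval_C, map_sum]
    refine Finset.sum_congr rfl fun p _ => ?_
    rw [descPoch_neg_one, neg_pow (hW - 1)]
    have : ((-1) ^ p : PowerSeries ℝ) = PowerSeries.C ((-1) ^ p : ℝ) := by simp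
    rw [this, PowerSeries.coeff_C_mul]
    field_simp
  rw [h2, h1, map_sub, hU_coeff a _ (by omega), sub_zero]

open PowerSeries in
lemma hW_sinh : (PowerSeries.X : PowerSeries ℝ) * hW =
    rescale (1 / 2 : ℝ) (exp ℝ) - rescale (-(1 / 2) : ℝ) (exp ℝ) := by
  ext n
  rcases n with _ | b
  · rw [map_sub, coeff_rescale, coeff_rescale]
    simp
  · rw [mul_comm, PowerSeries.coeff_succ_mul_X, map_sub, coeff_rescale, coeff_rescale, hW,
      PowerSeries.coeff_mk, coeff_exp, neg_pow]
    simp [hc]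
    field_simp

open PowerSeries in
lemma hdiff_mono (M N : ℕ) : ∑ i ∈ Finset.range (M + 1),
    (-1 : ℝ) ^ i * M.choose i * ((M : ℝ) / 2 - i) ^ N =
    if M ≤ N then (N.factorial : ℝ) * coeff (N - M) (hW ^ M) else 0 := by
  have h1 : coeff N ((PowerSeries.X : PowerSeries ℝ) ^ M * hW ^ M) =
      if M ≤ N then coeff (N - M) (hW ^ M) else 0 := coeff_X_pow_mul' _ _ _
  have h2 : ∀ (c : ℝ) (k : ℕ), (rescale c (exp ℝ)) ^ k = rescale (c * k) (exp ℝ) := by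
    intro c k
    rw [← map_pow, exp_pow_eq_rescale_exp, rescale_rescale, mul_comm]
  have h3 : (PowerSeries.X : PowerSeries ℝ) ^ M * hW ^ M = ∑ i ∈ Finset.range (M + 1),
      PowerSeries.C ((-1 : ℝ) ^ i * M.choose i) * rescale ((M : ℝ) / 2 - i) (exp ℝ) := by
    rw [← mul_pow, hW_sinh, sub_eq_neg_add, add_pow]
    refine Finset.sum_congr rfl fun i hi => ?_
    have hi' : i ≤ M := by have := Finset.mem_range.1 hi; omega
    rw [neg_pow, h2, h2]
    have : rescale ((M : ℝ) / 2 - i) (exp ℝ) =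
        rescale (-(1 / 2) * (i : ℝ)) (exp ℝ) * rescale (1 / 2 * ((M - i : ℕ) : ℝ)) (exp ℝ) := by
      rw [exp_mul_exp_eq_exp_add]
      congr 2
      rw [Nat.cast_sub hi']; ring
    rw [this]
    simp
    ring
  rw [h3, map_sum] at h1
  have h4 := congrArg (fun z => (N.factorial : ℝ) * z) h1
  simp only [Finset.mul_sum, coeff_C_mul, coeff_rescale, coeff_exp] at h4
  rw [mul_ite, mul_zero] at h4
  rw [← h4]
  refine Finset.sum_congr rfl fun i _ => ?_
  simp
  field_simp

/-- half of `d - 1` -/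
noncomputable def hrho (d : ℕ) : ℝ := ((d : ℝ) - 1) / 2

open Polynomial in
/-- multiplicity polynomial in `x = k + ρ` -/
noncomputable def hm (d : ℕ) : ℝ[X] :=
  C (1 / ((d - 1).factorial : ℝ) : ℝ) *
    (∏ q ∈ Finset.range (d - 1), (X - C (hrho d - q - 1)) +
     ∏ q ∈ Finset.range (d - 1), (X - C (hrho d - q)))

open Polynomial in
lemma hm_eval (d : ℕ) (x : ℝ) : (hm d).eval x = 1 / ((d - 1).factorial : ℝ) *
    (∏ q ∈ Finset.range (d - 1), (x - hrho d + q + 1) +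
     ∏ q ∈ Finset.range (d - 1), (x - hrho d + q)) := by
  simp only [hm, eval_mul, eval_add, eval_C, eval_prod, eval_sub, eval_X]
  congr 2 <;> refine Finset.prod_congr rfl fun q _ => by ring

open Polynomial in
lemma hm_natDegree (d : ℕ) : (hm d).natDegree ≤ d - 1 := by
  refine (natDegree_C_mul_le _ _).trans ?_
  refine natDegree_add_le_of_degree_le ?_ ?_ <;>
  · rw [natDegree_finsetProd_X_sub_C_eq_card]; simp

open Polynomial in
lemma hm_lead (d : ℕ) : (hm d).coeff (d - 1) = 2 / ((d - 1).factorial : ℝ) := by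
  have key : ∀ f : ℕ → ℝ, (∏ q ∈ Finset.range (d - 1), (X - C (f q))).coeff (d - 1) = 1 := by
    intro f
    have h1 : (∏ q ∈ Finset.range (d - 1), (X - C (f q))).Monic :=
      monic_prod_of_monic _ _ fun q _ => monic_X_sub_C _
    have h2 : (∏ q ∈ Finset.range (d - 1), (X - C (f q))).natDegree = d - 1 := by
      rw [natDegree_finsetProd_X_sub_C_eq_card]; simp
    rw [Monic, leadingCoeff, h2] at h1
    exact h1
  rw [hm, coeff_C_mul, coeff_add, key (fun q => hrho d - q - 1), key (fun q => hrho d - q)]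
  ring

lemma hm_parity (d : ℕ) (x : ℝ) (hd : 1 ≤ d) :
    (hm d).eval (-x) = (-1) ^ (d - 1) * (hm d).eval x := by
  have hr : hrho d + hrho d = ((d - 1 : ℕ) : ℝ) := by
    rw [hrho, Nat.cast_sub hd]; push_cast; ring
  have e1 : ∏ q ∈ Finset.range (d - 1), (-x - hrho d + q + 1) =
      (-1) ^ (d - 1) * ∏ q ∈ Finset.range (d - 1), (x - hrho d + q) := by
    rw [← Finset.prod_range_reflect]
    have : ((-1 : ℝ)) ^ (d - 1) = ∏ q ∈ Finset.range (d - 1), (-1 : ℝ) := by simp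
    rw [this, ← Finset.prod_mul_distrib]
    refine Finset.prod_congr rfl fun q hq => ?_
    have hq' := Finset.mem_range.1 hq
    have : ((d - 1 - 1 - q : ℕ) : ℝ) = ((d - 1 : ℕ) : ℝ) - 1 - q := by
      rw [Nat.cast_sub (by omega), Nat.cast_sub (by omega)]; simp
    rw [this]
    linear_combination -hr
  have e2 : ∏ q ∈ Finset.range (d - 1), (-x - hrho d + q) =
      (-1) ^ (d - 1) * ∏ q ∈ Finset.range (d - 1), (x - hrho d + q + 1) := by
    rw [← Finset.prod_range_reflect]
    have : ((-1 : ℝ)) ^ (d - 1) = ∏ q ∈ Finset.range (d - 1), (-1 : ℝ) := by simp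
    rw [this, ← Finset.prod_mul_distrib]
    refine Finset.prod_congr rfl fun q hq => ?_
    have hq' := Finset.mem_range.1 hq
    have : ((d - 1 - 1 - q : ℕ) : ℝ) = ((d - 1 : ℕ) : ℝ) - 1 - q := by
      rw [Nat.cast_sub (by omega), Nat.cast_sub (by omega)]; simp
    rw [this]
    linear_combination -hr
  rw [hm_eval, hm_eval, e1, e2]
  ring

open Polynomial in
lemma hm_coeff_zero (d : ℕ) (hd : 1 ≤ d) (c : ℕ) (hc : c ≤ d - 1) (ho : Odd c) :
    (hm d).coeff (d - 1 - c) = 0 := by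
  have h1 : (hm d).comp (C (-1) * X) = C ((-1 : ℝ) ^ (d - 1)) * hm d := by
    apply Polynomial.funext
    intro x
    rw [eval_comp, eval_mul, eval_mul, eval_C, eval_C, eval_X, neg_one_mul, hm_parity d x hd]
  have h2 := congrArg (fun p => coeff p (d - 1 - c)) h1
  simp only [comp_C_mul_X_coeff, coeff_C_mul] at h2
  have h3 : ((-1 : ℝ)) ^ (d - 1) = (-1) ^ (d - 1 - c) * (-1) ^ c := by
    rw [← pow_add]; congr 1; omega
  rw [h3, ho.neg_one_pow] at h2
  have h4 : ((-1 : ℝ)) ^ (d - 1 - c) ≠ 0 := pow_ne_zero _ (by norm_num)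
  have h5 : ((-1 : ℝ)) ^ (d - 1 - c) * (hm d).coeff (d - 1 - c) = 0 := by linarith
  exact (mul_eq_zero.1 h5).resolve_left h4

lemma hm_zero (d s : ℕ) (h1 : 1 ≤ s) (h2 : s + 2 ≤ d) : (hm d).eval (hrho d - s) = 0 := by
  rw [hm_eval, Finset.prod_eq_zero (i := s - 1) (Finset.mem_range.2 (by omega)),
    Finset.prod_eq_zero (i := s) (Finset.mem_range.2 (by omega))]
  · simp
  · ring
  · rw [Nat.cast_sub h1]; push_cast; ring

lemma hm_mu (d k : ℕ) (hd : 1 ≤ d) (hk : k ≠ 0) : (hm d).eval (k + hrho d) = sphMu k d := by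
  rw [hm_eval, sphMu, if_neg hk]
  have e1 : ∏ q ∈ Finset.range (d - 1), ((k : ℝ) + hrho d - hrho d + q + 1) =
      ((k + 1).ascFactorial (d - 1) : ℕ) := by
    rw [Nat.ascFactorial_eq_prod_range]; push_cast
    refine Finset.prod_congr rfl fun q _ => by ring
  have e2 : ∏ q ∈ Finset.range (d - 1), ((k : ℝ) + hrho d - hrho d + q) =
      (k.ascFactorial (d - 1) : ℕ) := by
    rw [Nat.ascFactorial_eq_prod_range]; push_cast
    refine Finset.prod_congr rfl fun q _ => by ring
  rw [e1, e2]
  obtain ⟨j, rfl⟩ := Nat.exists_eq_succ_of_ne_zero hk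
  obtain ⟨e, rfl⟩ : ∃ e, d = e + 1 := ⟨d - 1, by omega⟩
  have f1 : ((j + 1).factorial : ℝ) * ((j + 1 + 1).ascFactorial e : ℕ) = ((j + 1 + e).factorial : ℝ) := by
    exact_mod_cast Nat.factorial_mul_ascFactorial (j + 1) e
  have f2 : (j.factorial : ℝ) * ((j + 1).ascFactorial e : ℕ) = ((j + e).factorial : ℝ) := by
    exact_mod_cast Nat.factorial_mul_ascFactorial j e
  simp only [Nat.succ_eq_add_one, Nat.add_sub_cancel]
  rw [show j + 1 + (e + 1) - 2 = j + e by omega]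
  rw [show j + 1 + e = (j + e) + 1 by ring, Nat.factorial_succ (j + e)] at f1
  have g1 : (((j + 1 + 1).ascFactorial e : ℕ) : ℝ) =
    ((j + e + 1 : ℕ) : ℝ) * ((j + e).factorial : ℝ) / ((j + 1).factorial : ℝ) := by
      rw [eq_div_iff (by positivity), mul_comm, f1]; push_cast; ring
  have g2 : (((j + 1).ascFactorial e : ℕ) : ℝ) = ((j + e).factorial : ℝ) / (j.factorial : ℝ) := by
      rw [eq_div_iff (by positivity), mul_comm, f2]
  rw [g1, g2, Nat.factorial_succ]
  push_cast
  field_simp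
  ring

lemma hm_mu_zero (d : ℕ) (hd : 2 ≤ d) : (hm d).eval (hrho d) = sphMu 0 d := by
  rw [hm_eval, sphMu, if_pos rfl]
  have e1 : ∏ q ∈ Finset.range (d - 1), (hrho d - hrho d + q + 1) = ((d - 1).factorial : ℝ) := by
    rw [← Finset.prod_range_add_one_eq_factorial]; push_cast
    refine Finset.prod_congr rfl fun q _ => by ring
  rw [e1, Finset.prod_eq_zero (i := 0) (Finset.mem_range.2 (by omega)) (by simp)]
  field_simp
  simp

lemma hm_one : hm 1 = Polynomial.C 2 := by
  apply Polynomial.funext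
  intro x
  simp [hm]
  norm_num

lemma hlam (d k : ℕ) (hd : 1 ≤ d) : ((k : ℝ) + hrho d) ^ 2 - hrho d ^ 2 = (sphLam k d : ℝ) := by
  rw [sphLam, hrho, show k + d - 1 = k + (d - 1) by omega]
  push_cast [Nat.cast_sub hd]
  ring

open Polynomial in
/-- the interpolating polynomial -/
noncomputable def hT (d e : ℕ) : ℝ[X] :=
  ∑ c ∈ Finset.range d, if c ≤ 2 * e then
    C ((hm d).coeff (d - 1 - c)) * ((htau (2 * e - c)).comp (C 2 * X + C ((d : ℝ) - 1)) *
      (ascPochhammer ℝ (2 * e - c)).comp (C 2 * X + C (d : ℝ))) else 0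

open Polynomial in
lemma hT_natDegree (d e : ℕ) : (hT d e).natDegree ≤ 3 * e := by
  refine natDegree_sum_le_of_forall_le _ _ fun c _ => ?_
  split_ifs with h
  · refine (natDegree_C_mul_le _ _).trans (natDegree_mul_le.trans ?_)
    have h1 : ∀ r : ℝ, (C 2 * X + C r : ℝ[X]).natDegree ≤ 1 := fun r => natDegree_linear_le
    have h2 : ((htau (2 * e - c)).comp (C 2 * X + C ((d : ℝ) - 1))).natDegree ≤
        ((2 * e - c) / 2) * 1 := by
      refine natDegree_comp_le.trans (Nat.mul_le_mul (htau_degree _) (h1 _))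
    have h3 : ((ascPochhammer ℝ (2 * e - c)).comp (C 2 * X + C (d : ℝ))).natDegree ≤
        (2 * e - c) * 1 := by
      refine natDegree_comp_le.trans (Nat.mul_le_mul ?_ (h1 _))
      rw [ascPochhammer_natDegree]
    omega
  · simp

open Polynomial in
lemma hT_diff (d e M f : ℕ) (hd : 1 ≤ d) (hf : f + (d - 1) = M + 2 * e) (z : ℝ)
    (hz : 2 * z + (d - 1) = M) :
    (M.factorial : ℝ) * (hT d e).eval z = ∑ i ∈ Finset.range (M + 1),
      (-1 : ℝ) ^ i * M.choose i *
        ((hm d).eval ((M : ℝ) / 2 - i) * ((M : ℝ) / 2 - i) ^ f) := by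
  have h1 : ∀ x, (hm d).eval x = ∑ c ∈ Finset.range d, (hm d).coeff (d - 1 - c) * x ^ (d - 1 - c) := by
    intro x
    rw [eval_eq_sum_range' (n := d) (by have := hm_natDegree d; omega),
      ← Finset.sum_range_reflect]
  simp_rw [h1, Finset.sum_mul, Finset.mul_sum]
  rw [Finset.sum_comm, hT, eval_finsetSum, Finset.mul_sum]
  refine Finset.sum_congr rfl fun c hc => ?_
  have hc' := Finset.mem_range.1 hc
  have h2 := hdiff_mono M (d - 1 - c + f)
  have h3 : ∑ i ∈ Finset.range (M + 1), (-1 : ℝ) ^ i * M.choose i *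
      ((hm d).coeff (d - 1 - c) * ((M : ℝ) / 2 - i) ^ (d - 1 - c) * ((M : ℝ) / 2 - i) ^ f) =
      (hm d).coeff (d - 1 - c) * ∑ i ∈ Finset.range (M + 1),
        (-1 : ℝ) ^ i * M.choose i * ((M : ℝ) / 2 - i) ^ (d - 1 - c + f) := by
    rw [Finset.mul_sum]
    refine Finset.sum_congr rfl fun i _ => ?_
    rw [pow_add]; ring
  rw [h3, h2]
  by_cases h : c ≤ 2 * e
  · rw [if_pos h, if_pos (by omega), show d - 1 - c + f - M = 2 * e - c by omega,
      show d - 1 - c + f = M + (2 * e - c) by omega, ← htau_nat,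
      ← Nat.factorial_mul_ascFactorial]
    simp only [eval_mul, eval_C, eval_comp, eval_add, eval_X]
    rw [hz, show 2 * z + (d : ℝ) = ((M + 1 : ℕ) : ℝ) by push_cast; linarith]
    rw [← ascPochhammer_nat_eq_ascFactorial, ← ascPochhammer_eval_cast]
    push_cast
    ring
  · rw [if_neg h, if_neg (by omega)]
    simp

open Polynomial in
lemma hT_root (d e p : ℕ) (hd : 1 ≤ d) (h1 : 1 ≤ p) (h2 : p ≤ e) :
    (hT d e).eval (-(p : ℝ)) = 0 := by
  by_cases h : 2 * p ≤ d - 1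
  · have hM : ((d - 1 - 2 * p : ℕ) : ℝ) = (d : ℝ) - 1 - 2 * p := by
      rw [Nat.cast_sub h, Nat.cast_sub hd]; push_cast; ring
    have := hT_diff d e (d - 1 - 2 * p) (2 * e - 2 * p) hd (by omega) (-(p : ℝ))
      (by rw [hM]; ring)
    rw [Finset.sum_eq_zero] at this
    · exact (mul_eq_zero.1 this).resolve_left (by positivity)
    · intro i hi
      have hi' := Finset.mem_range.1 hi
      have : ((d - 1 - 2 * p : ℕ) : ℝ) / 2 - i = hrho d - ((p + i : ℕ) : ℝ) := by
        rw [hM, hrho]; push_cast; ring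
      rw [this, hm_zero d (p + i) (by omega) (by omega)]
      simp
  · rw [hT, eval_finsetSum]
    refine Finset.sum_eq_zero fun c hc => ?_
    have hc' := Finset.mem_range.1 hc
    split_ifs with h3
    · simp only [eval_mul, eval_comp, eval_add, eval_C, eval_X]
      have : 2 * -(p : ℝ) + d = -((2 * p - d : ℕ) : ℝ) := by
        rw [Nat.cast_sub (by omega)]; push_cast; ring
      rw [this, ascPochhammer_eval_neg_coe_nat_of_lt (by omega)]
      simp
    · simp

open Polynomial in
lemma hT_factor (d e : ℕ) (hd : 1 ≤ d) : ∃ S : ℝ[X], S.natDegree ≤ 2 * e ∧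
    hT d e = (∏ p ∈ Finset.range e, (X - C (-((p + 1 : ℕ) : ℝ)))) * S := by
  have hdvd : (∏ p ∈ Finset.range e, (X - C (-((p + 1 : ℕ) : ℝ)))) ∣ hT d e := by
    refine Finset.prod_dvd_of_coprime ?_ ?_
    · intro a _ b _ hab
      refine pairwise_coprime_X_sub_C (s := fun p : ℕ => -((p + 1 : ℕ) : ℝ)) ?_ hab
      intro a b h
      simpa using h
    · intro p hp
      rw [dvd_iff_isRoot]
      exact hT_root d e (p + 1) hd (by omega) (by have := Finset.mem_range.1 hp; omega)
  obtain ⟨S, hS⟩ := hdvd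
  by_cases h0 : hT d e = 0
  · exact ⟨0, by simp, by simp [h0]⟩
  · refine ⟨S, ?_, hS⟩
    have h1 := hT_natDegree d e
    have hm1 : (∏ p ∈ Finset.range e, (X - C (-((p + 1 : ℕ) : ℝ)))).Monic :=
      monic_prod_of_monic _ _ fun q _ => monic_X_sub_C _
    have hS0 : S ≠ 0 := by rintro rfl; simp at hS; exact h0 hS
    rw [hS, hm1.natDegree_mul' hS0, natDegree_finsetProd_X_sub_C_eq_card] at h1
    simp at h1
    omega

lemma hprod_weight (j : ℕ) (r : ℕ) : ∏ i ∈ (Finset.range (j + r + 1)).erase j, ((j : ℝ) - i) =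
    (-1) ^ r * j.factorial * r.factorial := by
  induction r with
  | zero =>
    have : (Finset.range (j + 0 + 1)).erase j = Finset.range j := by
      ext x; simp only [Finset.mem_erase, Finset.mem_range]; omega
    rw [this, ← Finset.prod_range_reflect, ← Finset.prod_range_add_one_eq_factorial]
    push_cast
    simp only [pow_zero, one_mul, Nat.factorial_zero, Nat.cast_one, mul_one]
    refine Finset.prod_congr rfl fun q hq => ?_
    have := Finset.mem_range.1 hq
    rw [Nat.cast_sub (by omega), Nat.cast_sub (by omega)]; push_cast; ring
  | succ r ih =>
    have : (Finset.range (j + (r + 1) + 1)).erase j =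
        insert (j + r + 1) ((Finset.range (j + r + 1)).erase j) := by
      ext x; simp only [Finset.mem_erase, Finset.mem_range, Finset.mem_insert]; omega
    rw [this, Finset.prod_insert (by simp), ih, Nat.factorial_succ]
    push_cast
    ring

lemma hprod_gamma (s : ℝ) (hs : 0 < s) (w : ℕ) : ∏ i ∈ Finset.range (w + 1), (-s - (i : ℝ)) =
    (-1) ^ (w + 1) * Real.Gamma (w + s + 1) / Real.Gamma s := by
  have hg := (Real.Gamma_pos_of_pos hs).ne'
  induction w with
  | zero =>
    simp [Real.Gamma_add_one hs.ne']
    field_simp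
  | succ w ih =>
    have h2 : (w : ℝ) + s + 1 ≠ 0 := by positivity
    rw [Finset.prod_range_succ, ih]
    push_cast
    rw [show (w : ℝ) + 1 + s + 1 = (w + s + 1) + 1 by ring, Real.Gamma_add_one h2]
    field_simp
    ring

open Polynomial in
lemma hlagrange (Q : ℝ[X]) (w : ℕ) (hQ : Q.natDegree ≤ w) (s : ℝ) (hs : 0 < s) :
    Real.Gamma s * Q.eval (-s) = ∑ j ∈ Finset.range (w + 1),
      (-1) ^ j * Real.Gamma (w + s + 1) / (j.factorial * (w - j).factorial * (j + s)) *
        Q.eval (j : ℝ) := by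
  have hinj : Set.InjOn (fun i : ℕ => (i : ℝ)) (Finset.range (w + 1) : Set ℕ) :=
    fun a _ b _ h => by simpa using h
  have h1 := Lagrange.eq_interpolate (s := Finset.range (w + 1)) (v := fun i : ℕ => (i : ℝ))
    (f := Q) hinj (by
      rw [Finset.card_range]
      refine (Polynomial.degree_le_natDegree).trans_lt ?_
      exact_mod_cast Nat.lt_succ_of_le hQ)
  have hg := (Real.Gamma_pos_of_pos hs).ne'
  have h2 : Q.eval (-s) = (∏ i ∈ Finset.range (w + 1), (-s - (i : ℝ))) *
      ∑ j ∈ Finset.range (w + 1), Lagrange.nodalWeight (Finset.range (w + 1)) (fun i : ℕ => (i : ℝ)) j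
        * (-s - (j : ℝ))⁻¹ * Q.eval (j : ℝ) := by
    conv_lhs => rw [h1]
    rw [Lagrange.eval_interpolate_not_at_node, Lagrange.eval_nodal]
    intro i _
    have : (0 : ℝ) ≤ i := i.cast_nonneg
    linarith
  rw [h2, hprod_gamma s hs, Finset.mul_sum, Finset.mul_sum]
  refine Finset.sum_congr rfl fun j hj => ?_
  have hj' := Finset.mem_range.1 hj
  obtain ⟨r, rfl⟩ : ∃ r, w = j + r := ⟨w - j, by omega⟩
  have h3 : Lagrange.nodalWeight (Finset.range (j + r + 1)) (fun i : ℕ => (i : ℝ)) j =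
      ((-1) ^ r * j.factorial * r.factorial : ℝ)⁻¹ := by
    rw [Lagrange.nodalWeight, Finset.prod_inv_distrib, hprod_weight]
  have h4 : (-s - (j : ℝ)) = -(j + s) := by ring
  have h5 : (j : ℝ) + s ≠ 0 := by positivity
  rw [h3, h4, Nat.add_sub_cancel_left]
  have h6 : ((-1 : ℝ)) ^ r ≠ 0 := pow_ne_zero _ (by norm_num)
  field_simp
  rw [pow_add, pow_add]
  ring

open Polynomial in
/-- the quotient polynomial -/
noncomputable def hSp (d e : ℕ) (hd : 1 ≤ d) : ℝ[X] := (hT_factor d e hd).choose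

open Polynomial in
/-- the full interpolation polynomial for the `n`-th coefficient -/
noncomputable def hQ (d n : ℕ) (hd : 1 ≤ d) : ℝ[X] :=
  ∑ e ∈ Finset.range (n + 1),
    C ((-1) ^ n * ((-hrho d ^ 2) ^ (n - e) / ((n - e).factorial : ℝ))) * hSp d e hd

open Polynomial in
lemma hQ_natDegree (d n : ℕ) (hd : 1 ≤ d) : (hQ d n hd).natDegree ≤ 2 * n := by
  refine natDegree_sum_le_of_forall_le _ _ fun e he => ?_
  refine (natDegree_C_mul_le _ _).trans ?_
  have h1 := (hT_factor d e hd).choose_spec.1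
  have h2 := Finset.mem_range.1 he
  rw [hSp]
  omega

open Polynomial in
lemma hSp_nat (d e j : ℕ) (hd : 1 ≤ d) : (hSp d e hd).eval (j : ℝ) =
    (hT d e).eval (j : ℝ) * j.factorial / (j + e).factorial := by
  have h1 := congrArg (eval (j : ℝ)) (hT_factor d e hd).choose_spec.2
  rw [eval_mul, eval_prod] at h1
  have h2 : ∏ p ∈ Finset.range e, eval (j : ℝ) (X - C (-((p + 1 : ℕ) : ℝ))) =
      ((j + 1).ascFactorial e : ℕ) := by
    rw [Nat.ascFactorial_eq_prod_range]
    push_cast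
    refine Finset.prod_congr rfl fun q _ => ?_
    simp
    ring
  rw [h2] at h1
  rw [h1, hSp, ← Nat.factorial_mul_ascFactorial]
  have : ((j + 1).ascFactorial e : ℝ) ≠ 0 := by
    exact_mod_cast (Nat.ascFactorial_pos _ _).ne'
  push_cast
  field_simp

open Polynomial in
lemma hdiff_low (d M f : ℕ) (hd : 1 ≤ d) (hf : f + (d - 1) < M) :
    ∑ i ∈ Finset.range (M + 1),
      (-1 : ℝ) ^ i * M.choose i *
        ((hm d).eval ((M : ℝ) / 2 - i) * ((M : ℝ) / 2 - i) ^ f) = 0 := by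
  have h1 : ∀ x, (hm d).eval x = ∑ a ∈ Finset.range d, (hm d).coeff a * x ^ a := by
    intro x
    rw [eval_eq_sum_range' (n := d) (by have := hm_natDegree d; omega)]
  simp_rw [h1, Finset.sum_mul, Finset.mul_sum]
  rw [Finset.sum_comm]
  refine Finset.sum_eq_zero fun a ha => ?_
  have ha' := Finset.mem_range.1 ha
  have h2 := hdiff_mono M (a + f)
  rw [if_neg (by omega)] at h2
  have h3 := congrArg (fun z => (hm d).coeff a * z) h2
  simp only [Finset.mul_sum, mul_zero] at h3
  rw [← h3]
  refine Finset.sum_congr rfl fun i _ => ?_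
  rw [pow_add]; ring

/-- the central difference of `m λ^(j+n)` -/
noncomputable def hdel (d j L : ℕ) : ℝ := ∑ i ∈ Finset.range (2 * j + d - 1 + 1),
      (-1 : ℝ) ^ i * (2 * j + d - 1).choose i *
        ((hm d).eval (((2 * j + d - 1 : ℕ) : ℝ) / 2 - i) *
          ((((2 * j + d - 1 : ℕ) : ℝ) / 2 - i) ^ 2 - hrho d ^ 2) ^ L)

lemma hQ_nat (d n j : ℕ) (hd : 1 ≤ d) : (hQ d n hd).eval (j : ℝ) =
    (-1) ^ n * j.factorial / ((2 * j + d - 1).factorial * (j + n).factorial) *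
      hdel d j (j + n) := by
  set M := 2 * j + d - 1 with hM
  have e1 : hdel d j (j + n) = ∑ u ∈ Finset.range (j + n + 1),
      ((j + n).choose u : ℝ) * (-hrho d ^ 2) ^ (j + n - u) * ∑ i ∈ Finset.range (M + 1),
      (-1 : ℝ) ^ i * M.choose i *
        ((hm d).eval ((M : ℝ) / 2 - i) * ((M : ℝ) / 2 - i) ^ (2 * u)) := by
    rw [hdel, ← hM]
    simp_rw [sub_eq_add_neg _ (hrho d ^ 2), add_pow, Finset.mul_sum]
    rw [Finset.sum_comm]
    refine Finset.sum_congr rfl fun u _ => Finset.sum_congr rfl fun i _ => ?_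
    rw [pow_mul]; ring
  have e2 : hdel d j (j + n) = ∑ e ∈ Finset.range (n + 1),
      ((j + n).choose (j + e) : ℝ) * (-hrho d ^ 2) ^ (n - e) *
        (M.factorial * (hT d e).eval (j : ℝ)) := by
    rw [e1, add_assoc, Finset.sum_range_add, Finset.sum_eq_zero, zero_add]
    · refine Finset.sum_congr rfl fun e _ => ?_
      rw [hT_diff d e M (2 * (j + e)) hd (by omega) (j : ℝ) (by
        rw [hM, show 2 * j + d - 1 = 2 * j + (d - 1) by omega]
        push_cast [Nat.cast_sub hd]; ring), show j + n - (j + e) = n - e by omega]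
    · intro u hu
      have := Finset.mem_range.1 hu
      rw [hdiff_low d M (2 * u) hd (by omega), mul_zero]
  rw [e2, hQ, Polynomial.eval_finsetSum, Finset.mul_sum]
  refine Finset.sum_congr rfl fun e he => ?_
  have he' := Finset.mem_range.1 he
  rw [Polynomial.eval_mul, Polynomial.eval_C, hSp_nat]
  have h1 := Nat.choose_mul_factorial_mul_factorial (show j + e ≤ j + n by omega)
  rw [show j + n - (j + e) = n - e by omega] at h1
  have h2 : ((j + n).choose (j + e) : ℝ) * (j + e).factorial * (n - e).factorial =
      (j + n).factorial := by exact_mod_cast h1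
  have h3 : ((j + n).choose (j + e) : ℝ) = (j + n).factorial / ((j + e).factorial * (n - e).factorial) := by
    rw [← h2]; field_simp
  rw [h3]
  field_simp

lemma hdel_eq (d j L : ℕ) (hd : 1 ≤ d) (hL : 1 ≤ L) : hdel d j L =
    2 * (-1) ^ j * ∑ k ∈ Finset.Icc 1 j,
      (-1 : ℝ) ^ k * (Nat.choose (2 * j + d - 1) (j - k)) * sphMu k d * (sphLam k d : ℝ) ^ L := by
  have hMr : ((2 * j + d - 1 : ℕ) : ℝ) / 2 = j + hrho d := by
    rw [show 2 * j + d - 1 = 2 * j + (d - 1) by omega, hrho]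
    push_cast [Nat.cast_sub hd]; ring
  rw [hdel, hMr, show 2 * j + d - 1 + 1 = j + d + j by omega, Finset.sum_range_add,
    Finset.sum_range_add]
  set F : ℕ → ℝ := fun i => (-1 : ℝ) ^ i * ((2 * j + d - 1).choose i : ℝ) *
        ((hm d).eval ((j : ℝ) + hrho d - i) *
          (((j : ℝ) + hrho d - i) ^ 2 - hrho d ^ 2) ^ L) with hF
  have h2 : ∑ s ∈ Finset.range d, F (j + s) = 0 := by
    refine Finset.sum_eq_zero fun s hs => ?_
    have hs' := Finset.mem_range.1 hs
    have hx : (j : ℝ) + hrho d - ((j + s : ℕ) : ℝ) = hrho d - s := by push_cast; ring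
    simp only [hF]
    rw [hx]
    rcases Nat.eq_zero_or_pos s with rfl | hs0
    · simp [show L ≠ 0 by omega]
    · by_cases h : s + 2 ≤ d
      · rw [hm_zero d s hs0 h]; simp
      · have : hrho d - s = - hrho d := by
          have : s = d - 1 := by omega
          rw [this, hrho, Nat.cast_sub hd]; push_cast; ring
        rw [this]
        simp [show L ≠ 0 by omega]
  have h3 : ∑ s ∈ Finset.range j, F (j + d + s) = ∑ i ∈ Finset.range j, F i := by
    rw [← Finset.sum_range_reflect]
    refine Finset.sum_congr rfl fun i hi => ?_
    have hi' := Finset.mem_range.1 hi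
    have e : j + d + (j - 1 - i) = 2 * j + d - 1 - i := by omega
    have hx : (j : ℝ) + hrho d - ((2 * j + d - 1 - i : ℕ) : ℝ) = -((j : ℝ) + hrho d - i) := by
      rw [Nat.cast_sub (by omega)]
      linarith
    simp only [hF]
    rw [e, hx, hm_parity _ _ hd, Nat.choose_symm (by omega), neg_sq]
    have : (-1 : ℝ) ^ (2 * j + d - 1 - i) * (-1) ^ (d - 1) = (-1) ^ i := by
      rw [← pow_add]
      have : 2 * j + d - 1 - i + (d - 1) + 2 * i = i + 2 * (j + d - 1) := by omega
      have h4 : (-1 : ℝ) ^ (2 * j + d - 1 - i + (d - 1) + 2 * i) = (-1) ^ (i + 2 * (j + d - 1)) := by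
        rw [this]
      rw [pow_add _ _ (2 * i), pow_add _ i, pow_mul, pow_mul] at h4
      simpa using h4
    rw [← this]; ring
  have h1 : ∑ i ∈ Finset.range j, F i = (-1) ^ j * ∑ k ∈ Finset.Icc 1 j,
      (-1 : ℝ) ^ k * (Nat.choose (2 * j + d - 1) (j - k)) * sphMu k d * (sphLam k d : ℝ) ^ L := by
    rw [Finset.mul_sum]
    refine Finset.sum_nbij' (fun i => j - i) (fun k => j - k) ?_ ?_ ?_ ?_ ?_
    · intro i hi; simp only [Finset.mem_range, Finset.mem_Icc] at *; omega
    · intro i hi; simp only [Finset.mem_range, Finset.mem_Icc] at *; omega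
    · intro i hi; simp only [Finset.mem_range, Finset.mem_Icc] at *; omega
    · intro i hi; simp only [Finset.mem_range, Finset.mem_Icc] at *; omega
    · intro i hi
      have hi' := Finset.mem_range.1 hi
      have hx : (j : ℝ) + hrho d - i = ((j - i : ℕ) : ℝ) + hrho d := by
        rw [Nat.cast_sub hi'.le]; ring
      simp only [hF]
      rw [hx, hm_mu d _ hd (by omega), hlam d _ hd, show j - (j - i) = i by omega]
      have : (-1 : ℝ) ^ j * (-1) ^ (j - i) = (-1) ^ i := by
        rw [← pow_add]
        have h4 : (-1 : ℝ) ^ (j + (j - i) + 2 * i) = (-1) ^ (i + 2 * j) := by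
          congr 1; omega
        rw [pow_add _ _ (2 * i), pow_add _ i, pow_mul, pow_mul] at h4
        simpa using h4
      rw [← this]; ring
  change ∑ i ∈ Finset.range j, F i + ∑ s ∈ Finset.range d, F (j + s) +
    ∑ s ∈ Finset.range j, F (j + d + s) = _
  rw [h2, h3, h1]; ring

lemma hA_eq (d n w : ℕ) (hd : 1 ≤ d) (hn : 1 ≤ n) (hw : 2 * n ≤ w) :
    A n d w = 1 / 2 * (Real.Gamma ((d : ℝ) / 2) * (hQ d n hd).eval (-((d : ℝ) / 2))) := by
  have hs : (0 : ℝ) < (d : ℝ) / 2 := by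
    have : (0 : ℝ) < d := by exact_mod_cast hd
    positivity
  rw [hlagrange _ w ((hQ_natDegree d n hd).trans hw) _ hs, Finset.sum_range_eq_add_Ico _ (by omega)]
  have h0 : (hQ d n hd).eval ((0 : ℕ) : ℝ) = 0 := by
    rw [hQ_nat, hdel_eq _ _ _ hd (by omega)]
    simp
  rw [h0, mul_zero, zero_add, A, Finset.mul_sum]
  have : Finset.Ico 1 (w + 1) = Finset.Icc 1 w := by ext; simp
  rw [this]
  refine Finset.sum_congr rfl fun j _ => ?_
  rw [hQ_nat, hdel_eq _ _ _ hd (by omega)]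
  generalize ∑ k ∈ Finset.Icc 1 j, (-1 : ℝ) ^ k * (Nat.choose (2 * j + d - 1) (j - k)) * sphMu k d *
    (sphLam k d : ℝ) ^ (j + n) = Z
  have h1 : ((2 * j + d).factorial : ℝ) = 2 * ((j : ℝ) + d / 2) * (2 * j + d - 1).factorial := by
    have := Nat.mul_factorial_pred (show 2 * j + d ≠ 0 by omega)
    rw [← this]; push_cast; ring
  have h2 : (j : ℝ) + d / 2 ≠ 0 := by positivity
  have h3 : ((-1 : ℝ)) ^ j * (-1) ^ j = 1 := by rw [← mul_pow]; simp
  rw [h1]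
  field_simp
  linear_combination (-Z) * h3

/-- the reduced heat coefficients -/
noncomputable def hbeta (d e : ℕ) (hd : 1 ≤ d) : ℝ :=
  1 / 2 * Real.Gamma ((d : ℝ) / 2) * ((-1) ^ e * (hSp d e hd).eval (-((d : ℝ) / 2)))

lemma hSp_factor (d e : ℕ) (hd : 1 ≤ d) :
    hT d e = Lagrange.nodal (Finset.range e) (fun p => -((p + 1 : ℕ) : ℝ)) * hSp d e hd :=
  (hT_factor d e hd).choose_spec.2

open Polynomial in
lemma hT_at (d e : ℕ) : (hT d e).eval (-((d : ℝ) / 2)) =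
    if 2 * e < d then (hm d).coeff (d - 1 - 2 * e) else 0 := by
  rw [hT, eval_finsetSum]
  have key : ∀ c ∈ Finset.range d, (if c ≤ 2 * e then
    C ((hm d).coeff (d - 1 - c)) * ((htau (2 * e - c)).comp (C 2 * X + C ((d : ℝ) - 1)) *
      (ascPochhammer ℝ (2 * e - c)).comp (C 2 * X + C (d : ℝ))) else 0).eval (-((d : ℝ) / 2)) =
      if c = 2 * e then (hm d).coeff (d - 1 - 2 * e) else 0 := by
    intro c _
    by_cases h : c ≤ 2 * e
    · rw [if_pos h]
      simp only [eval_mul, eval_C, eval_comp, eval_add, eval_X]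
      rw [show 2 * -((d : ℝ) / 2) + (d - 1) = -1 by ring, show 2 * -((d : ℝ) / 2) + d = 0 by ring,
        htau_neg_one, ascPochhammer_eval_zero]
      by_cases h2 : c = 2 * e
      · subst h2; simp [hW_const]
      · rw [if_neg (by omega), if_neg h2]; simp
    · rw [if_neg h, if_neg (by omega)]; simp
  rw [Finset.sum_congr rfl key, Finset.sum_ite_eq']
  simp

lemma hgamma_prod (s : ℝ) (e : ℕ) (h : ∀ p < e, s - (p + 1 : ℕ) ≠ 0) :
    Real.Gamma s = (∏ p ∈ Finset.range e, (s - (p + 1 : ℕ))) * Real.Gamma (s - e) := by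
  induction e with
  | zero => simp
  | succ e ih =>
    rw [ih fun p hp => h p (by omega), Finset.prod_range_succ, mul_assoc]
    congr 1
    rw [← Real.Gamma_add_one (h e (by omega))]
    congr 1
    push_cast; ring

open Polynomial in
lemma hbeta_low (d e : ℕ) (hd : 1 ≤ d) (h : Odd d ∨ 2 * e < d) : hbeta d e hd =
    if 2 * e < d then 1 / 2 * Real.Gamma ((d : ℝ) / 2 - e) * (hm d).coeff (d - 1 - 2 * e) else 0 := by
  have hne : ∀ p < e, (d : ℝ) / 2 - (p + 1 : ℕ) ≠ 0 := by
    intro p hp h0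
    have h1 : (d : ℝ) = ((2 * (p + 1) : ℕ) : ℝ) := by push_cast at *; linarith
    have h2 : d = 2 * (p + 1) := by exact_mod_cast h1
    rcases h with h | h
    · obtain ⟨r, hr⟩ := h; omega
    · omega
  have hT := hT_at d e
  rw [hSp_factor d e hd, eval_mul, Lagrange.eval_nodal] at hT
  have hP : ∏ i ∈ Finset.range e, (-((d : ℝ) / 2) - -((i + 1 : ℕ) : ℝ)) =
      (-1) ^ e * ∏ p ∈ Finset.range e, ((d : ℝ) / 2 - (p + 1 : ℕ)) := by
    have : (-1 : ℝ) ^ e = ∏ _p ∈ Finset.range e, (-1 : ℝ) := by simp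
    rw [this, ← Finset.prod_mul_distrib]
    exact Finset.prod_congr rfl fun i _ => by ring
  rw [hP] at hT
  rw [hbeta, hgamma_prod _ e hne]
  have : 1 / 2 * Real.Gamma ((d : ℝ) / 2 - e) *
    (if 2 * e < d then (hm d).coeff (d - 1 - 2 * e) else 0) =
    if 2 * e < d then 1 / 2 * Real.Gamma ((d : ℝ) / 2 - e) * (hm d).coeff (d - 1 - 2 * e) else 0 := by
    split_ifs <;> simp
  rw [← this, ← hT]; ring

open Polynomial in
lemma hasc_deriv (k : ℕ) : (derivative (ascPochhammer ℝ (k + 1))).eval 0 = k.factorial := by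
  induction k with
  | zero => simp
  | succ k ih =>
    rw [ascPochhammer_succ_right, derivative_mul, eval_add, eval_mul, eval_mul, ih,
      ascPochhammer_eval_zero]
    simp [Nat.factorial_succ, mul_comm]

open Polynomial in
lemma hT_deriv (d e : ℕ) (h : d ≤ 2 * e) : (derivative (hT d e)).eval (-((d : ℝ) / 2)) =
    2 * ∑ c ∈ Finset.range d, (hm d).coeff (d - 1 - c) * PowerSeries.coeff (2 * e - c) hW⁻¹ *
      (2 * e - c - 1).factorial := by
  rw [hT, derivative_sum, eval_finsetSum, Finset.mul_sum]
  refine Finset.sum_congr rfl fun c hc => ?_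
  have hc' := Finset.mem_range.1 hc
  obtain ⟨k, hk⟩ : ∃ k, 2 * e - c = k + 1 := ⟨2 * e - c - 1, by omega⟩
  rw [if_pos (by omega), hk, Nat.add_sub_cancel]
  simp only [derivative_mul, derivative_comp, derivative_C, derivative_X, eval_mul, eval_C, eval_comp,
    eval_add, eval_X, derivative_add, zero_mul, zero_add, eval_zero, eval_one, eval_ofNat]
  rw [show 2 * -((d : ℝ) / 2) + (d - 1) = -1 by ring, show 2 * -((d : ℝ) / 2) + d = 0 by ring,
        htau_neg_one, ascPochhammer_eval_zero, hasc_deriv]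
  simp
  ring

open Polynomial in
lemma hbeta_high (q e : ℕ) (hd : 1 ≤ 2 * q) (h : q ≤ e) : hbeta (2 * q) e hd =
    -((-1) ^ (e - q) / (e - q).factorial * ∑ c ∈ Finset.range (2 * q), (hm (2 * q)).coeff (2 * q - 1 - c) *
      PowerSeries.coeff (2 * e - c) hW⁻¹ * (2 * e - c - 1).factorial) := by
  obtain ⟨r, rfl⟩ := Nat.exists_eq_add_of_le h
  obtain ⟨s, rfl⟩ : ∃ s, q = s + 1 := ⟨q - 1, by omega⟩
  have h1 := hT_deriv (2 * (s + 1)) (s + 1 + r) (by omega)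
  have hz : -(((2 * (s + 1) : ℕ) : ℝ) / 2) = -((s + 1 : ℕ) : ℝ) := by push_cast; ring
  rw [hSp_factor _ _ hd, derivative_mul, eval_add, eval_mul, eval_mul, hz,
    Lagrange.eval_nodal_at_node (v := fun p => -((p + 1 : ℕ) : ℝ)) (i := s) (by simp; omega), zero_mul, add_zero,
    Lagrange.eval_nodal_derivative_eval_node_eq (v := fun p => -((p + 1 : ℕ) : ℝ)) (i := s) (by simp; omega),
    Lagrange.eval_nodal] at h1
  have hP : ∏ j ∈ (Finset.range (s + 1 + r)).erase s, (-((s + 1 : ℕ) : ℝ) - -((j + 1 : ℕ) : ℝ)) =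
      (-1) ^ (s + r) * ((-1) ^ r * s.factorial * r.factorial) := by
    rw [← hprod_weight, show s + 1 + r = s + r + 1 by ring]
    have : s + r = ((Finset.range (s + r + 1)).erase s).card := by
      rw [Finset.card_erase_of_mem (by simp)]; simp
    conv_rhs => rw [this, ← Finset.prod_const, ← this]
    rw [← Finset.prod_mul_distrib]
    exact Finset.prod_congr rfl fun i _ => by push_cast; ring
  rw [hP] at h1
  rw [hbeta, hz, show s + 1 + r - (s + 1) = r by omega]
  have hG : Real.Gamma (((2 * (s + 1) : ℕ) : ℝ) / 2) = s.factorial := by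
    rw [← Real.Gamma_nat_eq_factorial]; congr 1; push_cast; ring
  rw [hG]
  generalize (∑ c ∈ Finset.range (2 * (s + 1)), (hm (2 * (s + 1))).coeff (2 * (s + 1) - 1 - c) *
      PowerSeries.coeff (2 * (s + 1 + r) - c) hW⁻¹ * ((2 * (s + 1 + r) - c - 1).factorial : ℝ)) = Z at *
  generalize eval (-((s + 1 : ℕ) : ℝ)) (hSp (2 * (s + 1)) (s + 1 + r) hd) = S at *
  have h2 : (-1 : ℝ) ^ r * (-1) ^ r = 1 := by rw [← mul_pow]; simp
  have h3 : Z = 1 / 2 * ((-1) ^ s * s.factorial * r.factorial * S) := by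
    rw [pow_add] at h1
    linear_combination (-1 / 2) * h1 + (1 / 2 * (-1) ^ s * s.factorial * r.factorial * S) * h2
  rw [h3]
  field_simp
  ring

lemma hA_beta (d n : ℕ) (hd : 1 ≤ d) (hn : 1 ≤ n) : A n d (2 * n) =
    ∑ e ∈ Finset.range (n + 1), hbeta d e hd * ((hrho d ^ 2) ^ (n - e) / ((n - e).factorial : ℝ)) := by
  rw [hA_eq d n _ hd hn le_rfl, hQ, Polynomial.eval_finsetSum, Finset.mul_sum, Finset.mul_sum]
  refine Finset.sum_congr rfl fun e he => ?_
  have he' := Finset.mem_range.1 he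
  rw [Polynomial.eval_mul, Polynomial.eval_C, hbeta]
  have : (-1 : ℝ) ^ n * (-1) ^ (n - e) = (-1) ^ e := by
    obtain ⟨m, rfl⟩ := Nat.exists_eq_add_of_le (show e ≤ n by omega)
    rw [Nat.add_sub_cancel_left, pow_add, mul_assoc, ← mul_pow]; simp
  rw [neg_pow (hrho d ^ 2), ← this]
  ring

lemma hheat (d n : ℕ) (hd : 1 ≤ d) : heatCoeff n d =
    ∑ e ∈ Finset.range (n + 1), hbeta d e hd * ((hrho d ^ 2) ^ (n - e) / ((n - e).factorial : ℝ)) := by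
  rcases Nat.eq_zero_or_pos n with rfl | hn
  · rw [heatCoeff, if_pos rfl]
    simp only [zero_add, Finset.range_one, Finset.sum_singleton, Nat.sub_self, pow_zero,
      Nat.factorial_zero, Nat.cast_one, div_one, mul_one]
    rw [hbeta_low d 0 hd (Or.inr (by omega)), if_pos (by omega)]
    simp only [Nat.cast_zero, sub_zero, mul_zero, Nat.sub_zero]
    rw [hm_lead]
    have h1 := Real.Gamma_mul_Gamma_add_half ((d : ℝ) / 2)
    have h2 : Real.Gamma (2 * ((d : ℝ) / 2)) = (d - 1).factorial := by
      rw [← Real.Gamma_nat_eq_factorial, Nat.cast_sub hd]; congr 1; push_cast; ring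
    have h3 : (0 : ℝ) < Real.Gamma ((d : ℝ) / 2 + 1 / 2) := Real.Gamma_pos_of_pos (by positivity)
    rw [h2] at h1
    rw [show ((d : ℝ) + 1) / 2 = d / 2 + 1 / 2 by ring]
    have hpi := Real.pi_pos
    have h4 : (4 * Real.pi) ^ ((d : ℝ) / 2) = 2 ^ (d : ℝ) * Real.pi ^ ((d : ℝ) / 2) := by
      rw [Real.mul_rpow (by norm_num) hpi.le, show (4 : ℝ) = 2 ^ (2 : ℝ) by norm_num,
        ← Real.rpow_mul (by norm_num)]
      congr 2; ring
    rw [h4, Real.rpow_add hpi, ← Real.sqrt_eq_rpow]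
    rw [show 1 - 2 * ((d : ℝ) / 2) = 1 + -d by ring, Real.rpow_add (by norm_num),
      Real.rpow_neg (by norm_num), Real.rpow_one] at h1
    have h5 : (0 : ℝ) < 2 ^ (d : ℝ) := by positivity
    have h6 : (0 : ℝ) < Real.pi ^ ((d : ℝ) / 2) := by positivity
    have h7 : (0 : ℝ) < (d - 1).factorial := by positivity
    field_simp at h1 ⊢
    linear_combination -h1
  · rw [heatCoeff, if_neg (by omega), hA_beta d n hd hn]

open Polynomial in
/-- Gaussian moments over the relevant half line or line -/
noncomputable def hJ (d b a : ℕ) : ℝ :=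
  if Even d then ∫ y in Set.Ioi (0 : ℝ), hphi (hD^[b] (X ^ a)) y
  else 1 / 2 * ∫ y in Set.univ, hphi (hD^[b] (X ^ a)) y

/-- coefficient of `h^k` in the normalized lattice sum -/
noncomputable def hcoef (d k : ℕ) : ℝ := ∑ c ∈ Finset.range d,
  if c ≤ k then (hm d).coeff (d - 1 - c) * (PowerSeries.coeff (k - c) hW⁻¹ * hJ d (k - c) (d - 1 - c))
  else 0

lemma hcoef_odd (d k : ℕ) (hd : 1 ≤ d) (hk : Odd k) : hcoef d k = 0 := by
  refine Finset.sum_eq_zero fun c hc => ?_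
  have hc' := Finset.mem_range.1 hc
  split_ifs with h
  · rcases Nat.even_or_odd c with hce | hco
    · obtain ⟨b, hb⟩ : ∃ b, k - c = b + 1 := ⟨k - c - 1, by
        obtain ⟨x, hx⟩ := hk; obtain ⟨y, hy⟩ := hce; omega⟩
      have : hJ d (k - c) (d - 1 - c) = 0 := by
        rw [hJ, hb, Function.iterate_succ_apply']
        split_ifs with he
        · rw [hphi_int_Ioi, hD_iter_zero, if_neg, neg_zero]
          rintro ⟨h1, h2⟩
          obtain ⟨x, hx⟩ := hk; obtain ⟨y, hy⟩ := hce; obtain ⟨z, hz⟩ := h2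
          obtain ⟨w, hw⟩ := he
          omega
        · rw [hphi_int_univ, mul_zero]
      rw [this]; simp
    · rw [hm_coeff_zero d hd c (by omega) hco, zero_mul]
  · rfl

lemma hcoef_even (d e : ℕ) (hd : 1 ≤ d) : hcoef d (2 * e) = hbeta d e hd := by
  have hz : PowerSeries.coeff 0 hW⁻¹ = 1 := by simp [hW_const]
  by_cases hlow : Odd d ∨ 2 * e < d
  · rw [hbeta_low d e hd hlow, hcoef]
    have key : ∀ c ∈ Finset.range d, (if c ≤ 2 * e then (hm d).coeff (d - 1 - c) *
        (PowerSeries.coeff (2 * e - c) hW⁻¹ * hJ d (2 * e - c) (d - 1 - c)) else 0) =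
        if c = 2 * e then 1 / 2 * Real.Gamma ((d : ℝ) / 2 - e) * (hm d).coeff (d - 1 - 2 * e) else 0 := by
      intro c hc
      have hc' := Finset.mem_range.1 hc
      by_cases h2 : c = 2 * e
      · subst h2
        rw [if_pos le_rfl, if_pos rfl, Nat.sub_self, hz, hJ, Function.iterate_zero_apply]
        have hcast : (((d - 1 - 2 * e : ℕ) : ℝ) + 1) / 2 = (d : ℝ) / 2 - e := by
          rw [Nat.cast_sub (by omega), Nat.cast_sub hd]; push_cast; ring
        split_ifs with he
        · rw [hphi_gamma, hcast]; ring
        · rw [hphi_gamma_univ, hcast]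
          · ring
          · rw [Nat.not_even_iff_odd] at he
            obtain ⟨x, hx⟩ := he
            exact ⟨x - e, by omega⟩
      · rw [if_neg h2]
        split_ifs with h
        · obtain ⟨b, hb⟩ : ∃ b, 2 * e - c = b + 1 := ⟨2 * e - c - 1, by omega⟩
          have : hJ d (2 * e - c) (d - 1 - c) = 0 := by
            rw [hJ, hb, Function.iterate_succ_apply']
            split_ifs with he
            · rw [hphi_int_Ioi, hD_iter_zero, if_neg, neg_zero]
              rintro ⟨h1, h2⟩
              rcases hlow with hl | hl
              · exact (Nat.not_even_iff_odd.2 hl) he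
              · omega
            · rw [hphi_int_univ, mul_zero]
          rw [this]; simp
        · rfl
    rw [Finset.sum_congr rfl key, Finset.sum_ite_eq']
    simp
  · push Not at hlow
    obtain ⟨h1, h2⟩ := hlow
    rw [Nat.not_odd_iff_even] at h1
    obtain ⟨q, hq⟩ := h1
    obtain rfl : d = 2 * q := by omega
    rw [hbeta_high q e hd (by omega), hcoef, Finset.mul_sum, ← Finset.sum_neg_distrib]
    refine Finset.sum_congr rfl fun c hc => ?_
    have hc' := Finset.mem_range.1 hc
    obtain ⟨b, hb⟩ : ∃ b, 2 * e - c = b + 1 := ⟨2 * e - c - 1, by omega⟩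
    rw [if_pos (by omega), hJ, if_pos (by simp)]
    rw [hb, Function.iterate_succ_apply', hphi_int_Ioi, hD_iter_zero, if_pos ⟨by omega, ⟨e - q, by omega⟩⟩]
    rw [show (b - (2 * q - 1 - c)) / 2 = e - q by omega, Nat.add_sub_cancel]
    ring

lemma hreindex (c K : ℕ) (w : ℕ → ℝ) (h : ℝ) :
    ∑ k ∈ Finset.range K, (if c ≤ k then w (k - c) else 0) * h ^ k =
      h ^ c * ∑ b ∈ Finset.range (K - c), w b * h ^ b := by
  rcases le_total K c with hK | hK
  · rw [Nat.sub_eq_zero_of_le hK]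
    simp only [Finset.range_zero, Finset.sum_empty, mul_zero]
    refine Finset.sum_eq_zero fun k hk => ?_
    rw [if_neg (by have := Finset.mem_range.1 hk; omega), zero_mul]
  · obtain ⟨m, rfl⟩ := Nat.exists_eq_add_of_le hK
    rw [Finset.sum_range_add, Nat.add_sub_cancel_left, Finset.mul_sum]
    rw [Finset.sum_eq_zero fun k hk => by
      rw [if_neg (by have := Finset.mem_range.1 hk; omega), zero_mul], zero_add]
    refine Finset.sum_congr rfl fun b _ => ?_
    rw [if_pos (by omega), Nat.add_sub_cancel_left, pow_add]; ring

open Asymptotics Topology in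
lemma hpow_isBigO {a b : ℕ} (hab : b ≤ a) :
    (fun h : ℝ => h ^ a) =O[𝓝[>] 0] fun h => h ^ b := by
  refine IsBigO.of_bound 1 ?_
  filter_upwards [Ioc_mem_nhdsGT (one_pos : (0 : ℝ) < 1)] with h hh
  rw [one_mul, Real.norm_of_nonneg (pow_nonneg hh.1.le _), Real.norm_of_nonneg (pow_nonneg hh.1.le _)]
  exact pow_le_pow_of_le_one hh.1.le hh.2 hab

open Asymptotics Topology in
lemma hcauchy (n K : ℕ) (a : ℕ → ℝ) (g : ℕ → ℝ → ℝ) (w : ℕ → ℕ → ℝ)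
    (H : ∀ c K, (fun h => g c h - ∑ b ∈ Finset.range K, w c b * h ^ b) =O[𝓝[>] 0] fun h => h ^ K) :
    (fun h => ∑ c ∈ Finset.range n, a c * (h ^ c * g c h) - ∑ k ∈ Finset.range K,
      (∑ c ∈ Finset.range n, if c ≤ k then a c * w c (k - c) else 0) * h ^ k) =O[𝓝[>] 0]
      fun h => h ^ K := by
  have h1 : ∀ c ∈ Finset.range n, (fun h => a c * (h ^ c * (g c h - ∑ b ∈ Finset.range (K - c), w c b * h ^ b)))
      =O[𝓝[>] 0] fun h => h ^ K := by
    intro c _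
    refine IsBigO.const_mul_left ?_ _
    refine (IsBigO.mul (isBigO_refl (fun h : ℝ => h ^ c) _) (H c (K - c))).trans ?_
    simp only [← pow_add]
    exact hpow_isBigO (by omega)
  refine (IsBigO.sum h1).congr_left fun h => ?_
  simp only [Finset.sum_apply, mul_sub, Finset.sum_sub_distrib, Finset.sum_mul]
  congr 1
  rw [Finset.sum_comm]
  refine Finset.sum_congr rfl fun c _ => ?_
  rw [← hreindex, Finset.mul_sum]
  refine Finset.sum_congr rfl fun k _ => ?_
  split_ifs <;> ring

lemma hm_sum (d : ℕ) (hd : 1 ≤ d) (x h : ℝ) :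
    h ^ (d - 1) * ((hm d).eval x * Real.exp (-(x * h) ^ 2)) =
    ∑ c ∈ Finset.range d, (hm d).coeff (d - 1 - c) * (h ^ c * hphi (Polynomial.X ^ (d - 1 - c)) (x * h)) := by
  rw [Polynomial.eval_eq_sum_range' (n := d) (by have := hm_natDegree d; omega),
    ← Finset.sum_range_reflect, Finset.sum_mul, Finset.mul_sum]
  refine Finset.sum_congr rfl fun c hc => ?_
  have hc' := Finset.mem_range.1 hc
  obtain ⟨m, hm⟩ := Nat.exists_eq_add_of_le (show c ≤ d - 1 by omega)
  rw [hphi, Polynomial.eval_pow, Polynomial.eval_X, mul_pow, hm, Nat.add_sub_cancel_left, pow_add]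
  ring

lemma hm_summable {ι : Type} [Countable ι] {x : ι → ℝ} {U : Set ℝ} (hx : hTile x U)
    {h : ℝ} (h0 : 0 < h) (h1 : h ≤ 1) (d : ℕ) (hd : 1 ≤ d) :
    Summable fun i => (hm d).eval (x i) * Real.exp (-(x i * h) ^ 2) := by
  have : Summable fun i => h ^ (d - 1) * ((hm d).eval (x i) * Real.exp (-(x i * h) ^ 2)) := by
    simp only [hm_sum d hd]
    exact summable_sum fun c _ => ((hphi_summable hx h0 h1 _).mul_left _).mul_left _
  exact (summable_mul_left_iff (pow_pos h0 _).ne').1 this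

lemma hm_tsum {ι : Type} [Countable ι] {x : ι → ℝ} {U : Set ℝ} (hx : hTile x U)
    {h : ℝ} (h0 : 0 < h) (h1 : h ≤ 1) (d : ℕ) (hd : 1 ≤ d) :
    h ^ d * ∑' i, (hm d).eval (x i) * Real.exp (-(x i * h) ^ 2) =
      ∑ c ∈ Finset.range d, (hm d).coeff (d - 1 - c) * (h ^ c * hS x (Polynomial.X ^ (d - 1 - c)) h) := by
  have e : h ^ d = h * h ^ (d - 1) := by rw [← pow_succ']; congr 1; omega
  rw [e, mul_assoc, ← tsum_mul_left]
  simp only [hm_sum d hd]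
  rw [Summable.tsum_finsetSum fun c _ => ((hphi_summable hx h0 h1 _).mul_left _).mul_left _,
    Finset.mul_sum]
  refine Finset.sum_congr rfl fun c _ => ?_
  rw [tsum_mul_left, tsum_mul_left, hS]; ring

/-- the shifted lattice sum -/
noncomputable def hL (d : ℕ) (h : ℝ) : ℝ :=
  if Even d then ∑' k : ℕ, (hm d).eval ((k : ℝ) + 1 / 2) * Real.exp (-(((k : ℝ) + 1 / 2) * h) ^ 2)
  else 1 / 2 * ∑' k : ℤ, (hm d).eval (k : ℝ) * Real.exp (-((k : ℝ) * h) ^ 2)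

open Asymptotics Topology in
lemma hL_expand (d K : ℕ) (hd : 1 ≤ d) :
    (fun h => h ^ d * hL d h - ∑ k ∈ Finset.range K, hcoef d k * h ^ k) =O[𝓝[>] 0] fun h => h ^ K := by
  have hev : ∀ᶠ h : ℝ in 𝓝[>] 0, h ∈ Set.Ioc (0 : ℝ) 1 := Ioc_mem_nhdsGT one_pos
  by_cases he : Even d
  · have := hcauchy d K (fun c => (hm d).coeff (d - 1 - c))
      (fun c h => hS (fun k : ℕ => (k : ℝ) + 1 / 2) (Polynomial.X ^ (d - 1 - c)) h)
      (fun c b => PowerSeries.coeff b hW⁻¹ * hJ d b (d - 1 - c))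
      (fun c K => by
        simp only [hJ, if_pos he]
        exact hS_expand hTile_half K _)
    refine this.congr' ?_ (Filter.EventuallyEq.refl _ _)
    filter_upwards [hev] with h hh
    rw [hL, if_pos he, hm_tsum hTile_half hh.1 hh.2 d hd]
    rfl
  · have := hcauchy d K (fun c => (hm d).coeff (d - 1 - c))
      (fun c h => 1 / 2 * hS (fun k : ℤ => (k : ℝ)) (Polynomial.X ^ (d - 1 - c)) h)
      (fun c b => PowerSeries.coeff b hW⁻¹ * hJ d b (d - 1 - c))
      (fun c K => by
        simp only [hJ, if_neg he]
        refine ((hS_expand hTile_int K (Polynomial.X ^ (d - 1 - c))).const_mul_left (1 / 2)).congr_left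
          fun h => ?_
        rw [mul_sub, Finset.mul_sum]
        congr 1
        exact Finset.sum_congr rfl fun b _ => by ring)
    refine this.congr' ?_ (Filter.EventuallyEq.refl _ _)
    filter_upwards [hev] with h hh
    have h2 := hm_tsum hTile_int hh.1 hh.2 d hd
    rw [hL, if_neg he, mul_left_comm, h2, Finset.mul_sum]
    have h3 : ∑ c ∈ range d, (hm d).coeff (d - 1 - c) *
        (h ^ c * (1 / 2 * hS (fun k : ℤ => (k : ℝ)) (Polynomial.X ^ (d - 1 - c)) h)) =
        ∑ c ∈ range d, 1 / 2 * ((hm d).coeff (d - 1 - c) *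
        (h ^ c * hS (fun k : ℤ => (k : ℝ)) (Polynomial.X ^ (d - 1 - c)) h)) :=
      Finset.sum_congr rfl fun c _ => by ring
    rw [h3]
    rfl

open Asymptotics Topology Filter in
lemma hL_expand_t (d N : ℕ) (hd : 1 ≤ d) :
    (fun t : ℝ => √t ^ d * hL d √t - ∑ e ∈ Finset.range N, hbeta d e hd * t ^ e)
      =O[𝓝[>] 0] fun t => t ^ N := by
  have hs : Tendsto (fun t : ℝ => √t) (𝓝[>] 0) (𝓝[>] 0) := by
    refine tendsto_nhdsWithin_iff.2 ⟨?_, ?_⟩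
    · have : Tendsto (fun t : ℝ => √t) (𝓝 0) (𝓝 (√0)) := Real.continuous_sqrt.tendsto 0
      rw [Real.sqrt_zero] at this
      exact this.mono_left nhdsWithin_le_nhds
    · filter_upwards [self_mem_nhdsWithin] with t ht
      exact Real.sqrt_pos.2 ht
  have h1 := (hL_expand d (2 * N) hd).comp_tendsto hs
  refine h1.congr' ?_ ?_
  · filter_upwards [self_mem_nhdsWithin] with t ht
    have hsq : √t ^ 2 = t := Real.sq_sqrt (le_of_lt ht)
    simp only [Function.comp]
    congr 1
    clear h1
    induction N with
    | zero => simp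
    | succ N ih =>
      rw [show 2 * (N + 1) = 2 * N + 1 + 1 by ring, Finset.sum_range_succ, Finset.sum_range_succ, ih,
        Finset.sum_range_succ, hcoef_odd d _ hd ⟨N, rfl⟩, hcoef_even d N hd, pow_mul, hsq]
      ring
  · filter_upwards [self_mem_nhdsWithin] with t ht
    have hsq : √t ^ 2 = t := Real.sq_sqrt (le_of_lt ht)
    simp only [Function.comp]
    rw [pow_mul, hsq]

open Asymptotics Topology Filter in
lemma hE_expand (r : ℝ) (K : ℕ) :
    (fun t : ℝ => Real.exp (t * r) - ∑ b ∈ Finset.range K, (r ^ b / b.factorial) * t ^ b)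
      =O[𝓝[>] 0] fun t => t ^ K := by
  have hs : Tendsto (fun t : ℝ => t * r) (𝓝[>] 0) (𝓝 0) := by
    have : Tendsto (fun t : ℝ => t * r) (𝓝 0) (𝓝 (0 * r)) := (continuous_mul_const r).tendsto 0
    rw [zero_mul] at this
    exact this.mono_left nhdsWithin_le_nhds
  have h1 := (Real.exp_sub_sum_range_isBigO_pow K).comp_tendsto hs
  have h2 : ((fun x : ℝ => x ^ K) ∘ fun t : ℝ => t * r) =O[𝓝[>] 0] fun t : ℝ => t ^ K := by
    have : ((fun x : ℝ => x ^ K) ∘ fun t : ℝ => t * r) = fun t => r ^ K * t ^ K := by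
      ext t; simp only [Function.comp, mul_pow]; ring
    rw [this]
    exact (isBigO_refl _ _).const_mul_left _
  refine (h1.trans h2).congr_left fun t => ?_
  simp only [Function.comp]
  congr 1
  exact Finset.sum_congr rfl fun b _ => by rw [mul_pow]; ring

open Asymptotics Topology Filter in
lemma hF_expand (d N : ℕ) (hd : 1 ≤ d) :
    (fun t : ℝ => Real.exp (t * hrho d ^ 2) * (√t ^ d * hL d √t) -
      ∑ n ∈ Finset.range N, heatCoeff n d * t ^ n) =O[𝓝[>] 0] fun t => t ^ N := by
  have h1 := hcauchy N N (fun e => hbeta d e hd) (fun _ t => Real.exp (t * hrho d ^ 2))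
    (fun _ b => (hrho d ^ 2) ^ b / b.factorial) (fun _ K => hE_expand _ K)
  have hb : (fun t : ℝ => Real.exp (t * hrho d ^ 2)) =O[𝓝[>] 0] fun _ => (1 : ℝ) := by
    have : Tendsto (fun t : ℝ => Real.exp (t * hrho d ^ 2)) (𝓝 0) (𝓝 (Real.exp (0 * hrho d ^ 2))) :=
      Continuous.tendsto (by fun_prop) 0
    exact (this.mono_left nhdsWithin_le_nhds).isBigO_one ℝ
  have h2 := hb.mul (hL_expand_t d N hd)
  simp only [one_mul] at h2
  refine (h2.add h1).congr_left fun t => ?_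
  have h3 : ∑ k ∈ Finset.range N, (∑ c ∈ Finset.range N, if c ≤ k then hbeta d c hd *
      ((hrho d ^ 2) ^ (k - c) / ((k - c).factorial : ℝ)) else 0) * t ^ k =
      ∑ n ∈ Finset.range N, heatCoeff n d * t ^ n := by
    refine Finset.sum_congr rfl fun n hn => ?_
    have hn' := Finset.mem_range.1 hn
    congr 1
    rw [hheat d n hd, ← Finset.sum_filter]
    refine Finset.sum_congr ?_ fun _ _ => rfl
    ext c; simp only [Finset.mem_filter, Finset.mem_range]; omega
  rw [h3, mul_sub, Finset.mul_sum]
  have h4 : ∑ c ∈ Finset.range N, hbeta d c hd * (t ^ c * Real.exp (t * hrho d ^ 2)) =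
      ∑ c ∈ Finset.range N, Real.exp (t * hrho d ^ 2) * (hbeta d c hd * t ^ c) :=
    Finset.sum_congr rfl fun c _ => by ring
  rw [h4]; ring

lemma hshift (q : ℕ) (f : ℕ → ℝ) (hf : Summable f) (h0 : ∀ k < q, f k = 0) :
    ∑' k, f k = ∑' k, f (k + q) := by
  rw [← hf.sum_add_tsum_nat_add q, Finset.sum_eq_zero fun k hk => h0 k (Finset.mem_range.1 hk), zero_add]

lemma htrace (d : ℕ) (hd : 1 ≤ d) (h : ℝ) (h0 : 0 < h) (h1 : h ≤ 1) :
    ∑' k : ℕ, sphMu k d * Real.exp (-(((k : ℝ) + hrho d) * h) ^ 2) = hL d h := by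
  have hmu : ∀ k : ℕ, 2 ≤ d → (hm d).eval (k + hrho d) = sphMu k d := by
    intro k h2
    rcases Nat.eq_zero_or_pos k with rfl | hk
    · rw [← hm_mu_zero d h2]; simp
    · exact hm_mu d k hd (by omega)
  rw [hL]
  split_ifs with he
  · obtain ⟨q, hq⟩ := he
    have hr : hrho d = ((q - 1 : ℕ) : ℝ) + 1 / 2 := by
      rw [hrho, hq, Nat.cast_sub (by omega)]; push_cast; ring
    have hsum := hm_summable hTile_half h0 h1 d hd
    rw [hshift (q - 1) _ hsum]
    · refine tsum_congr fun k => ?_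
      rw [← hmu k (by omega), hr]
      push_cast
      rw [add_assoc]
    · intro k hk
      have := hm_zero d (q - 1 - k) (by omega) (by omega)
      rw [hr, Nat.cast_sub (show k ≤ q - 1 by omega),
        show ((q - 1 : ℕ) : ℝ) + 1 / 2 - (((q - 1 : ℕ) : ℝ) - k) = k + 1 / 2 by ring] at this
      simp only [this, zero_mul]
  · rw [Nat.not_even_iff_odd] at he
    obtain ⟨q, hq⟩ := he
    have hr : hrho d = (q : ℝ) := by
      rw [hrho, hq]; push_cast; ring
    have hsum := hm_summable hTile_int h0 h1 d hd
    set f : ℤ → ℝ := fun k => (hm d).eval (k : ℝ) * Real.exp (-((k : ℝ) * h) ^ 2) with hf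
    have heven : Function.Even f := by
      intro k
      simp only [hf]
      push_cast
      rw [hm_parity d _ hd, hq]
      simp
    have hnat : Summable fun n : ℕ => f n :=
      hsum.comp_injective (i := fun n : ℕ => (n : ℤ)) Nat.cast_injective
    have hs := tsum_int_eq_zero_add_two_mul_tsum_pnat heven hsum
    have hs2 : ∑' n : ℕ+, f ((n : ℕ) : ℤ) = ∑' n : ℕ, f ((n + 1 : ℕ) : ℤ) :=
      tsum_pnat_eq_tsum_succ (f := fun n : ℕ => f (n : ℤ))
    rw [hs, hs2, two_nsmul]
    have hs3 := hnat.tsum_eq_zero_add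
    by_cases hq0 : q = 0
    · subst hq0
      have hd1 : d = 1 := by omega
      subst hd1
      have hg : ∀ k : ℕ, sphMu (k + 1) 1 * Real.exp (-((((k + 1 : ℕ) : ℝ) + hrho 1) * h) ^ 2) =
          f ((k + 1 : ℕ) : ℤ) := by
        intro k
        rw [← hm_mu 1 (k + 1) hd (by omega), hr]
        simp [hf]
      have hsm : Summable fun k : ℕ => sphMu k 1 * Real.exp (-(((k : ℝ) + hrho 1) * h) ^ 2) := by
        rw [← summable_nat_add_iff 1]
        simp only [hg]
        exact (summable_nat_add_iff 1).2 hnat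
      rw [hsm.tsum_eq_zero_add]
      simp only [hg]
      have hf0 : f 0 = 2 := by simp [hf, hm_one]
      have : sphMu 0 1 = 1 := by simp [sphMu]
      rw [hf0, this, hr]
      simp
      ring
    · have hz : ∀ k < q, f ((k : ℕ) : ℤ) = 0 := by
        intro k hk
        have := hm_zero d (q - k) (by omega) (by omega)
        rw [hr, Nat.cast_sub hk.le, show (q : ℝ) - (q - k) = k by ring] at this
        simp [hf, this]
      have hf0 : f 0 = 0 := by simpa using hz 0 (by omega)
      have h5 := hshift q _ hnat hz
      rw [hf0]
      have h6 : ∑' n : ℕ, f ((n + 1 : ℕ) : ℤ) = ∑' n : ℕ, f ((n + q : ℕ) : ℤ) := by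
        rw [← h5, hs3]; simp [hf0]
      rw [h6]
      have h7 : ∑' k : ℕ, sphMu k d * Real.exp (-(((k : ℝ) + hrho d) * h) ^ 2) =
          ∑' n : ℕ, f ((n + q : ℕ) : ℤ) := by
        refine tsum_congr fun k => ?_
        rw [← hmu k (by omega), hr]
        simp [hf]
      rw [h7]; ring

lemma htrace_t (d : ℕ) (hd : 1 ≤ d) (t : ℝ) (h0 : 0 < t) (h1 : t ≤ 1) :
    ∑' k : ℕ, sphMu k d * Real.exp (-(t * (sphLam k d))) =
      Real.exp (t * hrho d ^ 2) * hL d √t := by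
  rw [← htrace d hd √t (Real.sqrt_pos.2 h0) (by rw [← Real.sqrt_one]; exact Real.sqrt_le_sqrt h1),
    ← tsum_mul_left]
  refine tsum_congr fun k => ?_
  rw [mul_left_comm, ← Real.exp_add, ← hlam d k hd]
  congr 2
  rw [mul_pow, Real.sq_sqrt h0.le]
  ring


/-- for every integer `d ≥ 1` and `N ≥ 0`, as `t → 0+`,
`Σ_{k=0}^∞ μ_{k,d} e^{-t k(k+d-1)} = Σ_{n=0}^N a_{n,d} t^{n-d/2} + o(t^{N-d/2})`. -/
theorem heat_trace_asymptotics_sphere (d : ℕ) (hd : 1 ≤ d) (N : ℕ) :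
    (fun t : ℝ =>
        (∑' k : ℕ, sphMu k d * Real.exp (-(t * (sphLam k d)))) -
          ∑ n ∈ Finset.range (N + 1), heatCoeff n d * t ^ ((n : ℝ) - (d : ℝ) / 2))
      =o[nhdsWithin 0 (Set.Ioi 0)] fun t : ℝ => t ^ ((N : ℝ) - (d : ℝ) / 2) := by
  have h1 := hF_expand d (N + 1) hd
  have h2 : (fun t : ℝ => t ^ (N + 1)) =o[nhdsWithin 0 (Set.Ioi 0)] fun t : ℝ => t ^ N := by
    have : (fun t : ℝ => t ^ (N + 1)) =o[nhds 0] fun t : ℝ => t ^ N :=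
      Asymptotics.isLittleO_pow_pow (Nat.lt_succ_self N)
    exact this.mono nhdsWithin_le_nhds
  have h3 := (Asymptotics.isBigO_refl (fun t : ℝ => t ^ (-((d : ℝ) / 2)))
    (nhdsWithin 0 (Set.Ioi 0))).mul_isLittleO (h1.trans_isLittleO h2)
  have hev : ∀ᶠ t : ℝ in nhdsWithin 0 (Set.Ioi 0), t ∈ Set.Ioc (0 : ℝ) 1 := Ioc_mem_nhdsGT one_pos
  refine h3.congr' ?_ ?_
  · filter_upwards [hev] with t ht
    have hr : ∀ n : ℕ, t ^ ((n : ℝ) - (d : ℝ) / 2) = t ^ (-((d : ℝ) / 2)) * t ^ n := by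
      intro n
      rw [sub_eq_neg_add, Real.rpow_add ht.1, Real.rpow_natCast]
    have hs : t ^ (-((d : ℝ) / 2)) * √t ^ d = 1 := by
      rw [Real.sqrt_eq_rpow, ← Real.rpow_natCast, ← Real.rpow_mul ht.1.le, ← Real.rpow_add ht.1]
      rw [show -((d : ℝ) / 2) + 1 / 2 * d = 0 by ring, Real.rpow_zero]
    rw [htrace_t d hd t ht.1 ht.2, mul_sub, Finset.mul_sum]
    congr 1
    · linear_combination (Real.exp (t * hrho d ^ 2) * hL d √t) * hs
    · refine Finset.sum_congr rfl fun n _ => ?_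
      rw [hr]; ring
  · filter_upwards [hev] with t ht
    rw [sub_eq_neg_add, Real.rpow_add ht.1, Real.rpow_natCast]
end

section
/- For all integers d ≥ 1, n ≥ 1 and all integers ω, ω' with ω ≥ 2n and ω' ≥ 2n one has A_{n,d}(ω) = A_{n,d}(ω'); i.e., the expression A_{n,d}(ω) does not depend on the choice of ω ≥ 2n. -/
open Finset

namespace AIndep

/-- Span of the binomial functions `j ↦ C(j,m)`, `m ≤ M`. -/
def V (M : ℕ) : Submodule ℝ (ℕ → ℝ) :=
  Submodule.span ℝ ((fun m : ℕ => fun j : ℕ => (j.choose m : ℝ)) '' Set.Iic M)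

lemma choose_mem {m M : ℕ} (h : m ≤ M) : (fun j : ℕ => (j.choose m : ℝ)) ∈ V M :=
  Submodule.subset_span ⟨m, h, rfl⟩

lemma V_mono {M M' : ℕ} (h : M ≤ M') : V M ≤ V M' :=
  Submodule.span_mono (Set.image_mono (Set.Iic_subset_Iic.mpr h))

lemma mul_choose (j m : ℕ) :
    (j : ℝ) * (j.choose m : ℝ) = m * (j.choose m : ℝ) + (m + 1) * (j.choose (m + 1) : ℝ) := by
  have h := Nat.choose_succ_right_eq j m
  rcases le_or_gt m j with hm | hm
  · have h' : (j.choose (m + 1) : ℝ) * (m + 1) = j.choose m * (j - m) := by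
      rw [← Nat.cast_sub hm]; exact_mod_cast h
    linarith
  · simp [Nat.choose_eq_zero_of_lt hm, Nat.choose_eq_zero_of_lt (Nat.lt_succ_of_lt hm)]

lemma mul_mem {M : ℕ} {f : ℕ → ℝ} (hf : f ∈ V M) : (fun j : ℕ => (j : ℝ) * f j) ∈ V (M + 1) := by
  induction hf using Submodule.span_induction with
  | mem x hx =>
    obtain ⟨m, hm, rfl⟩ := hx
    have hm' : m ≤ M := hm
    have : (fun j : ℕ => (j : ℝ) * (j.choose m : ℝ)) =
        (m : ℝ) • (fun j : ℕ => (j.choose m : ℝ))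
          + ((m : ℝ) + 1) • (fun j : ℕ => (j.choose (m + 1) : ℝ)) := by
      funext j; simpa using mul_choose j m
    show (fun j : ℕ => (j : ℝ) * (j.choose m : ℝ)) ∈ _
    rw [this]
    exact Submodule.add_mem _ (Submodule.smul_mem _ _ (choose_mem (by omega)))
      (Submodule.smul_mem _ _ (choose_mem (by omega)))
  | zero =>
    convert (V (M + 1)).zero_mem using 1
    funext j; simp
  | add x y _ _ hx hy =>
    have := Submodule.add_mem _ hx hy
    convert this using 1
    funext j; simp [mul_add]
  | smul a x _ hx =>
    have := Submodule.smul_mem _ a hx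
    convert this using 1
    funext j; simp; ring

lemma lam_mul_mem (e : ℕ) {M : ℕ} {f : ℕ → ℝ} (hf : f ∈ V M) :
    (fun j : ℕ => ((j : ℝ) * (j + e)) * f j) ∈ V (M + 2) := by
  have h1 := mul_mem hf
  have h2 := mul_mem h1
  have h3 := Submodule.add_mem _ h2 (Submodule.smul_mem _ (e : ℝ) (V_mono (Nat.le_succ _) h1))
  convert h3 using 1
  funext j; simp; ring

lemma eigen (j m : ℕ) :
    ((j : ℝ) + 1) * ((j + 1).choose m : ℝ) - (j + 1) * (j.choose m : ℝ)
      = m * ((j + 1).choose m : ℝ) := by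
  have h := Nat.choose_mul_succ_eq j m
  rcases le_or_gt m (j + 1) with hm | hm
  · have h' : (j.choose m : ℝ) * (j + 1) = (j + 1).choose m * ((j + 1 : ℕ) - m) := by
      rw [← Nat.cast_sub hm]; exact_mod_cast h
    push_cast at h'
    linarith
  · simp [Nat.choose_eq_zero_of_lt hm, Nat.choose_eq_zero_of_lt (show j < m by omega)]

lemma solve (n : ℕ) (hn : 1 ≤ n) {M : ℕ} {R : ℕ → ℝ} (hR : R ∈ V M) :
    ∃ P ∈ V M, (n : ℝ) * P 0 = R 0 ∧
      ∀ j : ℕ, ((j : ℝ) + 1 + n) * P (j + 1) - (j + 1) * P j = R (j + 1) := by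
  induction hR using Submodule.span_induction with
  | mem x hx =>
    obtain ⟨m, hm, rfl⟩ := hx
    have hm' : m ≤ M := hm
    have hne : (n : ℝ) + m ≠ 0 := by positivity
    refine ⟨((n : ℝ) + m)⁻¹ • (fun j : ℕ => (j.choose m : ℝ)),
      Submodule.smul_mem _ _ (choose_mem hm'), ?_, ?_⟩
    · rcases Nat.eq_zero_or_pos m with rfl | h
      · simp at hne ⊢; field_simp
      · simp [Nat.choose_eq_zero_of_lt h]
    · intro j
      have h := eigen j m
      simp only [Pi.smul_apply, smul_eq_mul]
      field_simp
      linarith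
  | zero => exact ⟨0, Submodule.zero_mem _, by simp, by simp⟩
  | add x y _ _ hx hy =>
    obtain ⟨P, hP, h0, h1⟩ := hx
    obtain ⟨Q, hQ, k0, k1⟩ := hy
    refine ⟨P + Q, Submodule.add_mem _ hP hQ, ?_, ?_⟩
    · simp only [Pi.add_apply]; linarith
    · intro j; simp only [Pi.add_apply]; linarith [h1 j, k1 j]
  | smul a x _ hx =>
    obtain ⟨P, hP, h0, h1⟩ := hx
    refine ⟨a • P, Submodule.smul_mem _ a hP, ?_, ?_⟩
    · simp only [Pi.smul_apply, smul_eq_mul]; rw [← h0]; ring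
    · intro j; simp only [Pi.smul_apply, smul_eq_mul]; rw [← h1 j]; ring

lemma choose_vanish {m N : ℕ} (h : m < N) :
    ∑ j ∈ range (N + 1), (-1 : ℝ) ^ j * (N.choose j : ℝ) * (j.choose m : ℝ) = 0 := by
  have h1 := fwdDiff_iter_choose_zero m N
  rw [fwdDiff_iter_eq_sum_shift, if_neg h.ne'] at h1
  have h2 : ∑ j ∈ range (N + 1), (-1 : ℝ) ^ (N - j) * (N.choose j : ℝ) * (j.choose m : ℝ) = 0 := by
    have := congrArg (Int.cast : ℤ → ℝ) h1
    simpa using this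
  have h3 : ∑ j ∈ range (N + 1), (-1 : ℝ) ^ j * (N.choose j : ℝ) * (j.choose m : ℝ)
      = (-1) ^ N * ∑ j ∈ range (N + 1),
        (-1 : ℝ) ^ (N - j) * (N.choose j : ℝ) * (j.choose m : ℝ) := by
    rw [mul_sum]
    refine sum_congr rfl fun j hj => ?_
    have hj' : j ≤ N := by simpa [Nat.lt_succ_iff] using hj
    obtain ⟨t, rfl⟩ := Nat.exists_eq_add_of_le hj'
    have : (-1 : ℝ) ^ t * (-1) ^ t = 1 := by rw [← mul_pow]; simp
    rw [Nat.add_sub_cancel_left, pow_add]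
    linear_combination (-(-1 : ℝ) ^ j * ((j + t).choose j : ℝ) * (j.choose m : ℝ)) * this
  rw [h3, h2, mul_zero]

lemma vanish {M N : ℕ} (h : M < N) {f : ℕ → ℝ} (hf : f ∈ V M) :
    ∑ j ∈ range (N + 1), (-1 : ℝ) ^ j * (N.choose j : ℝ) * f j = 0 := by
  induction hf using Submodule.span_induction with
  | mem x hx =>
    obtain ⟨m, hm, rfl⟩ := hx
    exact choose_vanish (lt_of_le_of_lt hm h)
  | zero => simp
  | add x y _ _ hx hy => simp only [Pi.add_apply, mul_add, sum_add_distrib, hx, hy, add_zero]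
  | smul a x _ hx =>
    have : ∀ j, (-1 : ℝ) ^ j * (N.choose j : ℝ) * (a • x) j
        = a * ((-1 : ℝ) ^ j * (N.choose j : ℝ) * x j) := by
      intro j; simp only [Pi.smul_apply, smul_eq_mul]; ring
    simp only [this, ← mul_sum, hx, mul_zero]

/-- Divided-difference weights (up to a constant). -/
noncomputable def c (e j k : ℕ) : ℝ :=
  (-1) ^ (j + k) * sphMu k (e + 1) / ((j - k).factorial * (j + k + e).factorial)

/-- Divided difference of `x^m` at `λ_0, …, λ_j` (up to a constant). -/
noncomputable def D (e j m : ℕ) : ℝ :=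
  ∑ k ∈ range (j + 1), c e j k * ((k : ℝ) * (k + e)) ^ m

lemma c_rec (e j k : ℕ) (h : k ≤ j) :
    c e j k = c e (j + 1) k * ((k : ℝ) * (k + e) - ((j : ℝ) + 1) * (j + 1 + e)) := by
  obtain ⟨t, rfl⟩ := Nat.exists_eq_add_of_le h
  unfold c
  rw [show k + t - k = t by omega, show k + t + 1 - k = t + 1 by omega,
    show k + t + 1 + k + e = (k + t + k + e) + 1 by ring, Nat.factorial_succ, Nat.factorial_succ,
    show k + t + 1 + k = k + t + k + 1 by ring, pow_succ]
  have h1 : (t.factorial : ℝ) ≠ 0 := by positivity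
  have h2 : ((k + t + k + e).factorial : ℝ) ≠ 0 := by positivity
  have h3 : (t : ℝ) + 1 ≠ 0 := by positivity
  have h4 : (k : ℝ) + t + k + e + 1 ≠ 0 := by positivity
  push_cast
  field_simp
  ring

lemma D_rec (e j m : ℕ) :
    D e (j + 1) (m + 1) = ((j : ℝ) + 1) * (j + 1 + e) * D e (j + 1) m + D e j m := by
  have h : D e j m = ∑ k ∈ range (j + 1), c e (j + 1) k *
      ((k : ℝ) * (k + e) - ((j : ℝ) + 1) * (j + 1 + e)) * ((k : ℝ) * (k + e)) ^ m := by
    unfold D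
    refine sum_congr rfl fun k hk => ?_
    rw [c_rec e j k (by simpa [Nat.lt_succ_iff] using hk)]
  rw [h]
  unfold D
  rw [sum_range_succ, sum_range_succ _ (j + 1), mul_add (((j : ℝ) + 1) * (j + 1 + e)) _ _, mul_sum]
  have : ∀ k : ℕ, c e (j + 1) k * ((k : ℝ) * (k + e)) ^ (m + 1)
      = ((j : ℝ) + 1) * (j + 1 + e) * (c e (j + 1) k * ((k : ℝ) * (k + e)) ^ m)
      + c e (j + 1) k * ((k : ℝ) * (k + e) - ((j : ℝ) + 1) * (j + 1 + e))
        * ((k : ℝ) * (k + e)) ^ m := by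
    intro k; ring
  rw [sum_congr rfl fun k _ => this k, sum_add_distrib]
  push_cast
  ring

lemma mu_succ (e k : ℕ) : sphMu (k + 1) (e + 1) =
    (2 * k + 2 + e) * (k + e).factorial / ((k + 1).factorial * e.factorial) := by
  unfold sphMu
  rw [if_neg (by omega), show k + 1 + (e + 1) - 2 = k + e by omega, Nat.add_sub_cancel]
  push_cast
  congr 2
  ring

lemma partial_sum (e j K : ℕ) (h : K ≤ j) :
    ∑ k ∈ range (K + 1), c e (j + 1) k =
      (-1) ^ (j + 1 + K) * (K + e).factorial /
        ((j + 1) * K.factorial * e.factorial * (j - K).factorial * (j + 1 + K + e).factorial) := by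
  induction K with
  | zero =>
    have h1 : (e.factorial : ℝ) ≠ 0 := by positivity
    have h2 : (j.factorial : ℝ) ≠ 0 := by positivity
    simp [c, sphMu, Nat.factorial_succ]
    field_simp
  | succ K ih =>
    rw [sum_range_succ, ih (by omega)]
    unfold c
    rw [mu_succ]
    obtain ⟨t, rfl⟩ := Nat.exists_eq_add_of_le h
    rw [show K + 1 + t - K = t + 1 by omega, show K + 1 + t - (K + 1) = t by omega,
      show K + 1 + t + 1 - (K + 1) = t + 1 by omega,
      show K + 1 + t + 1 + (K + 1) + e = (K + 1 + t + 1 + K + e) + 1 by ring,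
      show K + 1 + e = (K + e) + 1 by ring,
      show K + 1 + t + 1 + (K + 1) = (K + 1 + t + 1 + K) + 1 by ring]
    simp only [Nat.factorial_succ, pow_succ]
    have h1 : (t.factorial : ℝ) ≠ 0 := by positivity
    have h2 : ((K + 1 + t + 1 + K + e).factorial : ℝ) ≠ 0 := by positivity
    have h3 : (e.factorial : ℝ) ≠ 0 := by positivity
    have h4 : (K.factorial : ℝ) ≠ 0 := by positivity
    have h5 : (t : ℝ) + 1 ≠ 0 := by positivity
    have h6 : (K : ℝ) + 1 ≠ 0 := by positivity
    have h7 : (K : ℝ) + 1 + t + 1 ≠ 0 := by positivity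
    have h8 : (K : ℝ) + 1 + t + 1 + K + e + 1 ≠ 0 := by positivity
    push_cast
    field_simp
    ring

lemma D_zero (e j : ℕ) : D e (j + 1) 0 = 0 := by
  unfold D
  simp only [pow_zero, mul_one]
  rw [sum_range_succ, partial_sum e j j le_rfl]
  unfold c
  rw [mu_succ, Nat.sub_self, Nat.sub_self, show j + 1 + (j + 1) + e = (j + 1 + j + e) + 1 by ring,
      show j + 1 + (j + 1) = (j + 1 + j) + 1 by ring]
  simp only [Nat.factorial_succ, pow_succ, Nat.factorial_zero]
  have h2 : ((j + 1 + j + e).factorial : ℝ) ≠ 0 := by positivity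
  have h3 : (e.factorial : ℝ) ≠ 0 := by positivity
  have h4 : (j.factorial : ℝ) ≠ 0 := by positivity
  have h6 : (j : ℝ) + 1 ≠ 0 := by positivity
  have h8 : (j : ℝ) + 1 + j + e + 1 ≠ 0 := by positivity
  push_cast
  field_simp
  ring

lemma D_lt (e : ℕ) : ∀ m j : ℕ, m < j → D e j m = 0 := by
  intro m
  induction m with
  | zero => intro j hj; obtain ⟨i, rfl⟩ := Nat.exists_eq_succ_of_ne_zero hj.ne'; exact D_zero e i
  | succ m ih =>
    intro j hj
    obtain ⟨i, rfl⟩ := Nat.exists_eq_succ_of_ne_zero (show j ≠ 0 by omega)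
    rw [Nat.succ_eq_add_one, D_rec, ih _ (by omega), ih _ (by omega)]; simp

lemma D_diag (e j : ℕ) : D e j j = D e 0 0 := by
  induction j with
  | zero => rfl
  | succ j ih => rw [D_rec, D_lt e j (j + 1) (by omega), ih]; simp

/-- Normalised divided difference. -/
noncomputable def g (e n j : ℕ) : ℝ := (j.factorial : ℝ) / (j + n).factorial * D e j (j + n)

lemma g_zero (e n : ℕ) : g e (n + 1) 0 = 0 := by
  simp [g, D]

lemma g_rec (e n j : ℕ) : ((j : ℝ) + 1 + (n + 1)) * g e (n + 1) (j + 1) - (j + 1) * g e (n + 1) j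
    = ((j : ℝ) + 1) * (j + 1 + e) * g e n (j + 1) := by
  unfold g
  rw [show j + 1 + (n + 1) = (j + n + 1) + 1 by ring, D_rec,
    show j + (n + 1) = j + n + 1 by ring, show j + 1 + n = j + n + 1 by ring]
  simp only [Nat.factorial_succ]
  have h2 : ((j + n).factorial : ℝ) ≠ 0 := by positivity
  have h6 : (j : ℝ) + n + 1 ≠ 0 := by positivity
  have h8 : (j : ℝ) + n + 1 + 1 ≠ 0 := by positivity
  push_cast
  field_simp
  ring

lemma g_mem (e n : ℕ) : g e n ∈ V (2 * n) := by
  induction n with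
  | zero =>
    have : g e 0 = D e 0 0 • (fun j : ℕ => (j.choose 0 : ℝ)) := by
      funext j
      have h2 : (j.factorial : ℝ) ≠ 0 := by positivity
      simp [g, D_diag e j, h2]
    rw [this]
    exact Submodule.smul_mem _ _ (choose_mem (by omega))
  | succ n ih =>
    obtain ⟨P, hP, h0, h1⟩ := solve (n + 1) (by omega) (lam_mul_mem e ih)
    have : g e (n + 1) = P := by
      funext j
      induction j with
      | zero =>
        rw [g_zero]
        simp at h0
        rcases h0 with h | h
        · exact absurd h (by positivity)
        · exact h.symm
      | succ j ihj =>
        have a := h1 j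
        have b := g_rec e n j
        rw [ihj] at b
        have h6 : (j : ℝ) + 1 + (n + 1) ≠ 0 := by positivity
        apply mul_left_cancel₀ h6
        push_cast at a
        linarith
    rw [this]
    exact hP

/-- Summand. -/
noncomputable def u (e n j : ℕ) : ℝ :=
  (-1) ^ j * g e n j / (j.factorial * (2 * j + (e + 1)))

lemma inner (e n j : ℕ) (hn : 1 ≤ n) :
    ∑ k ∈ Icc 1 j, (-1 : ℝ) ^ k * (Nat.choose (2 * j + (e + 1) - 1) (j - k)) * sphMu k (e + 1) *
        (sphLam k (e + 1) : ℝ) ^ (j + n) = (-1) ^ j * (2 * j + e).factorial * D e j (j + n) := by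
  unfold D
  rw [range_eq_Ico, sum_eq_sum_Ico_succ_bot (by omega), mul_add, mul_sum]
  have h0 : ((((0 : ℕ) : ℝ)) * (((0 : ℕ) : ℝ) + e)) ^ (j + n) = 0 := by
    simp; omega
  rw [h0, mul_zero, mul_zero, zero_add]
  refine sum_congr (by ext; simp <;> omega) fun k hk => ?_
  have hk' : k ≤ j := by simp at hk; omega
  obtain ⟨t, rfl⟩ := Nat.exists_eq_add_of_le hk'
  unfold c sphLam
  rw [show 2 * (k + t) + (e + 1) - 1 = t + (k + t + k + e) by omega,
    show k + t - k = t by omega, show 2 * (k + t) + e = t + (k + t + k + e) by omega,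
    show k + (e + 1) - 1 = k + e by omega, Nat.cast_add_choose]
  have h1 : (-1 : ℝ) ^ (k + t + k) = (-1) ^ (k + t) * (-1) ^ k := by rw [pow_add]
  have h2 : (-1 : ℝ) ^ (k + t) * (-1) ^ (k + t) = 1 := by rw [← mul_pow]; simp
  rw [h1]
  push_cast
  linear_combination (-((-1 : ℝ) ^ k * ((t + (k + t + k + e)).factorial /
    (t.factorial * (k + t + k + e).factorial)) * sphMu k (e + 1)
      * ((k : ℝ) * (k + e)) ^ (k + t + n))) * h2

lemma A_eq (e n ω : ℕ) (hn : 1 ≤ n) : A n (e + 1) ω =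
    2 * (-1 : ℝ) ^ n * Real.Gamma ((ω : ℝ) + (e + 1 : ℕ) / 2 + 1) *
      ∑ j ∈ range (ω + 1), u e n j / (ω - j).factorial := by
  unfold A
  obtain ⟨n, rfl⟩ := Nat.exists_eq_succ_of_ne_zero (show n ≠ 0 by omega)
  rw [range_eq_Ico, sum_eq_sum_Ico_succ_bot (by omega), mul_add, mul_sum]
  have h0 : u e n.succ 0 = 0 := by simp [u, g_zero]
  rw [h0, zero_div, mul_zero, zero_add]
  refine sum_congr (by ext; simp <;> omega) fun j hj => ?_
  rw [inner e _ j hn]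
  unfold u g
  rw [show 2 * j + (e + 1) = (2 * j + e) + 1 by ring, Nat.factorial_succ]
  have h1 : ((2 * j + e).factorial : ℝ) ≠ 0 := by positivity
  have h2 : ((j + n.succ).factorial : ℝ) ≠ 0 := by positivity
  have h3 : (j.factorial : ℝ) ≠ 0 := by positivity
  have h4 : ((ω - j).factorial : ℝ) ≠ 0 := by positivity
  have h5 : (2 * j + e + 1 : ℝ) ≠ 0 := by positivity
  have h6 : (2 * j + (e + 1) : ℝ) ≠ 0 := by positivity
  push_cast
  field_simp
  ring

lemma B_step (e n ω : ℕ) (hω : 2 * n ≤ ω) :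
    ((ω : ℝ) + (e + 1 : ℕ) / 2 + 1) * ∑ j ∈ range (ω + 1 + 1), u e n j / (ω + 1 - j).factorial
      = ∑ j ∈ range (ω + 1), u e n j / (ω - j).factorial := by
  have hv := vanish (show 2 * n < ω + 1 by omega) (g_mem e n)
  have h1 : ∑ j ∈ range (ω + 1), u e n j / (ω - j).factorial
      = ∑ j ∈ range (ω + 1 + 1), ((ω : ℝ) + 1 - j) * (u e n j / (ω + 1 - j).factorial) := by
    rw [sum_range_succ _ (ω + 1)]
    simp only [Nat.cast_add, Nat.cast_one, sub_self, zero_mul, add_zero]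
    refine sum_congr rfl fun j hj => ?_
    have hj' : j ≤ ω := by simpa [Nat.lt_succ_iff] using hj
    obtain ⟨t, rfl⟩ := Nat.exists_eq_add_of_le hj'
    rw [show j + t - j = t by omega, show j + t + 1 - j = t + 1 by omega, Nat.factorial_succ]
    have h1 : (t.factorial : ℝ) ≠ 0 := by positivity
    have h5 : (t : ℝ) + 1 ≠ 0 := by positivity
    push_cast
    field_simp
    ring
  rw [h1, mul_sum, ← sub_eq_zero, ← sum_sub_distrib]
  have h2 : ∀ j ∈ range (ω + 1 + 1),
      ((ω : ℝ) + (e + 1 : ℕ) / 2 + 1) * (u e n j / (ω + 1 - j).factorial)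
        - ((ω : ℝ) + 1 - j) * (u e n j / (ω + 1 - j).factorial)
      = (2 * (ω + 1).factorial : ℝ)⁻¹ * ((-1 : ℝ) ^ j * ((ω + 1).choose j : ℝ) * g e n j) := by
    intro j hj
    have hj' : j ≤ ω + 1 := by simpa [Nat.lt_succ_iff] using hj
    rw [Nat.cast_choose ℝ hj']
    unfold u
    have h1 : ((ω + 1).factorial : ℝ) ≠ 0 := by positivity
    have h3 : (j.factorial : ℝ) ≠ 0 := by positivity
    have h4 : ((ω + 1 - j).factorial : ℝ) ≠ 0 := by positivity
    have h6 : (2 * j + (e + 1) : ℝ) ≠ 0 := by positivity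
    push_cast
    field_simp
    ring
  rw [sum_congr rfl h2, ← mul_sum, hv, mul_zero]

lemma A_step (e n ω : ℕ) (hn : 1 ≤ n) (hω : 2 * n ≤ ω) :
    A n (e + 1) (ω + 1) = A n (e + 1) ω := by
  rw [A_eq _ _ _ hn, A_eq _ _ _ hn, ← B_step e n ω hω,
    show (((ω + 1 : ℕ) : ℝ) + (e + 1 : ℕ) / 2 + 1) = ((ω : ℝ) + (e + 1 : ℕ) / 2 + 1) + 1 by
      push_cast; ring,
    Real.Gamma_add_one (by positivity)]
  ring

lemma A_const (e n ω : ℕ) (hn : 1 ≤ n) (hω : 2 * n ≤ ω) :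
    A n (e + 1) ω = A n (e + 1) (2 * n) := by
  induction ω, hω using Nat.le_induction with
  | base => rfl
  | succ ω h ih => rw [A_step e n ω hn h, ih]

end AIndep

/-- for `d ≥ 1`, `n ≥ 1`, the expression `A_{n,d}(ω)` does not
depend on the choice of `ω ≥ 2n`. -/
theorem A_independent_of_omega (d n ω ω' : ℕ) (hd : 1 ≤ d) (hn : 1 ≤ n)
    (hω : 2 * n ≤ ω) (hω' : 2 * n ≤ ω') :
    A n d ω = A n d ω' := by
  obtain ⟨e, rfl⟩ := Nat.exists_eq_succ_of_ne_zero (show d ≠ 0 by omega)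
  exact (AIndep.A_const e n ω hn hω).trans (AIndep.A_const e n ω' hn hω').symm
end

section
/- (S¹-identity) For all integers n ≥ 1 and ω ≥ 2n: Σ_{j=0}^{ω} [1/((ω-j)! (j+n)! (2j+1))] · Σ_{k=0}^{j} (-1)^k k^{2j+2n} / ((j-k)!(j+k)!) = 0. -/
open Finset

lemma S1_alt_sum (P : Polynomial ℚ) (w : ℕ) (h : P.natDegree < w) :
    ∑ j ∈ range (w + 1), (-1 : ℚ) ^ j * P.eval (j : ℚ) /
      ((Nat.factorial (w - j) : ℚ) * Nat.factorial j) = 0 := by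
  have h1 := congrFun (Polynomial.fwdDiff_iter_eq_zero_of_degree_lt h) 0
  rw [fwdDiff_iter_eq_sum_shift] at h1
  have h2 : ∑ j ∈ range (w + 1), (-1 : ℚ) ^ j * P.eval (j : ℚ) /
      ((Nat.factorial (w - j) : ℚ) * Nat.factorial j) = (-1) ^ w / (Nat.factorial w : ℚ) *
      ∑ k ∈ range (w + 1), ((-1 : ℤ) ^ (w - k) * w.choose k) • P.eval ((0 : ℚ) + k • 1) := by
    rw [mul_sum]
    refine sum_congr rfl fun j hj => ?_
    have hj' : j ≤ w := by simpa [Nat.lt_succ_iff] using hj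
    obtain ⟨d, rfl⟩ := Nat.exists_eq_add_of_le hj'
    have e : (-1 : ℚ) ^ (j + d) * (-1) ^ d = (-1) ^ j := by
      rw [pow_add, mul_assoc, ← mul_pow]; norm_num
    have hc : ((j + d).choose j : ℚ) = (Nat.factorial (j + d) : ℚ) /
        ((Nat.factorial j : ℚ) * Nat.factorial d) := Nat.cast_add_choose ℚ
    have f0 : (Nat.factorial (j + d) : ℚ) ≠ 0 := by positivity
    simp only [Nat.add_sub_cancel_left, zsmul_eq_mul, Int.cast_mul, Int.cast_pow, Int.cast_neg,
      Int.cast_one, Int.cast_natCast, nsmul_eq_mul, mul_one, zero_add, hc]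
    rw [← e]
    field_simp
  rw [h2, h1]
  simp

lemma S1_fact (j m : ℕ) : (Nat.factorial (2 * j + 2 * (m + 1)) : ℚ) * Nat.factorial j =
    Nat.factorial (2 * j) * Nat.factorial (j + (m + 1)) * (2 * j + 1) * 2 ^ (m + 1) *
      ∏ l ∈ range m, (2 * (j : ℚ) + 2 * l + 3) := by
  induction m with
  | zero =>
    have : 2 * j + 2 * (0 + 1) = (2 * j + 1) + 1 := by ring
    rw [this, Nat.factorial_succ, Nat.factorial_succ, zero_add, Nat.factorial_succ]
    push_cast; simp; ring
  | succ m ih =>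
    have : 2 * j + 2 * (m + 1 + 1) = (2 * j + 2 * (m + 1)) + 1 + 1 := by ring
    have e2 : j + (m + 1 + 1) = (j + (m + 1)) + 1 := by ring
    rw [this, e2, Nat.factorial_succ, Nat.factorial_succ, Nat.factorial_succ (j + (m + 1)),
      prod_range_succ]
    push_cast
    linear_combination (2 * (j : ℚ) + 2 * (m + 1) + 1 + 1) * (2 * (j : ℚ) + 2 * (m + 1) + 1) * ih

open PowerSeries in
lemma S1_exp_exists : ∃ K : PowerSeries ℚ,
    rescale (1 : ℚ) (exp ℚ) + rescale (-1 : ℚ) (exp ℚ) - 2 = X ^ 2 * (1 + X ^ 2 * K) := by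
  have : (X : PowerSeries ℚ) ^ 4 ∣
      rescale (1 : ℚ) (exp ℚ) + rescale (-1 : ℚ) (exp ℚ) - 2 - X ^ 2 := by
    rw [X_pow_dvd_iff]
    intro m hm
    have h2 : (2 : PowerSeries ℚ) = C (2 : ℚ) := (map_ofNat (C (R := ℚ)) 2).symm
    rw [h2]
    rw [map_sub, map_sub, map_add, coeff_rescale, coeff_rescale, coeff_exp, coeff_C, coeff_X_pow]
    interval_cases m <;> norm_num [Nat.factorial]
  obtain ⟨K, hK⟩ := this
  exact ⟨K, by linear_combination hK⟩

open PowerSeries in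
lemma S1_exp_pow (j : ℕ) :
    (rescale (1 : ℚ) (exp ℚ) + rescale (-1 : ℚ) (exp ℚ) - 2) ^ j =
    ∑ i ∈ range (2 * j + 1), C ((-1 : ℚ) ^ i * ((2 * j).choose i : ℚ)) *
      rescale ((i : ℚ) - j) (exp ℚ) := by
  have hz : rescale (0 : ℚ) (exp ℚ) = 1 := by simp [rescale_zero]
  have h1 : rescale (1 : ℚ) (exp ℚ) * rescale (-1 : ℚ) (exp ℚ) = 1 := by
    rw [exp_mul_exp_eq_exp_add]; simpa using hz
  have hpow (a : ℚ) (k : ℕ) : rescale a (exp ℚ) ^ k = rescale (k * a) (exp ℚ) := by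
    induction k with
    | zero => simpa using hz.symm
    | succ k ih =>
      rw [pow_succ, ih, exp_mul_exp_eq_exp_add]; congr 2; push_cast; ring
  have h2 : rescale (1 : ℚ) (exp ℚ) + rescale (-1 : ℚ) (exp ℚ) - 2 =
      rescale (-1 : ℚ) (exp ℚ) * (-rescale (1 : ℚ) (exp ℚ) + 1) ^ 2 := by
    linear_combination (2 - rescale (1 : ℚ) (exp ℚ)) * h1
  rw [h2, mul_pow, ← pow_mul, add_pow, mul_sum]
  refine sum_congr rfl fun i _ => ?_
  rw [neg_pow, hpow, hpow]
  have h3 := exp_mul_exp_eq_exp_add (A := ℚ) (j * (-1)) (i * 1)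
  have h4 : (j : ℚ) * (-1) + i * 1 = i - j := by ring
  rw [h4] at h3
  rw [← h3]
  simp only [map_mul, map_pow, map_neg, map_one, map_natCast, one_pow]
  ring

lemma S1_sym (j M : ℕ) (hM : 1 ≤ M) :
    ∑ i ∈ range (2 * j + 1), ((-1 : ℚ) ^ i * ((2 * j).choose i : ℚ)) * ((i : ℚ) - j) ^ (2 * M) =
    2 * (-1) ^ j * Nat.factorial (2 * j) * ∑ k ∈ range (j + 1),
      ((-1 : ℚ) ^ k * (k : ℚ) ^ (2 * M)) / (Nat.factorial (j - k) * Nat.factorial (j + k)) := by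
  have e : 2 * j + 1 = j + (j + 1) := by ring
  have h0 : 2 * M ≠ 0 := by omega
  rw [e, sum_range_add, ← sum_range_reflect, sum_range_succ', sum_range_succ' _ j]
  simp only [add_zero, sub_self, Nat.cast_zero, zero_pow h0, mul_zero, zero_div]
  rw [← sum_add_distrib, mul_sum]
  refine sum_congr rfl fun i hi => ?_
  obtain ⟨d, rfl⟩ := Nat.exists_eq_add_of_lt (mem_range.1 hi)
  have e1 : i + d + 1 - 1 - i = d := by omega
  have e2 : i + d + 1 - (i + 1) = d := by omega
  rw [e1, e2]
  have c1 : ((2 * (i + d + 1)).choose d : ℚ) = (Nat.factorial (2 * (i + d + 1)) : ℚ) /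
        ((Nat.factorial d : ℚ) * Nat.factorial (i + d + 1 + (i + 1))) := by
    have := Nat.cast_add_choose ℚ (a := d) (b := i + d + 1 + (i + 1))
    rwa [show d + (i + d + 1 + (i + 1)) = 2 * (i + d + 1) by ring] at this
  have c2 : ((2 * (i + d + 1)).choose (i + d + 1 + (i + 1)) : ℚ) =
      ((2 * (i + d + 1)).choose d : ℚ) := by
    rw [Nat.choose_symm_of_eq_add]; ring
  have p1 : ((d : ℚ) - ((i + d + 1 : ℕ) : ℚ)) ^ (2 * M) = ((i + 1 : ℕ) : ℚ) ^ (2 * M) := by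
    rw [pow_mul, pow_mul]; congr 1; push_cast; ring
  have p2 : (((i + d + 1 + (i + 1) : ℕ) : ℚ) - ((i + d + 1 : ℕ) : ℚ)) ^ (2 * M)
      = ((i + 1 : ℕ) : ℚ) ^ (2 * M) := by
    congr 1; push_cast; ring
  have s1 : (-1 : ℚ) ^ d = (-1) ^ (i + d + 1) * (-1) ^ (i + 1) := by
    rw [← pow_add, show i + d + 1 + (i + 1) = d + 2 * (i + 1) by ring, pow_add, pow_mul]
    norm_num
  rw [c2, c1, p1, p2, s1, pow_add (-1 : ℚ) (i + d + 1) (i + 1)]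
  ring

open PowerSeries in
lemma S1_poly (n : ℕ) (hn : 1 ≤ n) : ∃ p : Polynomial ℚ, p.natDegree ≤ n ∧ ∀ j : ℕ,
    2 * (-1) ^ j * (Nat.factorial (2 * j) : ℚ) * ∑ k ∈ range (j + 1),
      ((-1 : ℚ) ^ k * (k : ℚ) ^ (2 * j + 2 * n)) / (Nat.factorial (j - k) * Nat.factorial (j + k))
    = Nat.factorial (2 * j + 2 * n) * p.eval (j : ℚ) := by
  obtain ⟨K, hK⟩ := S1_exp_exists
  refine ⟨∑ i ∈ range (n + 1), Polynomial.C (coeff (2 * n - 2 * i) (K ^ i) / Nat.factorial i) *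
    descPochhammer ℚ i, ?_, ?_⟩
  · refine Polynomial.natDegree_sum_le_of_forall_le _ _ fun i hi => ?_
    refine (Polynomial.natDegree_C_mul_le _ _).trans ?_
    rw [descPochhammer_natDegree]
    simpa [Nat.lt_succ_iff] using hi
  · intro j
    have hs := S1_sym j (j + n) (by omega)
    rw [mul_add] at hs
    rw [← hs]
    have h1 := congrArg (coeff (2 * j + 2 * n)) (S1_exp_pow j)
    have h2 : coeff (2 * j + 2 * n)
        ((rescale (1 : ℚ) (exp ℚ) + rescale (-1 : ℚ) (exp ℚ) - 2) ^ j) =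
        ∑ i ∈ range (n + 1), coeff (2 * n - 2 * i) (K ^ i) * (j.choose i : ℚ) := by
      rw [hK, mul_pow, ← pow_mul, add_comm (2 * j), coeff_X_pow_mul, add_comm 1, add_pow, map_sum]
      have t (i : ℕ) : coeff (2 * n) ((X ^ 2 * K) ^ i * 1 ^ (j - i) * (j.choose i : PowerSeries ℚ))
          = if i ≤ n then coeff (2 * n - 2 * i) (K ^ i) * (j.choose i : ℚ) else 0 := by
        rw [one_pow, mul_one, ← map_natCast (C (R := ℚ)), coeff_mul_C, mul_pow, ← pow_mul,
          coeff_X_pow_mul']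
        simp
      simp only [t]
      have u1 : ∑ i ∈ range (j + 1),
          (if i ≤ n then coeff (2 * n - 2 * i) (K ^ i) * (j.choose i : ℚ) else 0) =
          ∑ i ∈ range (j + n + 1),
          (if i ≤ n then coeff (2 * n - 2 * i) (K ^ i) * (j.choose i : ℚ) else 0) := by
        refine sum_subset (range_mono (by omega)) fun i _ hi => ?_
        rw [mem_range, not_lt] at hi
        rw [Nat.choose_eq_zero_of_lt (by omega)]
        simp
      have u2 : ∑ i ∈ range (n + 1),
          (if i ≤ n then coeff (2 * n - 2 * i) (K ^ i) * (j.choose i : ℚ) else 0) =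
          ∑ i ∈ range (j + n + 1),
          (if i ≤ n then coeff (2 * n - 2 * i) (K ^ i) * (j.choose i : ℚ) else 0) := by
        refine sum_subset (range_mono (by omega)) fun i _ hi => ?_
        rw [mem_range, not_lt] at hi
        rw [if_neg (by omega)]
      rw [u1, ← u2]
      refine sum_congr rfl fun i hi => ?_
      rw [mem_range] at hi
      rw [if_pos (by omega)]
    rw [h2, map_sum] at h1
    simp only [coeff_C_mul, coeff_rescale, coeff_exp] at h1
    rw [Polynomial.eval_finsetSum]
    simp only [Polynomial.eval_mul, Polynomial.eval_C, descPochhammer_eval_eq_descFactorial,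
      Nat.descFactorial_eq_factorial_mul_choose, Nat.cast_mul]
    have h3 : ∑ i ∈ range (n + 1), coeff (2 * n - 2 * i) (K ^ i) / (Nat.factorial i : ℚ) *
        ((Nat.factorial i : ℚ) * (j.choose i : ℚ)) =
        ∑ i ∈ range (n + 1), coeff (2 * n - 2 * i) (K ^ i) * (j.choose i : ℚ) := by
      refine sum_congr rfl fun i _ => ?_
      field_simp
    rw [h3, h1, mul_sum]
    refine sum_congr rfl fun i _ => ?_
    simp
    field_simp

/-- the `S¹`-identity: for all integers `n ≥ 1` and `ω ≥ 2n`,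
`Σ_{j=0}^{ω} [1/((ω-j)!(j+n)!(2j+1))] Σ_{k=0}^{j} (-1)^k k^{2j+2n}/((j-k)!(j+k)!) = 0`. -/
theorem S1_identity (n ω : ℕ) (hn : 1 ≤ n) (hω : 2 * n ≤ ω) :
    ∑ j ∈ range (ω + 1),
      (1 / ((Nat.factorial (ω - j) : ℚ) * Nat.factorial (j + n) * (2 * j + 1))) *
        ∑ k ∈ range (j + 1),
          ((-1 : ℚ) ^ k * (k : ℚ) ^ (2 * j + 2 * n)) /
            (Nat.factorial (j - k) * Nat.factorial (j + k)) = 0 := by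
  obtain ⟨p, hp, hS⟩ := S1_poly n hn
  obtain ⟨m, rfl⟩ := Nat.exists_eq_add_of_le' hn
  let q : Polynomial ℚ := ∏ l ∈ range m,
    (Polynomial.C 2 * Polynomial.X + Polynomial.C (2 * (l : ℚ) + 3))
  have hq : q.natDegree ≤ m := by
    refine (Polynomial.natDegree_prod_le _ _).trans ?_
    refine (sum_le_card_nsmul _ _ 1 fun l _ => Polynomial.natDegree_linear_le).trans ?_
    simp
  have hqe (j : ℕ) : q.eval (j : ℚ) = ∏ l ∈ range m, (2 * (j : ℚ) + 2 * l + 3) := by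
    simp only [q, Polynomial.eval_prod]
    refine prod_congr rfl fun l _ => ?_
    simp; ring
  have hd : (p * q).natDegree < ω := by
    have := Polynomial.natDegree_mul_le (p := p) (q := q)
    omega
  have key := S1_alt_sum (p * q) ω hd
  have : ∀ j ∈ range (ω + 1), (1 / ((Nat.factorial (ω - j) : ℚ) * Nat.factorial (j + (m + 1)) *
      (2 * j + 1))) * ∑ k ∈ range (j + 1),
          ((-1 : ℚ) ^ k * (k : ℚ) ^ (2 * j + 2 * (m + 1))) /
            (Nat.factorial (j - k) * Nat.factorial (j + k)) =
      2 ^ m * ((-1 : ℚ) ^ j * (p * q).eval (j : ℚ) /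
      ((Nat.factorial (ω - j) : ℚ) * Nat.factorial j)) := by
    intro j _
    have a1 := hS j
    have a2 := S1_fact j m
    rw [← hqe] at a2
    generalize (∑ k ∈ range (j + 1),
          ((-1 : ℚ) ^ k * (k : ℚ) ^ (2 * j + 2 * (m + 1))) /
            (Nat.factorial (j - k) * Nat.factorial (j + k))) = S at a1 ⊢
    have hsq : (-1 : ℚ) ^ j * (-1) ^ j = 1 := by rw [← mul_pow]; norm_num
    rw [Polynomial.eval_mul]
    have f1 : (Nat.factorial (2 * j) : ℚ) ≠ 0 := by positivity
    have f3 : (2 * (j : ℚ) + 1) ≠ 0 := by positivity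
    field_simp
    apply mul_left_cancel₀ f1
    generalize (-1 : ℚ) ^ j = s at *
    rw [pow_succ] at a2
    linear_combination (s * Nat.factorial j / 2) * a1 + (s * p.eval (j : ℚ) / 2) * a2
      - (Nat.factorial j * Nat.factorial (2 * j) * S) * hsq
  rw [sum_congr rfl this, ← mul_sum, key, mul_zero]
end

section
/- (Generalized S¹-identity) For every real number x and all integers n ≥ 1 and ω ≥ 2n: Σ_{j=0}^{ω} [1/((ω-j)! (j+n)! (2j+1))] · Σ_{k=-j}^{j} (-1)^k (x+k)^{2j+2n} / ((j-k)!(j+k)!) = 0. -/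
open Finset

/-- Second central difference operator. -/
noncomputable def cdiff : (ℝ → ℝ) →ₗ[ℝ] (ℝ → ℝ) where
  toFun f := fun x => f (x + 1) - 2 * f x + f (x - 1)
  map_add' f g := by funext x; simp only [Pi.add_apply]; ring
  map_smul' c f := by funext x; simp only [Pi.smul_apply, smul_eq_mul, RingHom.id_apply]; ring

theorem cdiff_apply (f : ℝ → ℝ) (x : ℝ) : cdiff f x = f (x + 1) - 2 * f x + f (x - 1) := rfl

/-- Normalized even monomial. -/
noncomputable def emon (q : ℕ) : ℝ → ℝ := fun x => x ^ (2 * q) / (Nat.factorial (2 * q) : ℝ)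

theorem cdiff_pow_eq (j : ℕ) (f : ℝ → ℝ) (x : ℝ) :
    (cdiff ^ j) f x = (fwdDiff (1 : ℝ))^[2 * j] f (x - j) := by
  induction j generalizing x with
  | zero => simp
  | succ j ih =>
    rw [pow_succ', Module.End.mul_apply, cdiff_apply, ih, ih, ih,
      show 2 * (j + 1) = 2 * j + 1 + 1 by ring, Function.iterate_succ_apply',
      Function.iterate_succ_apply']
    simp only [fwdDiff]
    push_cast
    rw [show x - (j + 1 : ℝ) + 1 + 1 = x + 1 - j by ring,
      show x - (j + 1 : ℝ) + 1 = x - j by ring, show x - (j + 1 : ℝ) = x - 1 - j by ring]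
    ring

theorem sum_even_aux (q : ℕ) (g : ℕ → ℝ) :
    ∑ m ∈ range (2 * q + 1), (g m + (-1) ^ m * g m) = ∑ i ∈ range (q + 1), 2 * g (2 * i) := by
  induction q with
  | zero => simp; ring
  | succ q ih =>
    rw [show 2 * (q + 1) + 1 = 2 * q + 1 + 1 + 1 by ring, sum_range_succ, sum_range_succ, ih,
      sum_range_succ _ (q + 1)]
    have h1 : ((-1 : ℝ)) ^ (2 * q + 1) = -1 := by rw [pow_succ, pow_mul]; simp
    have h2 : ((-1 : ℝ)) ^ (2 * q + 1 + 1) = 1 := by rw [pow_succ, h1]; simp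
    rw [h1, h2, show 2 * (q + 1) = 2 * q + 1 + 1 by ring]
    ring

theorem cdiff_emon (q : ℕ) :
    cdiff (emon q) = ∑ i ∈ range q, (2 / (Nat.factorial (2 * (q - i)) : ℝ)) • emon i := by
  funext x
  have key : (x + 1) ^ (2 * q) + (x - 1) ^ (2 * q)
      = ∑ i ∈ range (q + 1), 2 * (x ^ (2 * i) * ((2 * q).choose (2 * i) : ℝ)) := by
    rw [← sum_even_aux q (fun m => x ^ m * ((2 * q).choose m : ℝ)), sub_eq_add_neg, add_pow,
      add_pow, ← sum_add_distrib]
    refine sum_congr rfl fun m hm => ?_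
    have hm' : m ≤ 2 * q := by have := mem_range.1 hm; omega
    have : (-1 : ℝ) ^ (2 * q - m) = (-1) ^ m := by
      have e : (-1 : ℝ) ^ (2 * q - m) * (-1) ^ m = 1 := by
        rw [← pow_add, Nat.sub_add_cancel hm', pow_mul]; simp
      have e2 : (-1 : ℝ) ^ m * (-1) ^ m = 1 := by rw [← mul_pow]; simp
      exact mul_right_cancel₀ (pow_ne_zero m (by norm_num)) (e.trans e2.symm)
    rw [this]; simp; ring
  rw [sum_range_succ] at key
  have h0 : (Nat.factorial (2 * q) : ℝ) ≠ 0 := by positivity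
  rw [cdiff_apply]
  simp only [emon, Finset.sum_apply, Pi.smul_apply, smul_eq_mul]
  have : (x + 1) ^ (2 * q) / (Nat.factorial (2 * q) : ℝ) - 2 * (x ^ (2 * q) / (Nat.factorial (2 * q) : ℝ))
      + (x - 1) ^ (2 * q) / (Nat.factorial (2 * q) : ℝ)
      = (∑ i ∈ range q, 2 * (x ^ (2 * i) * ((2 * q).choose (2 * i) : ℝ)))
        / (Nat.factorial (2 * q) : ℝ) := by
    rw [Nat.choose_self] at key
    push_cast at key
    rw [← sub_eq_iff_eq_add.2 key]
    ring
  rw [this, sum_div]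
  refine sum_congr rfl fun i hi => ?_
  have hi' : i < q := mem_range.1 hi
  rw [Nat.cast_choose ℝ (show 2 * i ≤ 2 * q by omega), show 2 * q - 2 * i = 2 * (q - i) by omega]
  field_simp

theorem cdiff_pow_zero (j : ℕ) : ∀ i < j, (cdiff ^ j) (emon i) = 0 := by
  induction j with
  | zero => intro i hi; omega
  | succ j ih =>
    intro i hi
    rw [pow_succ, Module.End.mul_apply, cdiff_emon, map_sum]
    refine sum_eq_zero fun m hm => ?_
    have := mem_range.1 hm
    rw [map_smul, ih m (by omega), smul_zero]

theorem cdiff_rec (j n : ℕ) (x : ℝ) : (cdiff ^ (j + 1)) (emon (j + 1 + n)) x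
    = ∑ m ∈ range (n + 1), (2 / (Nat.factorial (2 * (n + 1 - m)) : ℝ)) *
      (cdiff ^ j) (emon (j + m)) x := by
  rw [pow_succ, Module.End.mul_apply, cdiff_emon, map_sum,
    show j + 1 + n = j + (n + 1) by ring, sum_range_add, sum_eq_zero, zero_add]
  · simp only [Finset.sum_apply, map_smul, Pi.smul_apply, smul_eq_mul]
    refine sum_congr rfl fun m hm => ?_
    rw [show j + (n + 1) - (j + m) = n + 1 - m by omega]
  · intro i hi
    rw [map_smul, cdiff_pow_zero j i (mem_range.1 hi), smul_zero]

/-- Sequences killed by `d` forward differences. -/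
def Kil (d : ℕ) (f : ℕ → ℝ) : Prop := (fwdDiff (1 : ℕ))^[d] f = 0

theorem iter_zero_fun (d : ℕ) : (fwdDiff (1 : ℕ))^[d] (0 : ℕ → ℝ) = 0 := by
  induction d with
  | zero => rfl
  | succ d ih =>
    rw [Function.iterate_succ_apply]
    have : fwdDiff (1 : ℕ) (0 : ℕ → ℝ) = 0 := by funext j; simp [fwdDiff]
    rw [this, ih]

theorem Kil.mono {d e : ℕ} {f : ℕ → ℝ} (h : Kil d f) (hde : d ≤ e) : Kil e f := by
  obtain ⟨k, rfl⟩ := Nat.exists_eq_add_of_le hde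
  unfold Kil at *
  rw [add_comm, Function.iterate_add_apply, h, iter_zero_fun]

theorem Kil.add {d : ℕ} {f g : ℕ → ℝ} (hf : Kil d f) (hg : Kil d g) : Kil d (f + g) := by
  unfold Kil at *
  rw [fwdDiff_iter_add, hf, hg, add_zero]

theorem Kil.smul {d : ℕ} {f : ℕ → ℝ} (c : ℝ) (hf : Kil d f) : Kil d (c • f) := by
  unfold Kil at *
  rw [fwdDiff_iter_const_smul, hf, smul_zero]

theorem Kil.sum {d : ℕ} (s : Finset ℕ) (f : ℕ → ℕ → ℝ) (h : ∀ i ∈ s, Kil d (f i)) :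
    Kil d (∑ i ∈ s, f i) := by
  induction s using Finset.induction_on with
  | empty => rw [sum_empty]; exact iter_zero_fun d
  | insert a s ha ih =>
    rw [sum_insert ha]
    exact (h a (mem_insert_self a s)).add (ih fun i hi => h i (mem_insert_of_mem hi))

theorem Kil.affine {d : ℕ} (a : ℝ) : ∀ (b : ℝ) {f : ℕ → ℝ}, Kil d f →
    Kil (d + 1) (fun j : ℕ => (a * j + b) * f j) := by
  induction d with
  | zero =>
    intro b f hf
    have hf' : f = 0 := hf
    subst hf'
    have : (fun j : ℕ => (a * j + b) * (0 : ℕ → ℝ) j) = 0 := by funext j; simp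
    rw [this]; exact iter_zero_fun _
  | succ d ih =>
    intro b f hf
    have hd : Kil d (fwdDiff 1 f) := hf
    have h1 := (ih (a + b) hd).add (hf.smul a)
    have e : fwdDiff 1 (fun j : ℕ => (a * j + b) * f j)
        = (fun j : ℕ => (a * j + (a + b)) * fwdDiff 1 f j) + a • f := by
      funext j
      simp only [fwdDiff, Pi.add_apply, Pi.smul_apply, smul_eq_mul]
      push_cast
      ring
    rw [← e] at h1
    exact h1

theorem kil_H (x : ℝ) (n : ℕ) : Kil (n + 1) (fun j => (cdiff ^ j) (emon (j + n)) x) := by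
  induction n using Nat.strong_induction_on with
  | _ n ih =>
    have e : fwdDiff 1 (fun j => (cdiff ^ j) (emon (j + n)) x)
        = ∑ m ∈ range n, (2 / (Nat.factorial (2 * (n + 1 - m)) : ℝ)) •
          (fun j => (cdiff ^ j) (emon (j + m)) x) := by
      funext j
      simp only [fwdDiff, Finset.sum_apply, Pi.smul_apply, smul_eq_mul]
      rw [cdiff_rec, sum_range_succ]
      simp
    have h : Kil n (fwdDiff 1 (fun j => (cdiff ^ j) (emon (j + n)) x)) := by
      rw [e]
      refine Kil.sum _ _ fun m hm => Kil.smul _ ((ih m (mem_range.1 hm)).mono ?_)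
      exact mem_range.1 hm
    exact h

/-- The factorial ratio. -/
noncomputable def Rat' (n j : ℕ) : ℝ :=
  (Nat.factorial j * Nat.factorial (2 * j + 2 * n) : ℝ) /
    (Nat.factorial (j + n) * Nat.factorial (2 * j + 1))

theorem kil_R {d : ℕ} {f : ℕ → ℝ} (hf : Kil d f) (n : ℕ) :
    Kil (d + n) (fun j => Rat' (n + 1) j * f j) := by
  induction n with
  | zero =>
    have : (fun j => Rat' (0 + 1) j * f j) = (2 : ℝ) • f := by
      funext j
      simp only [Rat', Pi.smul_apply, smul_eq_mul]
      rw [show 2 * j + 2 * (0 + 1) = (2 * j + 1) + 1 by ring, Nat.factorial_succ (2 * j + 1),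
        show j + (0 + 1) = j + 1 by ring, Nat.factorial_succ j]
      push_cast
      field_simp
      ring
    rw [this]; exact hf.smul 2
  | succ n ih =>
    have : (fun j => Rat' (n + 1 + 1) j * f j)
        = fun j : ℕ => ((4 : ℝ) * j + (4 * n + 6)) * (Rat' (n + 1) j * f j) := by
      funext j
      simp only [Rat']
      rw [show 2 * j + 2 * (n + 1 + 1) = (2 * j + 2 * (n + 1)) + 1 + 1 by ring,
        Nat.factorial_succ (2 * j + 2 * (n + 1) + 1), Nat.factorial_succ (2 * j + 2 * (n + 1)),
        show j + (n + 1 + 1) = j + (n + 1) + 1 by ring, Nat.factorial_succ (j + (n + 1))]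
      push_cast
      field_simp
      ring
    rw [this]
    exact Kil.affine 4 _ ih

theorem inner_eq (x : ℝ) (n j : ℕ) :
    ∑ k ∈ Finset.Icc (-(j : ℤ)) (j : ℤ),
          ((-1 : ℝ) ^ k * (x + (k : ℝ)) ^ (2 * j + 2 * n)) /
            (Nat.factorial ((j : ℤ) - k).toNat * Nat.factorial ((j : ℤ) + k).toNat)
      = (-1) ^ j * (Nat.factorial (2 * j + 2 * n) / Nat.factorial (2 * j) : ℝ) *
        (cdiff ^ j) (emon (j + n)) x := by
  rw [cdiff_pow_eq, fwdDiff_iter_eq_sum_shift, mul_sum]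
  refine sum_nbij' (fun k => (k + j).toNat) (fun i => (i : ℤ) - j) ?_ ?_ ?_ ?_ ?_
  · intro k hk; simp only [mem_Icc, mem_range] at *; omega
  · intro k hk; simp only [mem_Icc, mem_range] at *; omega
  · intro k hk; simp only [mem_Icc] at *; omega
  · intro k hk; simp only [mem_range] at *; omega
  · intro k hk
    simp only [mem_Icc] at hk
    obtain ⟨i, hi⟩ : ∃ i : ℕ, k = (i : ℤ) - j := ⟨(k + j).toNat, by omega⟩
    subst hi
    have hi2 : i ≤ 2 * j := by omega
    rw [show ((i : ℤ) - j + j).toNat = i by omega, show ((j : ℤ) - (i - j)).toNat = 2 * j - i by omega,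
      show ((j : ℤ) + (i - j)).toNat = i by omega]
    have s1 : (-1 : ℝ) ^ ((i : ℤ) - j) = (-1) ^ j * (-1) ^ (2 * j - i) := by
      rw [← pow_add, ← zpow_natCast]
      have : ((j + (2 * j - i) : ℕ) : ℤ) = ((i : ℤ) - j) + 2 * (2 * j - i) := by omega
      rw [this, zpow_add₀ (by norm_num), zpow_mul]
      simp
    rw [s1]
    simp only [emon, zsmul_eq_mul, nsmul_eq_mul, mul_one]
    push_cast
    rw [Nat.cast_choose ℝ hi2, show 2 * (j + n) = 2 * j + 2 * n by ring,
      show x - (j : ℝ) + i = x + (i - j) by ring]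
    field_simp

/-- generalized `S¹`-identity: for every real `x` and all integers
`n ≥ 1`, `ω ≥ 2n`,
`Σ_{j=0}^{ω} [1/((ω-j)!(j+n)!(2j+1))] Σ_{k=-j}^{j} (-1)^k (x+k)^{2j+2n}/((j-k)!(j+k)!) = 0`. -/
theorem S1_identity_generalized (x : ℝ) (n ω : ℕ) (hn : 1 ≤ n) (hω : 2 * n ≤ ω) :
    ∑ j ∈ range (ω + 1),
      (1 / ((Nat.factorial (ω - j) : ℝ) * Nat.factorial (j + n) * (2 * j + 1))) *
        ∑ k ∈ Finset.Icc (-(j : ℤ)) (j : ℤ),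
          ((-1 : ℝ) ^ k * (x + (k : ℝ)) ^ (2 * j + 2 * n)) /
            (Nat.factorial ((j : ℤ) - k).toNat * Nat.factorial ((j : ℤ) + k).toNat) = 0 := by
  obtain ⟨n, rfl⟩ := Nat.exists_eq_add_of_le' hn
  have h := (kil_R (kil_H x (n + 1)) n).mono (show n + 1 + 1 + n ≤ ω by omega)
  have h0 := congrFun h 0
  rw [fwdDiff_iter_eq_sum_shift] at h0
  have h1 : ((-1 : ℝ) ^ ω / Nat.factorial ω) * 0 = 0 := mul_zero _
  rw [← h1]
  change _ = _ * (0 : ℕ → ℝ) 0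
  rw [← h0, mul_sum]
  refine sum_congr rfl fun j hj => ?_
  have hj' : j ≤ ω := by have := mem_range.1 hj; omega
  rw [inner_eq]
  have s1 : (-1 : ℝ) ^ j = (-1) ^ ω * (-1) ^ (ω - j) := by
    obtain ⟨k, rfl⟩ := Nat.exists_eq_add_of_le hj'
    rw [Nat.add_sub_cancel_left, pow_add, mul_assoc, ← mul_pow]
    simp
  rw [s1]
  simp only [zsmul_eq_mul, smul_eq_mul, mul_one, zero_add, Rat']
  push_cast
  rw [Nat.cast_choose ℝ hj', Nat.factorial_succ (2 * j)]
  push_cast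
  field_simp
end

section
/- (S³-identity) For all integers n ≥ 1 and ω ≥ 2n: Σ_{j=0}^{ω} [Γ(ω+5/2)/((ω-j)! (j+n)! (2j+3))] · Σ_{l=0}^{j+1} (-1)^l l² (l²-1)^{j+n} / ((j+l+1)!(j-l+1)!) = (-1)^{n+1} √π / (8 · n!). -/
open Finset Real

section helpers

open Polynomial

/-- inner sum -/
noncomputable def innerC (j p : ℕ) : ℝ := ∑ l ∈ range (j + 2),
          ((-1 : ℝ) ^ l * (l : ℝ) ^ 2 * ((l : ℝ) ^ 2 - 1) ^ p) /
            (Nat.factorial (j + l + 1) * Nat.factorial (j + 1 - l))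

lemma innerC_zero_zero : innerC 0 0 = -1/2 := by
  simp [innerC, Finset.sum_range_succ]

lemma innerC_zero_succ (p : ℕ) : innerC 0 (p+1) = 0 := by
  simp [innerC, Finset.sum_range_succ]

lemma innerC_step (j p : ℕ) :
    innerC (j+1) (p+1) = ((j:ℝ)+1)*(j+3) * innerC (j+1) p - innerC j p := by
  unfold innerC
  rw [Finset.sum_range_succ _ (j+2), Finset.sum_range_succ _ (j+2), mul_add, Finset.mul_sum,
    add_sub_right_comm, ← Finset.sum_sub_distrib]
  congr 1
  · apply Finset.sum_congr rfl
    intro l hl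
    rw [Finset.mem_range] at hl
    obtain ⟨k, hk⟩ : ∃ k, j + 1 = l + k := ⟨j+1-l, by omega⟩
    have e1 : j + 1 + l + 1 = (j + l + 1) + 1 := by omega
    have e2 : j + 1 + 1 - l = k + 1 := by omega
    have e3 : j + 1 - l = k := by omega
    have hj : (j:ℝ) = l + k - 1 := by
      have : ((j+1 : ℕ):ℝ) = ((l + k : ℕ):ℝ) := by rw [hk]
      push_cast at this; linarith
    rw [e1, e2, e3, Nat.factorial_succ (j+l+1), Nat.factorial_succ k]
    have h1 := Nat.factorial_ne_zero (j+l+1)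
    have h2 := Nat.factorial_ne_zero k
    have h3 : ((j + l + 1 + 1 : ℕ):ℝ) ≠ 0 := by positivity
    push_cast at h3 ⊢
    field_simp
    rw [hj]
    ring
  · have e2 : j + 1 + 1 - (j+2) = 0 := by omega
    rw [e2]
    push_cast
    ring

lemma innerC_partial (j L : ℕ) (hL : L ≤ j + 2) :
    ∑ l ∈ range L, ((-1 : ℝ) ^ l * (l : ℝ) ^ 2) /
            (Nat.factorial (j + l + 2) * Nat.factorial (j + 2 - l))
     = - ((-1:ℝ)^L * L * (L-1)) * (j+L+2) / (2*(j+1)* (Nat.factorial (j + L + 2) * Nat.factorial (j + 2 - L))) := by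
  induction L with
  | zero => simp
  | succ l ih =>
    rw [Finset.sum_range_succ, ih (by omega)]
    obtain ⟨k, hk⟩ : ∃ k, j + 1 = l + k := ⟨j+1-l, by omega⟩
    have e1 : j + (l + 1) + 2 = (j + l + 2) + 1 := by omega
    have e2 : j + 2 - l = k + 1 := by omega
    have e3 : j + 2 - (l + 1) = k := by omega
    have hj : (j:ℝ) = l + k - 1 := by
      have : ((j+1 : ℕ):ℝ) = ((l + k : ℕ):ℝ) := by rw [hk]
      push_cast at this; linarith
    rw [e1, e2, e3, Nat.factorial_succ (j+l+2), Nat.factorial_succ k]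
    have h1 := Nat.factorial_ne_zero (j+l+2)
    have h2 := Nat.factorial_ne_zero k
    have h3 : ((j + l + 2 + 1 : ℕ):ℝ) ≠ 0 := by positivity
    have h4 : (j:ℝ) + 1 ≠ 0 := by positivity
    push_cast at h3 ⊢
    field_simp
    rw [hj]
    ring

lemma innerC_succ_zero (j : ℕ) : innerC (j+1) 0 = 0 := by
  have h := innerC_partial j (j+2) le_rfl
  unfold innerC
  rw [Finset.sum_range_succ]
  have e : ∀ l, j + 1 + l + 1 = j + l + 2 := by intro l; omega
  have e' : j + 1 + 1 = j + 2 := by omega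
  simp only [pow_zero, mul_one, e, e']
  rw [h]
  have h1 := Nat.factorial_ne_zero (j+(j+2)+2)
  have h4 : (j:ℝ) + 1 ≠ 0 := by positivity
  push_cast
  field_simp
  ring

lemma innerC_lt (j p : ℕ) (h : p < j) : innerC j p = 0 := by
  induction p generalizing j with
  | zero => obtain ⟨i, rfl⟩ : ∃ i, j = i + 1 := ⟨j-1, by omega⟩
            exact innerC_succ_zero i
  | succ p ih =>
    obtain ⟨i, rfl⟩ : ∃ i, j = i + 1 := ⟨j-1, by omega⟩
    rw [innerC_step, ih _ (by omega), ih _ (by omega)]; simp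

lemma innerC_eq (H : ℕ → ℝ → ℝ) (h0 : ∀ x, H 0 x = 1) (hz : ∀ n, H (n+1) 0 = 0)
    (hs : ∀ n x, H (n+1) x = H (n+1) (x-1) + x*(x+2)*H n x) (j n : ℕ) :
    innerC j (j+n) = 1/2 * (-1)^(j+1) * H n j := by
  induction j generalizing n with
  | zero => cases n with
    | zero => simp [innerC_zero_zero, h0]; norm_num
    | succ n => simp [innerC_zero_succ, hz]
  | succ j ih =>
    induction n with
    | zero => 
      have := ih 0
      rw [h0] at this ⊢
      rw [add_zero] at this ⊢
      rw [innerC_step, innerC_lt _ _ (by omega), this]; ring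
    | succ n ihn =>
      have e : j + 1 + (n+1) = (j + 1 + n) + 1 := by omega
      rw [e, innerC_step, ihn, hs, show j + 1 + n = j + (n+1) by omega, ih]
      push_cast
      rw [show (j:ℝ) + 1 - 1 = j by ring]
      ring

lemma exists_solve (n : ℕ) (hn : 1 ≤ n) (d : ℕ) : ∀ Q : ℝ[X], Q.natDegree ≤ d →
    ∃ P : ℝ[X], P.natDegree ≤ d ∧ ∀ x, (x + n) * P.eval x - x * P.eval (x-1) = Q.eval x := by
  induction d with
  | zero =>
    intro Q hQ
    rw [Polynomial.eq_C_of_natDegree_le_zero hQ]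
    refine ⟨C (Q.coeff 0 / n), by simp, ?_⟩
    intro x
    have : (n:ℝ) ≠ 0 := by positivity
    simp; field_simp; ring
  | succ d ih =>
    intro Q hQ
    set c := Q.coeff (d+1) / (n + d + 1) with hc
    set R : ℝ[X] := Q - C c * ((X + C (n:ℝ)) * X^(d+1) - X * (X - C 1)^(d+1)) with hR
    have key : (((X + C (n:ℝ)) * X^(d+1) - X * (X - C 1)^(d+1) : ℝ[X]) -
        C ((n:ℝ) + d + 1) * X^(d+1)).natDegree ≤ d := by
      have e : (((X + C (n:ℝ)) * X^(d+1) - X * (X - C 1)^(d+1) : ℝ[X]) -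
          C ((n:ℝ) + d + 1) * X^(d+1)) =
          X * (X^(d+1) - (X + C (-1))^(d+1) - C ((d:ℝ)+1) * X^d) := by
        simp only [map_add, map_neg]; ring
      rw [e, natDegree_le_iff_coeff_eq_zero]
      intro N hN
      obtain ⟨M, rfl⟩ : ∃ M, N = M + 1 := ⟨N-1, by omega⟩
      rw [coeff_X_mul, coeff_sub, coeff_sub, coeff_X_add_C_pow, coeff_C_mul, coeff_X_pow,
        coeff_X_pow]
      rcases lt_trichotomy M (d+1) with h | h | h
      · obtain rfl : M = d := by omega
        simp
      · subst h; simp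
      · rw [Nat.choose_eq_zero_of_lt h, if_neg (by omega), if_neg (by omega)]; simp
    have hRd : R.natDegree ≤ d := by
      have hcc : C c * C ((n:ℝ)+d+1) = C (Q.coeff (d+1)) := by
        rw [← C_mul, hc]; congr 1; field_simp
      have : R = (Q - C (Q.coeff (d+1)) * X^(d+1)) - C c * (((X + C (n:ℝ)) * X^(d+1) - X * (X - C 1)^(d+1) : ℝ[X]) -
        C ((n:ℝ) + d + 1) * X^(d+1)) := by
        rw [hR, ← hcc]; ring
      rw [this]
      refine (natDegree_sub_le _ _).trans (max_le ?_ ((natDegree_C_mul_le _ _).trans key))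
      rw [natDegree_le_iff_coeff_eq_zero] at hQ ⊢
      intro N hN
      rcases eq_or_ne N (d+1) with rfl | h
      · simp
      · simp [coeff_X_pow, h, hQ N (by omega)]
    obtain ⟨P, hP, hPe⟩ := ih R hRd
    refine ⟨P + C c * X^(d+1), ?_, ?_⟩
    · refine (natDegree_add_le _ _).trans (max_le (by omega) (natDegree_C_mul_X_pow_le _ _))
    · intro x
      have := hPe x
      rw [hR] at this
      simp at this ⊢
      linarith

/-- The polynomials `P_n` of degree at most `2n`. -/
noncomputable def Pseq : (n : ℕ) → {P : ℝ[X] // P.natDegree ≤ 2 * n}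
  | 0 => ⟨1, by simp⟩
  | n + 1 =>
    have h : (X * (X + C 2) * (Pseq n).1 : ℝ[X]).natDegree ≤ 2 * (n + 1) := by
      have h1 := (Pseq n).2
      have h2 : (X * (X + C 2) : ℝ[X]).natDegree ≤ 2 := by compute_degree
      exact natDegree_mul_le.trans (by omega)
    ⟨Classical.choose (exists_solve (n+1) (by omega) _ _ h),
      (Classical.choose_spec (exists_solve (n+1) (by omega) _ _ h)).1⟩

lemma Pseq_succ (n : ℕ) (x : ℝ) : (x + (n + 1)) * (Pseq (n+1)).1.eval x
    - x * (Pseq (n+1)).1.eval (x-1) = x * (x+2) * (Pseq n).1.eval x := by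
  have h : (X * (X + C 2) * (Pseq n).1 : ℝ[X]).natDegree ≤ 2 * (n + 1) := by
      have h1 := (Pseq n).2
      have h2 : (X * (X + C 2) : ℝ[X]).natDegree ≤ 2 := by compute_degree
      exact natDegree_mul_le.trans (by omega)
  have := (Classical.choose_spec (exists_solve (n+1) (by omega) _ _ h)).2 x
  rw [Pseq]
  simpa using this

/-- `H_n = (x+1)...(x+n) P_n` -/
noncomputable def Hpol (n : ℕ) : ℝ[X] := (Pseq n).1 * ∏ i ∈ range n, (X + C ((i:ℝ) + 1))

lemma Hpol_zero (x : ℝ) : (Hpol 0).eval x = 1 := by simp [Hpol, Pseq]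

lemma Hpol_eval (n : ℕ) (x : ℝ) :
    (Hpol n).eval x = (Pseq n).1.eval x * ∏ i ∈ range n, (x + (i + 1)) := by
  simp [Hpol, eval_prod]

lemma Hpol_succ_zero (n : ℕ) : (Hpol (n+1)).eval 0 = 0 := by
  have := Pseq_succ n 0
  have h : (n:ℝ) + 1 ≠ 0 := by positivity
  simp [h] at this
  simp [Hpol_eval, this]

lemma Hpol_step (n : ℕ) (x : ℝ) :
    (Hpol (n+1)).eval x = (Hpol (n+1)).eval (x-1) + x * (x+2) * (Hpol n).eval x := by
  rw [Hpol_eval, Hpol_eval, Hpol_eval, prod_range_succ, prod_range_succ']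
  have : ∀ i : ℕ, x - 1 + (((i + 1 : ℕ):ℝ) + 1) = x + (i + 1) := by intro i; push_cast; ring
  simp only [this]
  have := Pseq_succ n x
  push_cast
  linear_combination (∏ i ∈ range n, (x + ((i:ℝ) + 1))) * this

/-- generating function -/
noncomputable def Gser (x : ℝ) : PowerSeries ℝ := PowerSeries.mk fun n => (Hpol n).eval x

lemma Gser_step (x : ℝ) :
    Gser (x-1) = Gser x * (1 - PowerSeries.C (x * (x+2)) * PowerSeries.X) := by
  ext n
  rw [mul_sub, mul_one, mul_left_comm, map_sub, PowerSeries.coeff_C_mul]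
  cases n with
  | zero => simp [Gser, Hpol_zero]
  | succ n =>
    rw [PowerSeries.coeff_succ_mul_X]
    simp only [Gser, PowerSeries.coeff_mk]
    rw [Hpol_step n x]; ring

lemma Gser_zero : Gser 0 = 1 := by
  ext n
  cases n with
  | zero => simp [Gser, Hpol_zero]
  | succ n => simp [Gser, Hpol_succ_zero, PowerSeries.coeff_one]

lemma Gser_neg_three : Gser (-3) = 1 + PowerSeries.X := by
  have h1 := Gser_step 0
  have h2 := Gser_step (-1)
  have h3 := Gser_step (-2)
  norm_num at h1 h2 h3
  rw [h3, h2, h1, Gser_zero]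
  ring

lemma Gser_per (x : ℝ) : Gser x * Gser (-3 - x) = Gser (x-1) * Gser (-3-(x-1)) := by
  have h1 := Gser_step x
  have h2 := Gser_step (-2 - x)
  rw [show -2 - x - 1 = -3 - x by ring, show (-2-x)*(-2-x+2) = x*(x+2) by ring] at h2
  rw [h1, h2, show -3-(x-1) = -2-x by ring]
  ring

lemma Gser_nat (k : ℕ) : Gser k * Gser (-3 - k) = 1 + PowerSeries.X := by
  induction k with
  | zero => simp [Gser_zero, Gser_neg_three]
  | succ k ih => rw [Gser_per, ← ih]; push_cast; simp

lemma Gser_all (x : ℝ) : Gser x * Gser (-3 - x) = 1 + PowerSeries.X := by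
  ext n
  set F : ℝ[X] := ∑ p ∈ antidiagonal n, Hpol p.1 * (Hpol p.2).comp (C (-3) - X) with hF
  have hev : ∀ y, PowerSeries.coeff n (Gser y * Gser (-3 - y)) = F.eval y := by
    intro y
    rw [PowerSeries.coeff_mul, hF, eval_finsetSum]
    simp [Gser]
  have hFc : F = C (PowerSeries.coeff n (1 + PowerSeries.X : PowerSeries ℝ)) := by
    apply Polynomial.eq_of_infinite_eval_eq
    apply Set.Infinite.mono (s := Set.range (fun k : ℕ => (k:ℝ)))
    · rintro _ ⟨k, rfl⟩
      simp only [Set.mem_ofPred_eq]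
      rw [← hev, Gser_nat, eval_C]
    · exact Set.infinite_range_of_injective Nat.cast_injective
  rw [hev, hFc, eval_C]

lemma H_rec (n : ℕ) : 2 * ((n:ℝ) + 1) * (Hpol (n+1)).eval (-3/2) =
    (1 - 2 * n) * (Hpol n).eval (-3/2) := by
  have h := Gser_all (-3/2)
  rw [show (-3 - -3/2 : ℝ) = -3/2 by norm_num] at h
  set G := Gser (-3/2) with hG
  have hd := congrArg (PowerSeries.derivative ℝ) h
  rw [Derivation.leibniz] at hd
  simp only [smul_eq_mul, map_add, PowerSeries.derivative_X, Derivation.map_one_eq_zero, zero_add] at hd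
  have h2 : 2 * (PowerSeries.derivative ℝ G + PowerSeries.derivative ℝ G * PowerSeries.X) = G := by
    linear_combination G * hd - 2 * PowerSeries.derivative ℝ G * h
  have h3 := congrArg (PowerSeries.coeff n) h2
  rw [show (2 : PowerSeries ℝ) = PowerSeries.C 2 from (map_ofNat PowerSeries.C 2).symm, PowerSeries.coeff_C_mul, map_add] at h3
  cases n with
  | zero =>
    simp [PowerSeries.coeff_derivative, hG, Gser] at h3
    simp; linarith
  | succ n =>
    rw [PowerSeries.coeff_succ_mul_X, PowerSeries.coeff_derivative, PowerSeries.coeff_derivative] at h3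
    simp only [hG, Gser, PowerSeries.coeff_mk] at h3
    push_cast at h3 ⊢
    linarith

lemma prod_ne (n : ℕ) : ∏ i ∈ range n, ((-3/2 : ℝ) + (i + 1)) ≠ 0 := by
  rw [prod_ne_zero_iff]
  intro i _ h
  have : (2 * i : ℝ) = 1 := by linarith
  have : 2 * i = 1 := by exact_mod_cast this
  omega

lemma P_val (n : ℕ) : (Pseq n).1.eval (-3/2) = (-1)^n / Nat.factorial n := by
  induction n with
  | zero => simp [Pseq]
  | succ n ih =>
    have h := H_rec n
    rw [Hpol_eval, Hpol_eval, ih] at h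
    have h1 := prod_ne (n+1)
    have h2 := Nat.factorial_ne_zero n
    rw [prod_range_succ] at h h1
    rw [Nat.factorial_succ]
    obtain ⟨h3, h4⟩ := mul_ne_zero_iff.1 h1
    have h5 : (n:ℝ) + 1 ≠ 0 := by positivity
    apply mul_right_cancel₀ h1
    apply mul_left_cancel₀ (mul_ne_zero two_ne_zero h5)
    rw [h]
    push_cast
    field_simp
    ring

lemma fwd_inv (w : ℕ) (x : ℝ) (hx : 0 < x) : (fwdDiff (1:ℝ))^[w] (fun y : ℝ => y⁻¹) x
    = (-1)^w * Nat.factorial w * Gamma x / Gamma (x + w + 1) := by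
  induction w generalizing x with
  | zero => 
    have := (Gamma_pos_of_pos hx).ne'
    simp [Gamma_add_one hx.ne']
    field_simp
  | succ w ih =>
    rw [Function.iterate_succ_apply', fwdDiff, ih x hx, ih (x+1) (by linarith)]
    have h1 := (Gamma_pos_of_pos (show 0 < x + w + 1 by positivity)).ne'
    have h2 : x + w + 1 ≠ 0 := by positivity
    rw [show x + 1 + w + 1 = x + w + 1 + 1 by ring,
      show x + ((w+1 : ℕ):ℝ) + 1 = x + w + 1 + 1 by push_cast; ring, Gamma_add_one h2, Gamma_add_one hx.ne', Nat.factorial_succ]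
    push_cast
    field_simp
    ring

lemma neg_pow_sub (w j : ℕ) (h : j ≤ w) : (-1:ℝ)^(w-j) = (-1)^w * (-1)^j := by
  obtain ⟨k, rfl⟩ := Nat.exists_eq_add_of_le h
  rw [Nat.add_sub_cancel_left, pow_add]
  have : ((-1:ℝ)^j)*(-1)^j = 1 := by rw [← mul_pow]; simp
  linear_combination (-(-1:ℝ)^k) * this

lemma sum_inv (w : ℕ) : ∑ j ∈ range (w+1), (-1:ℝ)^j * w.choose j * (2 * (j:ℝ) + 3)⁻¹
    = Nat.factorial w * (sqrt π / 4) / Gamma (w + 5/2) := by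
  have h := fwd_inv w (3/2) (by norm_num)
  rw [fwdDiff_iter_eq_sum_shift] at h
  have hG : Gamma (3/2) = sqrt π / 2 := by
    rw [show (3/2:ℝ) = 1/2 + 1 by norm_num, Gamma_add_one (by norm_num), Gamma_one_half_eq]; ring
  rw [hG, show (3/2:ℝ) + w + 1 = w + 5/2 by ring] at h
  have hs : ((-1:ℝ)^w)*(-1)^w = 1 := by rw [← mul_pow]; simp
  calc _ = (-1)^w/2 * ∑ k ∈ range (w+1), ((-1 : ℤ) ^ (w - k) * w.choose k) • ((3/2:ℝ) + k • (1:ℝ))⁻¹ := by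
        rw [mul_sum]
        apply sum_congr rfl
        intro j hj
        rw [mem_range] at hj
        rw [zsmul_eq_mul]
        push_cast
        rw [neg_pow_sub w j (by omega)]
        have : (2 * (j:ℝ) + 3)⁻¹ = (3/2 + (j:ℝ))⁻¹ / 2 := by
          have : (3/2 + (j:ℝ)) ≠ 0 := by positivity
          have : (2 * (j:ℝ) + 3) ≠ 0 := by positivity
          field_simp; ring
        rw [this]
        simp only [nsmul_eq_mul, mul_one]
        linear_combination (-(-1)^j * (w.choose j) * (3/2 + (j:ℝ))⁻¹ / 2) * hs
    _ = _ := by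
      rw [h]
      linear_combination (Nat.factorial w * (sqrt π / 4) / Gamma (w + 5/2)) * hs

lemma sum_poly (w : ℕ) (Q : ℝ[X]) (hQ : Q.natDegree < w) :
    ∑ j ∈ range (w+1), (-1:ℝ)^j * w.choose j * Q.eval (j:ℝ) = 0 := by
  have h := congrFun (Polynomial.fwdDiff_iter_eq_zero_of_degree_lt hQ) 0
  rw [fwdDiff_iter_eq_sum_shift] at h
  have hs : ((-1:ℝ)^w)*(-1)^w = 1 := by rw [← mul_pow]; simp
  rw [Pi.zero_apply] at h
  rw [← mul_zero ((-1:ℝ)^w), ← h, mul_sum]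
  apply sum_congr rfl
  intro j hj
  rw [mem_range] at hj
  rw [zsmul_eq_mul]
  push_cast
  rw [neg_pow_sub w j (by omega)]
  simp only [nsmul_eq_mul, mul_one, zero_add]
  linear_combination (-(-1)^j * (w.choose j) * Q.eval (j:ℝ)) * hs

lemma sum_P (n w : ℕ) (hn : 1 ≤ n) (hw : 2 * n ≤ w) :
    ∑ j ∈ range (w+1), (-1:ℝ)^j * w.choose j * ((Pseq n).1.eval (j:ℝ) * (2 * (j:ℝ) + 3)⁻¹)
    = (-1)^n / Nat.factorial n * (Nat.factorial w * (sqrt π / 4) / Gamma (w + 5/2)) := by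
  set P := (Pseq n).1 with hP
  have hd : P.natDegree ≤ 2 * n := (Pseq n).2
  set Q := P /ₘ (X - C (-3/2)) with hQ
  have hPQ : ∀ x, P.eval x = (x + 3/2) * Q.eval x + (-1)^n / Nat.factorial n := by
    intro x
    rw [← P_val n, ← hP]
    have := congrArg (eval x) (modByMonic_add_div P (X - C (-3/2 : ℝ)))
    rw [modByMonic_X_sub_C_eq_C_eval] at this
    simp at this
    rw [← this]; ring
  have hQd : Q.natDegree < w := by
    rw [hQ, natDegree_divByMonic _ (monic_X_sub_C _), natDegree_X_sub_C]
    omega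
  have h0 := sum_poly w Q hQd
  rw [← sum_inv, mul_sum]
  rw [← sub_eq_zero, ← sum_sub_distrib, ← mul_zero (1/2:ℝ), ← h0, mul_sum]
  apply sum_congr rfl
  intro j _
  rw [hPQ]
  have : (2 * (j:ℝ) + 3) ≠ 0 := by positivity
  field_simp
  ring

end helpers

/-- the `S³`-identity: for all integers `n ≥ 1`, `ω ≥ 2n`,
`Σ_{j=0}^{ω} [Γ(ω+5/2)/((ω-j)!(j+n)!(2j+3))]
  Σ_{l=0}^{j+1} (-1)^l l² (l²-1)^{j+n}/((j+l+1)!(j-l+1)!) = (-1)^{n+1}√π/(8 n!)`. -/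
theorem S3_identity (n ω : ℕ) (hn : 1 ≤ n) (hω : 2 * n ≤ ω) :
    ∑ j ∈ range (ω + 1),
      (Real.Gamma ((ω : ℝ) + 5 / 2) /
          ((Nat.factorial (ω - j) : ℝ) * Nat.factorial (j + n) * (2 * j + 3))) *
        ∑ l ∈ range (j + 2),
          ((-1 : ℝ) ^ l * (l : ℝ) ^ 2 * ((l : ℝ) ^ 2 - 1) ^ (j + n)) /
            (Nat.factorial (j + l + 1) * Nat.factorial (j + 1 - l)) =
      (-1 : ℝ) ^ (n + 1) * Real.sqrt π / (8 * Nat.factorial n) := by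
  have hG := (Gamma_pos_of_pos (show (0:ℝ) < ω + 5/2 by positivity)).ne'
  have hf := Nat.factorial_ne_zero ω
  have hfac : ∀ j m : ℕ, (Nat.factorial (j + m) : ℝ) =
      Nat.factorial j * ∏ i ∈ range m, ((j:ℝ) + (i + 1)) := by
    intro j m
    induction m with
    | zero => simp
    | succ m ih =>
      rw [← add_assoc, Nat.factorial_succ, prod_range_succ]
      push_cast
      rw [ih]; ring
  have key : ∀ j ∈ range (ω + 1), (Real.Gamma ((ω : ℝ) + 5 / 2) /
          ((Nat.factorial (ω - j) : ℝ) * Nat.factorial (j + n) * (2 * j + 3))) *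
        innerC j (j + n) = (-Real.Gamma ((ω : ℝ) + 5 / 2) / (2 * Nat.factorial ω)) *
        ((-1:ℝ)^j * ω.choose j * ((Pseq n).1.eval (j:ℝ) * (2 * (j:ℝ) + 3)⁻¹)) := by
    intro j hj
    rw [mem_range] at hj
    rw [innerC_eq (fun n x => (Hpol n).eval x) Hpol_zero Hpol_succ_zero Hpol_step, Hpol_eval,
      Nat.cast_choose ℝ (show j ≤ ω by omega), hfac]
    have h1 := Nat.factorial_ne_zero j
    have h2 := Nat.factorial_ne_zero (ω - j)
    have h3 : ∏ i ∈ range n, ((j:ℝ) + (i + 1)) ≠ 0 := by positivity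
    have : (2 * (j:ℝ) + 3) ≠ 0 := by positivity
    field_simp
    ring
  have hsum := sum_congr rfl key
  simp only [innerC] at hsum
  rw [hsum, ← mul_sum, sum_P n ω hn hω]
  have h1 := Nat.factorial_ne_zero n
  field_simp
  ring
end
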